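/- arXiv:2408.16085 — 3 statements merged into one kernel-verified Lean document; each statement's English description precedes it below -/
import Mathlib

section
/- Every 1-planar finite simple graph of girth at least 5 on n vertices has at most (12/5)·n edges. -/
open unitInterval

/-- A (good) drawing of a simple graph in the plane: vertices map to distinct
points, each edge is drawn as a simple continuous arc between its endpoints,
arcs avoid vertex points other than their endpoints, two arcs meet in finitely
many points, and no three arcs pass through a common interior point. -/
structure PlaneDrawing {V : Type*} (G : SimpleGraph V) where
  pos : V → ℝ × ℝ
  pos_inj : Function.Injective pos
  arc : ∀ ⦃u v : V⦄, G.Adj u v → Path (pos u) (pos v)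
  arc_symm : ∀ ⦃u v : V⦄ (h : G.Adj u v), arc h.symm = (arc h).symm
  arc_inj : ∀ ⦃u v : V⦄ (h : G.Adj u v), Function.Injective (arc h)
  no_vertex_mem : ∀ ⦃u v : V⦄ (h : G.Adj u v) (w : V) (t : I),
      arc h t = pos w → w = u ∨ w = v
  finite_inter : ∀ ⦃u v x y : V⦄ (h₁ : G.Adj u v) (h₂ : G.Adj x y),
      s(u, v) ≠ s(x, y) →
      (Set.range (arc h₁) ∩ Set.range (arc h₂)).Finite
  no_triple_point : ∀ ⦃u₁ v₁ u₂ v₂ u₃ v₃ : V⦄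
      (h₁ : G.Adj u₁ v₁) (h₂ : G.Adj u₂ v₂) (h₃ : G.Adj u₃ v₃),
      s(u₁, v₁) ≠ s(u₂, v₂) → s(u₁, v₁) ≠ s(u₃, v₃) → s(u₂, v₂) ≠ s(u₃, v₃) →
      ∀ t₁ t₂ t₃ : I, t₁ ≠ 0 → t₁ ≠ 1 → t₂ ≠ 0 → t₂ ≠ 1 → t₃ ≠ 0 → t₃ ≠ 1 →
      arc h₁ t₁ = arc h₂ t₂ → arc h₂ t₂ = arc h₃ t₃ → False

namespace PlaneDrawing

variable {V : Type*} {G : SimpleGraph V} (D : PlaneDrawing G)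

/-- `p` is an interior point of the arc of the edge `uv`. -/
def IsInteriorPoint {u v : V} (h : G.Adj u v) (p : ℝ × ℝ) : Prop :=
  ∃ t : I, t ≠ 0 ∧ t ≠ 1 ∧ D.arc h t = p

/-- The set of crossing points of the drawing: points where the interiors of
the arcs of two distinct edges meet. -/
def crossings : Set (ℝ × ℝ) :=
  {p | ∃ (u v x y : V) (h₁ : G.Adj u v) (h₂ : G.Adj x y),
    s(u, v) ≠ s(x, y) ∧ D.IsInteriorPoint h₁ p ∧ D.IsInteriorPoint h₂ p}

/-- The number of crossings of the drawing. -/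
noncomputable def crossingCount : ℕ := D.crossings.ncard

/-- The set of crossing points lying on the edge `uv`. -/
def edgeCrossings {u v : V} (h : G.Adj u v) : Set (ℝ × ℝ) :=
  {p | D.IsInteriorPoint h p ∧
    ∃ (x y : V) (h₂ : G.Adj x y), s(u, v) ≠ s(x, y) ∧ D.IsInteriorPoint h₂ p}

/-- A drawing is `k`-plane if every edge is involved in at most `k` crossings. -/
def IsKPlane (k : ℕ) : Prop :=
  ∀ ⦃u v : V⦄ (h : G.Adj u v), (D.edgeCrossings h).ncard ≤ k

end PlaneDrawing

/-- The crossing number of a graph: the minimum number of crossings over all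
drawings. -/
noncomputable def crossingNumber {V : Type*} (G : SimpleGraph V) : ℕ :=
  sInf {c : ℕ | ∃ D : PlaneDrawing G, D.crossingCount = c}

/-- A graph is `k`-planar if it admits a drawing in which every edge is
involved in at most `k` crossings. -/
def KPlanar {V : Type*} (G : SimpleGraph V) (k : ℕ) : Prop :=
  ∃ D : PlaneDrawing G, D.IsKPlane k

/-- `G` has no cycle of length `ℓ`. -/
def HasNoCycleOfLength {V : Type*} (G : SimpleGraph V) (ℓ : ℕ) : Prop :=
  ∀ (v : V) (c : G.Walk v v), c.IsCycle → c.length ≠ ℓ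

/-! ### Algebraic duals -/

open Classical in
/-- `P` has an algebraic dual over `ZMod 2`: each edge `e` gets two sides `L e`, `R e` so that the
edge boundary of each face is a cycle, and each cycle is a cut of the dual graph. -/
def HasAlgDual {W : Type*} [Fintype W] (P : SimpleGraph W) : Prop :=
  ∃ (F : Type) (L R : Sym2 W → F),
    (∀ f w, ∑ e ∈ P.edgeFinset with w ∈ e,
      ((if L e = f then 1 else 0) + (if R e = f then 1 else 0) : ZMod 2) = 0) ∧
    ∀ C : Sym2 W → ZMod 2, (∀ w, ∑ e ∈ P.edgeFinset with w ∈ e, C e = 0) →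
      ∃ h : F → ZMod 2, ∀ e ∈ P.edgeSet, C e = h (L e) + h (R e)

namespace PlaneGrid

/-- An edge of the square grid: its source, and whether it is horizontal. -/
abbrev Edge := (ℤ × ℤ) × Bool

/-- The second endpoint of a grid edge; the first one is `g.1`. -/
def tgt (g : Edge) : ℤ × ℤ := if g.2 then (g.1.1 + 1, g.1.2) else (g.1.1, g.1.2 + 1)

/-- The second face at a grid edge; the first one is `g.1`. -/
def side (g : Edge) : ℤ × ℤ := if g.2 then (g.1.1, g.1.2 - 1) else (g.1.1 - 1, g.1.2)

/-- Adjacency in the square grid. -/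
def Adj (x y : ℤ × ℤ) : Prop := ∃ g : Edge, (g.1 = x ∧ tgt g = y) ∨ (g.1 = y ∧ tgt g = x)

lemma Adj.symm {x y : ℤ × ℤ} : Adj x y → Adj y x := fun ⟨g, hg⟩ => ⟨g, hg.symm⟩

/-- Any two points of `S` are joined by a grid walk inside `S`. -/
def Conn (S : Set (ℤ × ℤ)) : Prop :=
  ∀ x ∈ S, ∀ y ∈ S, Relation.ReflTransGen (fun a b => Adj a b ∧ a ∈ S ∧ b ∈ S) x y

/-- The boundary map on finitely supported chains of the grid. -/
noncomputable def bdry : (Edge →₀ ZMod 2) →ₗ[ZMod 2] ((ℤ × ℤ) →₀ ZMod 2) :=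
  Finsupp.lsum (ZMod 2) fun g => Finsupp.lsingle g.1 + Finsupp.lsingle (tgt g)

lemma bdry_single (g : Edge) (a : ZMod 2) :
    bdry (Finsupp.single g a) = Finsupp.single g.1 a + Finsupp.single (tgt g) a := by
  simp [bdry]

lemma bdry_apply (c : Edge →₀ ZMod 2) (i j : ℤ) :
    bdry c (i, j) = c ((i, j), true) + c ((i - 1, j), true) + c ((i, j), false)
      + c ((i, j - 1), false) := by
  induction c using Finsupp.induction_linear with
  | zero => simp
  | add f g hf hg => rw [map_add, Finsupp.add_apply, hf, hg]; simp only [Finsupp.add_apply]; ring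
  | single g a =>
    obtain ⟨⟨k, l⟩, b⟩ := g
    rw [bdry_single]
    cases b <;>
    simp only [Finsupp.add_apply, Finsupp.single_apply, tgt, Prod.mk.injEq, and_true, and_false,
      if_true, if_false, Bool.false_eq_true, Bool.true_eq_false, add_zero, zero_add,
      eq_sub_iff_add_eq]

lemma add_self_two (a : ZMod 2) : a + a = 0 := CharTwo.add_self_eq_zero a

/-- A finitely supported cycle of the grid is the coboundary of a function on faces. -/
lemma exists_potential (c : Edge →₀ ZMod 2) (hc : bdry c = 0) :
    ∃ h : ℤ × ℤ → ZMod 2, ∀ g, c g = h g.1 + h (side g) := by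
  obtain ⟨M, hM⟩ : ∃ M : ℤ, ∀ g ∈ c.support, M < g.1.2 := by
    obtain ⟨M, hM⟩ := (c.support.image fun g => g.1.2).bddBelow
    exact ⟨M - 1, fun g hg => by
      have : M ≤ g.1.2 := hM (Finset.mem_coe.2 (Finset.mem_image_of_mem _ hg))
      omega⟩
  have h0 : ∀ i j b, j ≤ M → c ((i, j), b) = 0 := by
    intro i j b hj
    by_contra hne
    have := hM _ (Finsupp.mem_support_iff.2 hne)
    simp only at this; omega
  let h : ℤ × ℤ → ZMod 2 := fun z => ∑ k ∈ Finset.Ioc M z.2, c ((z.1, k), true)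
  have hlow : ∀ i j, j ≤ M → h (i, j) = 0 := by
    intro i j hj
    simp [h, Finset.Ioc_eq_empty (by omega : ¬ M < j)]
  have hstep : ∀ i j, h (i, j) = h (i, j - 1) + c ((i, j), true) := by
    intro i j
    by_cases hj : M < j
    · have : Finset.Ioc M j = insert j (Finset.Ioc M (j - 1)) := by
        ext; simp only [Finset.mem_Ioc, Finset.mem_insert]; omega
      change ∑ k ∈ Finset.Ioc M j, c ((i, k), true) = _
      rw [this, Finset.sum_insert (by simp), add_comm]
    · rw [hlow i j (by omega), hlow i (j - 1) (by omega), h0 i j _ (by omega), add_zero]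
  have hver : ∀ (n : ℕ) i, h (i, M + n) + h (i - 1, M + n) = c ((i, M + n), false) := by
    intro n
    induction n with
    | zero => intro i; simp [hlow, h0]
    | succ n ih =>
      intro i
      have hb := bdry_apply c i (M + (n + 1 : ℕ))
      have e : M + ((n + 1 : ℕ) : ℤ) - 1 = M + n := by push_cast; ring
      rw [hc, Finsupp.zero_apply, e] at hb
      rw [hstep i, hstep (i - 1), e]
      have := ih i
      linear_combination this - hb - add_self_two (c ((i, M + (n + 1 : ℕ)), false))
  refine ⟨h, ?_⟩
  rintro ⟨⟨i, j⟩, b⟩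
  cases b
  · simp only [side, Bool.false_eq_true, if_false]
    by_cases hj : j ≤ M
    · rw [h0 _ _ _ hj, hlow _ _ hj, hlow _ _ hj, add_zero]
    · obtain ⟨n, hn⟩ : ∃ n : ℕ, j = M + n := ⟨(j - M).toNat, by omega⟩
      rw [hn, hver]
  · simp only [side, if_true]
    rw [hstep i j]
    linear_combination - add_self_two (h (i, j - 1))

lemma exists_chain {S : Set (ℤ × ℤ)} {x y : ℤ × ℤ}
    (h : Relation.ReflTransGen (fun a b => Adj a b ∧ a ∈ S ∧ b ∈ S) x y) :
    ∃ c : Edge →₀ ZMod 2, bdry c = Finsupp.single x 1 + Finsupp.single y 1 ∧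
      ∀ g, c g ≠ 0 → g.1 ∈ S ∧ tgt g ∈ S := by
  induction h with
  | refl => exact ⟨0, by simp [← Finsupp.single_add, add_self_two], by simp⟩
  | @tail b d _ hbd ih =>
    obtain ⟨c, hc, hs⟩ := ih
    obtain ⟨⟨g, hg⟩, hb, hd⟩ := hbd
    have key : Finsupp.single g.1 1 + Finsupp.single (tgt g) (1 : ZMod 2) =
        Finsupp.single b 1 + Finsupp.single d 1 := by
      rcases hg with ⟨rfl, rfl⟩ | ⟨rfl, rfl⟩
      · rfl
      · rw [add_comm]
    refine ⟨c + Finsupp.single g 1, ?_, ?_⟩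
    · rw [map_add, bdry_single, hc, key, add_assoc, ← add_assoc (Finsupp.single b _),
        ← Finsupp.single_add, add_self_two, Finsupp.single_zero, zero_add]
    · intro g' hg'
      by_cases h : g' = g
      · subst h
        rcases hg with ⟨rfl, rfl⟩ | ⟨rfl, rfl⟩
        · exact ⟨hb, hd⟩
        · exact ⟨hd, hb⟩
      · exact hs g' (by simpa [Finsupp.single_apply, Ne.symm h] using hg')

open Classical in
/-- A finite minor of the square grid has an algebraic dual. -/
theorem hasAlgDual_of_minor {W : Type*} [Fintype W] (P : SimpleGraph W)
    (B : W → Finset (ℤ × ℤ)) (hne : ∀ w, (B w).Nonempty)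
    (hdisj : ∀ u v, u ≠ v → Disjoint (B u) (B v)) (hconn : ∀ w, Conn (B w : Set (ℤ × ℤ)))
    (hadj : ∀ u v, P.Adj u v → ∃ x ∈ B u, ∃ y ∈ B v, Adj x y) : HasAlgDual P := by
  have huniq : ∀ {z u v}, z ∈ B u → z ∈ B v → u = v := by
    intro z u v hu hv
    by_contra h
    exact Finset.disjoint_left.1 (hdisj u v h) hu hv
  have hg : ∀ e : Sym2 W, ∃ g : Edge, e ∈ P.edgeSet →
      ∃ u v, e = s(u, v) ∧ u ≠ v ∧ g.1 ∈ B u ∧ tgt g ∈ B v := by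
    intro e
    by_cases he : e ∈ P.edgeSet
    · induction e using Sym2.ind with
      | _ u v =>
        obtain ⟨x, hx, y, hy, g, ⟨rfl, rfl⟩ | ⟨rfl, rfl⟩⟩ := hadj u v he
        · exact ⟨g, fun _ => ⟨u, v, rfl, P.ne_of_adj he, hx, hy⟩⟩
        · exact ⟨g, fun _ => ⟨v, u, Sym2.eq_swap, (P.ne_of_adj he).symm, hy, hx⟩⟩
    · exact ⟨default, fun h => absurd h he⟩
  choose γ hγ using hg
  choose base hbase using hne
  have hinc : ∀ e ∈ P.edgeSet, ∀ w,
      ((if (γ e).1 ∈ B w then 1 else 0) + (if tgt (γ e) ∈ B w then 1 else 0) : ZMod 2) =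
        if w ∈ e then 1 else 0 := by
    intro e he w
    obtain ⟨u, v, rfl, huv, hu, hv⟩ := hγ e he
    have h1 : (γ s(u, v)).1 ∈ B w ↔ w = u := ⟨fun h => huniq h hu, fun h => h ▸ hu⟩
    have h2 : tgt (γ s(u, v)) ∈ B w ↔ w = v := ⟨fun h => huniq h hv, fun h => h ▸ hv⟩
    simp only [h1, h2, Sym2.mem_iff]
    by_cases hwu : w = u
    · subst hwu; simp [huv]
    · simp [hwu]
  have hγinj : ∀ e ∈ P.edgeSet, ∀ e' ∈ P.edgeSet, γ e = γ e' → e = e' := by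
    intro e he e' he' h
    obtain ⟨u, v, rfl, -, hu, hv⟩ := hγ e he
    obtain ⟨u', v', rfl, -, hu', hv'⟩ := hγ e' he'
    rw [h] at hu hv
    rw [huniq hu hu', huniq hv hv']
  have hγout : ∀ e ∈ P.edgeSet, ∀ w, ¬ ((γ e).1 ∈ B w ∧ tgt (γ e) ∈ B w) := by
    rintro e he w ⟨h1, h2⟩
    obtain ⟨u, v, rfl, huv, hu, hv⟩ := hγ e he
    exact huv ((huniq hu h1).trans (huniq h2 hv))
  let inside : Edge → Prop := fun g => ∃ w, g.1 ∈ B w ∧ tgt g ∈ B w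
  let allowed : Edge → Prop := fun g => inside g ∨ ∃ e ∈ P.edgeSet, γ e = g
  have hfin : {g | allowed g}.Finite := by
    have h1 : (((Finset.univ.biUnion B) ×ˢ (Finset.univ : Finset Bool) ∪ P.edgeFinset.image γ :
      Finset Edge) : Set Edge).Finite := Finset.finite_toSet _
    refine h1.subset ?_
    rintro g (⟨w, h, -⟩ | ⟨e, he, rfl⟩)
    · simp only [Finset.coe_union, Set.mem_union, Finset.mem_coe]
      left
      simp only [Finset.mem_product, Finset.mem_biUnion, Finset.mem_univ, true_and, and_true]
      exact ⟨w, h⟩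
    · simp only [Finset.coe_union, Set.mem_union, Finset.mem_coe]
      right
      exact Finset.mem_image_of_mem _ (by simpa using he)
  let r : ℤ × ℤ → ℤ × ℤ → Prop := fun a b => ∃ g, ¬ allowed g ∧ g.1 = a ∧ side g = b
  refine ⟨Quot r, fun e => Quot.mk r (γ e).1, fun e => Quot.mk r (side (γ e)), ?_, ?_⟩
  · intro f w
    let χ : ℤ × ℤ → ZMod 2 := fun a => if Quot.mk r a = f then 1 else 0
    let b : Edge →₀ ZMod 2 := Finsupp.onFinset hfin.toFinset (fun g => χ g.1 + χ (side g)) (by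
      intro g hg
      rw [Set.Finite.mem_toFinset]
      by_contra hna
      apply hg
      have : Quot.mk r g.1 = Quot.mk r (side g) := Quot.sound ⟨g, hna, rfl, rfl⟩
      simp only [χ, this, add_self_two])
    have hb : ∀ g, b g = χ g.1 + χ (side g) := fun g => rfl
    have hb0 : bdry b = 0 := by
      ext ⟨i, j⟩
      rw [bdry_apply]
      simp only [hb, side, if_true, Bool.false_eq_true, if_false, Finsupp.zero_apply]
      linear_combination add_self_two (χ (i, j)) + add_self_two (χ (i - 1, j)) +
        add_self_two (χ (i, j - 1)) + add_self_two (χ (i - 1, j - 1))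
    let φ : ((ℤ × ℤ) →₀ ZMod 2) →ₗ[ZMod 2] ZMod 2 :=
      Finsupp.lsum (ZMod 2) fun z => (if z ∈ B w then 1 else 0 : ZMod 2) • LinearMap.id
    have hφ : ∀ z a, φ (Finsupp.single z a) = if z ∈ B w then a else 0 := by
      intro z a
      simp only [φ, Finsupp.lsum_single]
      split_ifs <;> simp
    have hsum : ∀ c : Edge →₀ ZMod 2, φ (bdry c) = c.sum fun g a =>
        a * ((if g.1 ∈ B w then 1 else 0) + (if tgt g ∈ B w then 1 else 0)) := by
      intro c
      induction c using Finsupp.induction_linear with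
      | zero => simp
      | add f g hf hg =>
        rw [map_add, map_add, hf, hg, Finsupp.sum_add_index'] <;> intros <;> ring
      | single g a =>
        rw [bdry_single, map_add, hφ, hφ, Finsupp.sum_single_index] <;> simp [mul_add]
    have h0 := hsum b
    rw [hb0, map_zero] at h0
    rw [Finset.sum_filter]
    calc _ = ∑ e ∈ P.edgeFinset, b (γ e) * ((if (γ e).1 ∈ B w then 1 else 0) +
          (if tgt (γ e) ∈ B w then 1 else 0)) := by
            refine Finset.sum_congr rfl fun e he => ?_
            rw [hinc e (by simpa using he)]
            simp only [mul_ite, mul_one, mul_zero]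
            rfl
      _ = ∑ g ∈ P.edgeFinset.image γ, b g * ((if g.1 ∈ B w then 1 else 0) +
          (if tgt g ∈ B w then 1 else 0)) := by
            rw [Finset.sum_image]
            intro e he e' he' h
            exact hγinj e (by simpa using he) e' (by simpa using he') h
      _ = ∑ g ∈ P.edgeFinset.image γ ∪ b.support, b g * ((if g.1 ∈ B w then 1 else 0) +
          (if tgt g ∈ B w then 1 else 0)) := by
            refine Finset.sum_subset Finset.subset_union_left fun g hg hg' => ?_
            by_cases hbg : b g = 0
            · rw [hbg, zero_mul]
            have hall : allowed g := by
              by_contra hna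
              apply hbg
              have : Quot.mk r g.1 = Quot.mk r (side g) := Quot.sound ⟨g, hna, rfl, rfl⟩
              rw [hb]
              simp only [χ, this, add_self_two]
            obtain ⟨u, h1, h2⟩ | ⟨e, he, rfl⟩ := hall
            · have e1 : g.1 ∈ B w ↔ w = u := ⟨fun h => huniq h h1, fun h => h ▸ h1⟩
              have e2 : tgt g ∈ B w ↔ w = u := ⟨fun h => huniq h h2, fun h => h ▸ h2⟩
              simp only [e1, e2, add_self_two, mul_zero]
            · exact absurd (Finset.mem_image_of_mem _ (by simpa using he)) hg'
      _ = ∑ g ∈ b.support, b g * ((if g.1 ∈ B w then 1 else 0) +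
          (if tgt g ∈ B w then 1 else 0)) := by
            refine (Finset.sum_subset Finset.subset_union_right fun g hg hg' => ?_).symm
            rw [Finsupp.notMem_support_iff.1 hg', zero_mul]
      _ = 0 := h0.symm
  · intro C hC
    have hk : ∀ e : Sym2 W, ∃ k : Edge →₀ ZMod 2, e ∈ P.edgeSet →
        bdry k = ∑ w with w ∈ e, Finsupp.single (base w) 1 ∧ k (γ e) = 1 ∧
          ∀ g, g ≠ γ e → k g ≠ 0 → inside g := by
      intro e
      by_cases he : e ∈ P.edgeSet
      swap
      · exact ⟨0, fun h => absurd h he⟩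
      obtain ⟨u, v, heq, huv, hu, hv⟩ := hγ e he
      obtain ⟨c, hc, hcs⟩ := exists_chain (hconn u _ (hbase u) _ hu)
      obtain ⟨d, hd, hds⟩ := exists_chain (hconn v _ (hbase v) _ hv)
      refine ⟨c + Finsupp.single (γ e) 1 + d, fun _ => ⟨?_, ?_, ?_⟩⟩
      · have : (Finset.univ.filter fun w => w ∈ e) = {u, v} := by
          ext w; simp [heq]
        rw [this, Finset.sum_pair huv, map_add, map_add, hc, hd, bdry_single]
        have h2 : ∀ z : ℤ × ℤ, Finsupp.single z (1 : ZMod 2) + Finsupp.single z 1 = 0 := by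
          intro z
          rw [← Finsupp.single_add, add_self_two, Finsupp.single_zero]
        calc _ = Finsupp.single (base u) (1 : ZMod 2) + Finsupp.single (base v) 1 +
            (Finsupp.single (γ e).1 (1 : ZMod 2) + Finsupp.single (γ e).1 1) +
            (Finsupp.single (tgt (γ e)) (1 : ZMod 2) + Finsupp.single (tgt (γ e)) 1) := by abel
          _ = _ := by rw [h2, h2, add_zero, add_zero]
      · have h1 : c (γ e) = 0 := by
          by_contra h
          exact hγout e he u (hcs _ h)
        have h2 : d (γ e) = 0 := by
          by_contra h
          exact hγout e he v (hds _ h)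
        simp [h1, h2]
      · intro g hne hg
        by_cases h1 : c g = 0
        · have h2 : d g ≠ 0 := by simpa [h1, Finsupp.single_apply, hne.symm] using hg
          exact ⟨v, hds _ h2⟩
        · exact ⟨u, hcs _ h1⟩
    choose k hk using hk
    let c : Edge →₀ ZMod 2 := ∑ e ∈ P.edgeFinset, C e • k e
    have hc0 : bdry c = 0 := by
      simp only [c, map_sum, map_smul]
      calc _ = ∑ e ∈ P.edgeFinset, ∑ w, if w ∈ e then C e • Finsupp.single (base w) (1 : ZMod 2)
              else 0 := by
            refine Finset.sum_congr rfl fun e he => ?_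
            rw [(hk e (by simpa using he)).1, Finset.smul_sum, Finset.sum_filter]
        _ = ∑ w, (∑ e ∈ P.edgeFinset with w ∈ e, C e) • Finsupp.single (base w) (1 : ZMod 2) := by
            rw [Finset.sum_comm]
            refine Finset.sum_congr rfl fun w _ => ?_
            rw [Finset.sum_smul, Finset.sum_filter]
        _ = 0 := by simp [hC]
    have happ : ∀ g, c g = ∑ e ∈ P.edgeFinset, C e * k e g := by
      intro g
      simp [c, Finsupp.finsetSum_apply]
    obtain ⟨h, hh⟩ := exists_potential c hc0
    have hr : ∀ a b, r a b → h a = h b := by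
      rintro _ _ ⟨g, hg, rfl, rfl⟩
      have : c g = 0 := by
        rw [happ]
        refine Finset.sum_eq_zero fun e he => ?_
        have he' : e ∈ P.edgeSet := by simpa using he
        have : k e g = 0 := by
          by_contra h0
          exact hg (Or.inl ((hk e he').2.2 g (fun hge => hg (Or.inr ⟨e, he', hge.symm⟩)) h0))
        rw [this, mul_zero]
      have h2 := hh g
      rw [this] at h2
      exact CharTwo.add_eq_zero.1 h2.symm
    refine ⟨Quot.lift h hr, fun e he => ?_⟩
    have : c (γ e) = C e := by
      rw [happ, Finset.sum_eq_single e]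
      · rw [(hk e he).2.1, mul_one]
      · intro e' he' hne
        have he'' : e' ∈ P.edgeSet := by simpa using he'
        have : k e' (γ e) = 0 := by
          by_contra h0
          obtain ⟨w, hw⟩ := (hk e' he'').2.2 _ (fun h => hne (hγinj e he e' he'' h).symm) h0
          exact hγout e he w hw
        rw [this, mul_zero]
      · intro hne
        exact absurd (by simpa using he) hne
    rw [← this, hh]

/-! ### Covering plane sets by grid cells -/

lemma adj_of_fst (i j : ℤ) : Adj (i, j) (i + 1, j) := ⟨((i, j), true), by simp [tgt]⟩

lemma adj_of_snd (i j : ℤ) : Adj (i, j) (i, j + 1) := ⟨((i, j), false), by simp [tgt]⟩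

lemma Conn.of_forall {S : Set (ℤ × ℤ)} (a : ℤ × ℤ)
    (h : ∀ x ∈ S, Relation.ReflTransGen (fun a b => Adj a b ∧ a ∈ S ∧ b ∈ S) a x) : Conn S := by
  intro x hx y hy
  refine Relation.ReflTransGen.trans ?_ (h y hy)
  have hx' := h x hx
  clear hx
  induction hx' with
  | refl => exact .refl
  | tail _ hcd ih => exact ih.head ⟨hcd.1.symm, hcd.2.2, hcd.2.1⟩

/-- A connected set of cells reaching `Y` contains a connected part that avoids `Y` and is
adjacent to `Y`. -/
lemma Conn.exists_prefix {S Y : Set (ℤ × ℤ)} (hS : Conn S) {a b : ℤ × ℤ} (ha : a ∈ S)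
    (haY : a ∉ Y) (hb : b ∈ S) (hbY : b ∈ Y) :
    ∃ R ⊆ S \ Y, Conn R ∧ a ∈ R ∧ ∃ x ∈ R, ∃ y ∈ Y, Adj x y := by
  let r : ℤ × ℤ → ℤ × ℤ → Prop := fun c d => Adj c d ∧ d ∈ S \ Y
  let R : Set (ℤ × ℤ) := {z | Relation.ReflTransGen r a z}
  refine ⟨R, ?_, ?_, Relation.ReflTransGen.refl, ?_⟩
  · intro z hz
    rcases Relation.ReflTransGen.cases_tail hz with rfl | ⟨_, -, -, h⟩
    · exact ⟨ha, haY⟩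
    · exact h
  · refine Conn.of_forall a fun x hx => ?_
    induction hx with
    | refl => exact .refl
    | tail hac hcd ih => exact ih.tail ⟨hcd.1, hac, hac.tail hcd⟩
  · have key : ∀ z, Relation.ReflTransGen (fun a b => Adj a b ∧ a ∈ S ∧ b ∈ S) a z →
        (∃ x ∈ R, ∃ y ∈ Y, Adj x y) ∨ z ∈ R := by
      intro z hz
      induction hz with
      | refl => exact Or.inr .refl
      | @tail c d _ hcd ih =>
        rcases ih with h | h
        · exact Or.inl h
        · by_cases hd : d ∈ Y
          · exact Or.inl ⟨c, h, d, hd, hcd.1⟩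
          · exact Or.inr (Relation.ReflTransGen.tail h ⟨hcd.1, hcd.2.2, hd⟩)
    rcases key b (hS a ha b hb) with h | h
    · exact h
    · rcases Relation.ReflTransGen.cases_tail h with rfl | ⟨_, -, -, h'⟩
      · exact absurd hbY haY
      · exact absurd hbY h'.2

/-- The closed cell of mesh `δ` with index `c`. -/
def cell (δ : ℝ) (c : ℤ × ℤ) : Set (ℝ × ℝ) :=
  Set.Icc (δ * c.1) (δ * (c.1 + 1)) ×ˢ Set.Icc (δ * c.2) (δ * (c.2 + 1))

/-- The indices of the cells of mesh `δ` that meet `A`. -/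
def cells (δ : ℝ) (A : Set (ℝ × ℝ)) : Set (ℤ × ℤ) := {c | (cell δ c ∩ A).Nonempty}

lemma exists_mem_cell {δ : ℝ} (hδ : 0 < δ) (p : ℝ × ℝ) : ∃ c, p ∈ cell δ c := by
  have key : ∀ x : ℝ, x ∈ Set.Icc (δ * (⌊x / δ⌋ : ℤ)) (δ * ((⌊x / δ⌋ : ℤ) + 1)) := by
    intro x
    have h1 := Int.floor_le (x / δ)
    have h2 := (Int.lt_floor_add_one (x / δ)).le
    rw [le_div_iff₀ hδ] at h1
    rw [div_le_iff₀ hδ] at h2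
    constructor <;> linarith
  exact ⟨(⌊p.1 / δ⌋, ⌊p.2 / δ⌋), key _, key _⟩

lemma dist_le_of_mem_cell {δ : ℝ} {c : ℤ × ℤ} {p q : ℝ × ℝ} (hp : p ∈ cell δ c)
    (hq : q ∈ cell δ c) : dist p q ≤ δ := by
  obtain ⟨⟨h1, h2⟩, h3, h4⟩ := hp
  obtain ⟨⟨h5, h6⟩, h7, h8⟩ := hq
  rw [Prod.dist_eq, Real.dist_eq, Real.dist_eq]
  refine max_le ?_ ?_ <;> rw [abs_le] <;> constructor <;> linarith

lemma cells_finite {δ : ℝ} (hδ : 0 < δ) {A : Set (ℝ × ℝ)} (hA : Bornology.IsBounded A) :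
    (cells δ A).Finite := by
  obtain ⟨r, hr⟩ := hA.subset_closedBall (0 : ℝ × ℝ)
  refine (((Set.finite_Icc (⌊-r / δ⌋ - 1) ⌈r / δ⌉).prod
    (Set.finite_Icc (⌊-r / δ⌋ - 1) ⌈r / δ⌉))).subset ?_
  have key : ∀ (x : ℝ) (i : ℤ), |x| ≤ r → x ∈ Set.Icc (δ * i) (δ * (i + 1)) →
      i ∈ Set.Icc (⌊-r / δ⌋ - 1) ⌈r / δ⌉ := by
    rintro x i hx ⟨h1, h2⟩
    obtain ⟨h3, h4⟩ := abs_le.1 hx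
    constructor
    · have : -r / δ ≤ ((i + 1 : ℤ) : ℝ) := by
        rw [div_le_iff₀ hδ]; push_cast; linarith
      have := Int.floor_mono this
      rw [Int.floor_intCast] at this
      omega
    · have : (i : ℝ) ≤ r / δ := by
        rw [le_div_iff₀ hδ]; linarith
      exact_mod_cast this.trans (Int.le_ceil _)
  rintro ⟨i, j⟩ ⟨p, ⟨h1, h2⟩, hp⟩
  have hp' := hr hp
  rw [Metric.mem_closedBall, Prod.dist_eq, Real.dist_eq, Real.dist_eq] at hp'
  simp only [Prod.fst_zero, Prod.snd_zero, sub_zero, sup_le_iff] at hp'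
  exact ⟨key _ _ hp'.1 h1, key _ _ hp'.2 h2⟩

lemma index_close {δ x : ℝ} (hδ : 0 < δ) {i k : ℤ} (h1 : x ∈ Set.Icc (δ * i) (δ * (i + 1)))
    (h2 : x ∈ Set.Icc (δ * k) (δ * (k + 1))) : i = k ∨ k = i + 1 ∨ i = k + 1 := by
  have h3 : (i : ℝ) ≤ k + 1 := le_of_mul_le_mul_left (h1.1.trans h2.2) hδ
  have h4 : (k : ℝ) ≤ i + 1 := le_of_mul_le_mul_left (h2.1.trans h1.2) hδ
  have h3' : i ≤ k + 1 := by exact_mod_cast h3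
  have h4' : k ≤ i + 1 := by exact_mod_cast h4
  omega

lemma conn_of_common_point {δ : ℝ} (hδ : 0 < δ) {p : ℝ × ℝ} {c d : ℤ × ℤ} (hc : p ∈ cell δ c)
    (hd : p ∈ cell δ d) {S : Set (ℤ × ℤ)} (hS : ∀ c, p ∈ cell δ c → c ∈ S) :
    Relation.ReflTransGen (fun a b => Adj a b ∧ a ∈ S ∧ b ∈ S) c d := by
  obtain ⟨i, j⟩ := c
  obtain ⟨k, l⟩ := d
  obtain ⟨h1, h2⟩ := hc
  obtain ⟨h3, h4⟩ := hd
  have ha : (i, j) ∈ S := hS _ ⟨h1, h2⟩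
  have hb : (k, j) ∈ S := hS _ ⟨h3, h2⟩
  have hc : (k, l) ∈ S := hS _ ⟨h3, h4⟩
  refine Relation.ReflTransGen.trans (b := (k, j)) ?_ ?_
  · rcases index_close hδ h1 h3 with h | h | h <;> simp only at h <;> subst h
    · exact .refl
    · exact .single ⟨adj_of_fst _ _, ha, hb⟩
    · exact .single ⟨(adj_of_fst _ _).symm, ha, hb⟩
  · rcases index_close hδ h2 h4 with h | h | h <;> simp only at h <;> subst h
    · exact .refl
    · exact .single ⟨adj_of_snd _ _, hb, hc⟩
    · exact .single ⟨(adj_of_snd _ _).symm, hb, hc⟩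

lemma isClosed_cell (δ : ℝ) (c : ℤ × ℤ) : IsClosed (cell δ c) := isClosed_Icc.prod isClosed_Icc

/-- The cells meeting a bounded connected set are connected. -/
lemma conn_cells {δ : ℝ} (hδ : 0 < δ) {A : Set (ℝ × ℝ)} (hA : Bornology.IsBounded A)
    (hc : IsPreconnected A) : Conn (cells δ A) := by
  intro a ha b hb
  by_contra hab
  let R : Set (ℤ × ℤ) :=
    {z | Relation.ReflTransGen (fun c d => Adj c d ∧ c ∈ cells δ A ∧ d ∈ cells δ A) a z}
  have hfin := cells_finite hδ hA
  have hclosed : ∀ T ⊆ cells δ A, IsClosed (⋃ c ∈ T, cell δ c) := fun T hT =>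
    (hfin.subset hT).isClosed_biUnion fun c _ => isClosed_cell δ c
  obtain ⟨pa, hpa, hpaA⟩ := ha
  obtain ⟨pb, hpb, hpbA⟩ := hb
  obtain ⟨p, hpA, hp1, hp2⟩ := isPreconnected_closed_iff.1 hc
    (⋃ c ∈ cells δ A ∩ R, cell δ c) (⋃ c ∈ cells δ A \ R, cell δ c)
    (hclosed _ Set.inter_subset_left) (hclosed _ Set.sdiff_subset)
    (by
      intro p hp
      obtain ⟨c, hc⟩ := exists_mem_cell hδ p
      by_cases hcR : c ∈ R
      · exact Or.inl (Set.mem_biUnion ⟨⟨p, hc, hp⟩, hcR⟩ hc)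
      · exact Or.inr (Set.mem_biUnion ⟨⟨p, hc, hp⟩, hcR⟩ hc))
    ⟨pa, hpaA, Set.mem_biUnion (x := a) ⟨⟨pa, hpa, hpaA⟩, .refl⟩ hpa⟩
    ⟨pb, hpbA, Set.mem_biUnion (x := b) ⟨⟨pb, hpb, hpbA⟩, hab⟩ hpb⟩
  simp only [Set.mem_iUnion, exists_prop] at hp1 hp2
  obtain ⟨c, ⟨-, hcR⟩, hpc⟩ := hp1
  obtain ⟨d, ⟨-, hdR⟩, hpd⟩ := hp2
  exact hdR (Relation.ReflTransGen.trans hcR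
    (conn_of_common_point hδ hpc hpd fun z hz => ⟨p, hz, hpA⟩))

lemma exists_pos_le_dist {A B : Set (ℝ × ℝ)} (hA : IsCompact A) (hB : IsCompact B)
    (h : Disjoint A B) : ∃ ε > 0, ∀ p ∈ A, ∀ q ∈ B, ε ≤ dist p q := by
  obtain ⟨ε, hε, hd⟩ := h.exists_thickenings hA hB.isClosed
  refine ⟨ε, hε, fun p hp q hq => ?_⟩
  by_contra hlt
  exact Set.disjoint_left.1 hd (Metric.mem_thickening_iff.2 ⟨p, hp, by
    rw [dist_comm]; exact not_le.1 hlt⟩) (Metric.self_subset_thickening hε _ hq)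

lemma exists_uniform_pos {ι : Type*} [Finite ι] (Q : ι → ℝ → Prop)
    (hQ : ∀ i, ∃ ε > 0, Q i ε) (hmono : ∀ i a b, a ≤ b → Q i b → Q i a) :
    ∃ ε > 0, ∀ i, Q i ε := by
  cases nonempty_fintype ι
  choose ε hε hQε using hQ
  by_cases hne : Nonempty ι
  · obtain ⟨i, hi⟩ := Finite.exists_min ε
    exact ⟨ε i, hε i, fun j => hmono j _ _ (hi j) (hQε j)⟩
  · exact ⟨1, one_pos, fun i => absurd ⟨i⟩ hne⟩

lemma isPreconnected_thickening {K : Set (ℝ × ℝ)} (hK : IsConnected K) {ε : ℝ} (hε : 0 < ε) :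
    IsPreconnected (Metric.thickening ε K) := by
  have h : Metric.thickening ε K = ⋃ x : K, (K ∪ Metric.ball (x : ℝ × ℝ) ε) := by
    rw [Metric.thickening_eq_biUnion_ball]
    ext p
    simp only [Set.mem_iUnion, Set.mem_union, exists_prop, Subtype.exists]
    constructor
    · rintro ⟨x, hx, hp⟩
      exact ⟨x, hx, Or.inr hp⟩
    · rintro ⟨x, hx, hp | hp⟩
      · exact ⟨p, hp, Metric.mem_ball_self hε⟩
      · exact ⟨x, hx, hp⟩
  rw [h]
  obtain ⟨y, hy⟩ := hK.nonempty
  refine isPreconnected_iUnion ⟨y, Set.mem_iInter.2 fun _ => Or.inl hy⟩ fun x => ?_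
  exact hK.isPreconnected.union (x : ℝ × ℝ) x.2 (Metric.mem_ball_self hε)
    (convex_ball (x : ℝ × ℝ) ε).isPreconnected

/-- A finite graph represented in the plane by disjoint connected compact sets for the vertices and
connected compact sets for the edges has an algebraic dual. -/
theorem hasAlgDual_of_compact_model {W : Type*} [Fintype W] (P : SimpleGraph W)
    (K : W → Set (ℝ × ℝ)) (A : Sym2 W → Set (ℝ × ℝ))
    (hK : ∀ w, IsCompact (K w)) (hKc : ∀ w, IsConnected (K w))
    (hKd : ∀ u v, u ≠ v → Disjoint (K u) (K v))
    (hA : ∀ e ∈ P.edgeSet, IsCompact (A e)) (hAc : ∀ e ∈ P.edgeSet, IsPreconnected (A e))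
    (hAK : ∀ e ∈ P.edgeSet, ∀ w, (A e ∩ K w).Nonempty ↔ w ∈ e)
    (hAA : ∀ e ∈ P.edgeSet, ∀ e' ∈ P.edgeSet, e ≠ e' → A e ∩ A e' ⊆ ⋃ w, K w) :
    HasAlgDual P := by
  classical
  obtain ⟨ε₁, hε₁, hKsep⟩ := exists_uniform_pos
    (fun (x : {x : W × W // x.1 ≠ x.2}) ε => ∀ p ∈ K x.1.1, ∀ q ∈ K x.1.2, ε ≤ dist p q)
    (fun x => exists_pos_le_dist (hK _) (hK _) (hKd _ _ x.2))
    (fun x a b hab h p hp q hq => hab.trans (h p hp q hq))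
  obtain ⟨ε₂, hε₂, hAsep⟩ := exists_uniform_pos
    (fun (x : {x : Sym2 W × W // x.1 ∈ P.edgeSet ∧ x.2 ∉ x.1}) ε =>
      ∀ p ∈ A x.1.1, ∀ q ∈ K x.1.2, ε ≤ dist p q)
    (fun x => exists_pos_le_dist (hA _ x.2.1) (hK _) (by
      rw [Set.disjoint_iff_inter_eq_empty, ← Set.not_nonempty_iff_eq_empty, hAK _ x.2.1]
      exact x.2.2))
    (fun x a b hab h p hp q hq => hab.trans (h p hp q hq))
  obtain ⟨ε, hε, h1ε, h2ε⟩ : ∃ ε > 0, 4 * ε ≤ ε₁ ∧ 4 * ε ≤ ε₂ :=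
    ⟨min ε₁ ε₂ / 4, by positivity, by linarith [min_le_left ε₁ ε₂],
      by linarith [min_le_right ε₁ ε₂]⟩
  let D : W → Set (ℝ × ℝ) := fun w => Metric.thickening ε (K w)
  have hKD : ∀ w, K w ⊆ D w := fun w => Metric.self_subset_thickening hε _
  have hDb : ∀ w, Bornology.IsBounded (D w) := fun w => (hK w).isBounded.thickening
  have hDo : IsOpen (⋃ w, D w) := isOpen_iUnion fun w => Metric.isOpen_thickening
  obtain ⟨η, hη, hηsep⟩ := exists_uniform_pos
    (fun (x : {x : Sym2 W × Sym2 W // x.1 ∈ P.edgeSet ∧ x.2 ∈ P.edgeSet ∧ x.1 ≠ x.2}) ε =>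
      ∀ p ∈ A x.1.1 \ ⋃ w, D w, ∀ q ∈ A x.1.2 \ ⋃ w, D w, ε ≤ dist p q)
    (fun x => exists_pos_le_dist ((hA _ x.2.1).diff hDo) ((hA _ x.2.2.1).diff hDo) (by
      rw [Set.disjoint_left]
      rintro p ⟨h1, h2⟩ ⟨h3, -⟩
      exact h2 (Set.iUnion_mono hKD (hAA _ x.2.1 _ x.2.2.1 x.2.2.2 ⟨h1, h3⟩))))
    (fun x a b hab h p hp q hq => hab.trans (h p hp q hq))
  obtain ⟨δ, hδ, hδε, hδη⟩ : ∃ δ > 0, δ ≤ ε ∧ δ < η :=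
    ⟨min ε η / 2, by positivity, by linarith [min_le_left ε η], by linarith [min_le_right ε η]⟩
  have hDD : ∀ u v z, z ∈ cells δ (D u) → z ∈ cells δ (D v) → u = v := by
    rintro u v z ⟨p, hpz, hp⟩ ⟨q, hqz, hq⟩
    by_contra huv
    obtain ⟨p', hp', hpp'⟩ := Metric.mem_thickening_iff.1 hp
    obtain ⟨q', hq', hqq'⟩ := Metric.mem_thickening_iff.1 hq
    have := hKsep ⟨(u, v), huv⟩ p' hp' q' hq'
    have h2 := dist_le_of_mem_cell hpz hqz
    have h3 := dist_triangle4_left p' q' p q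
    rw [dist_comm] at hpp'
    have h4 := dist_triangle p' p q'
    have h5 := dist_triangle p q q'
    linarith
  have hAD : ∀ e ∈ P.edgeSet, ∀ w z, z ∈ cells δ (A e) → z ∈ cells δ (D w) → w ∈ e := by
    rintro e he w z ⟨p, hpz, hp⟩ ⟨q, hqz, hq⟩
    by_contra hw
    obtain ⟨q', hq', hqq'⟩ := Metric.mem_thickening_iff.1 hq
    have := hAsep ⟨(e, w), he, hw⟩ p hp q' hq'
    have h2 := dist_le_of_mem_cell hpz hqz
    have h5 := dist_triangle p q q'
    linarith
  have hmeet : ∀ e ∈ P.edgeSet, ∀ w ∈ e, ∃ z, z ∈ cells δ (A e) ∧ z ∈ cells δ (D w) := by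
    intro e he w hw
    obtain ⟨p, hpA, hpK⟩ := (hAK e he w).2 hw
    obtain ⟨c, hc⟩ := exists_mem_cell hδ p
    exact ⟨c, ⟨p, hc, hpA⟩, ⟨p, hc, hKD w hpK⟩⟩
  have hpre : ∀ e : Sym2 W, ∃ (u v : W) (R : Set (ℤ × ℤ)), e ∈ P.edgeSet →
      e = s(u, v) ∧ R ⊆ cells δ (A e) \ cells δ (D v) ∧ Conn R ∧
      (∃ a ∈ R, a ∈ cells δ (D u)) ∧ ∃ x ∈ R, ∃ y ∈ cells δ (D v), Adj x y := by
    intro e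
    induction e using Sym2.ind with
    | _ u v =>
      by_cases he : s(u, v) ∈ P.edgeSet
      swap
      · exact ⟨u, v, ∅, fun h => absurd h he⟩
      obtain ⟨a, ha, haD⟩ := hmeet _ he u (Sym2.mem_mk_left u v)
      obtain ⟨b, hb, hbD⟩ := hmeet _ he v (Sym2.mem_mk_right u v)
      obtain ⟨R, h1, h2, h3, h4⟩ := (conn_cells hδ (hA _ he).isBounded (hAc _ he)).exists_prefix
        ha (fun h => P.ne_of_adj he (hDD _ _ _ haD h)) hb hbD
      exact ⟨u, v, R, fun _ => ⟨rfl, h1, h2, ⟨a, h3, haD⟩, h4⟩⟩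
  choose src dst R hR using hpre
  let B : W → Set (ℤ × ℤ) := fun w =>
    cells δ (D w) ∪ ⋃ e ∈ {e | e ∈ P.edgeSet ∧ src e = w}, R e
  have hBfin : ∀ w, (B w).Finite := by
    intro w
    refine (cells_finite hδ (hDb w)).union ((Set.toFinite _).biUnion fun e he => ?_)
    exact (cells_finite hδ (hA e he.1).isBounded).subset
      ((hR e he.1).2.1.trans Set.sdiff_subset)
  have hmemR : ∀ e ∈ P.edgeSet, ∀ w z, z ∈ R e → z ∈ cells δ (D w) → w = src e := by
    intro e he w z hz hw
    obtain ⟨h1, h2, -⟩ := hR e he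
    have h3 := hAD e he w z (h2 hz).1 hw
    rw [h1, Sym2.mem_iff] at h3
    rcases h3 with h3 | h3
    · exact h3
    · exact absurd (h3 ▸ hw) (h2 hz).2
  have hBuniq : ∀ u v z, z ∈ B u → z ∈ B v → u = v := by
    intro u v z hu hv
    simp only [B, Set.mem_union, Set.mem_iUnion, Set.mem_ofPred_eq, exists_prop] at hu hv
    rcases hu with hu | ⟨e, ⟨he, rfl⟩, hze⟩ <;> rcases hv with hv | ⟨e', ⟨he', rfl⟩, hze'⟩
    · exact hDD _ _ _ hu hv
    · exact hmemR e' he' _ _ hze' hu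
    · exact (hmemR e he _ _ hze hv).symm
    · by_contra hne
      have hnD : ∀ w, z ∉ cells δ (D w) := fun w hw =>
        hne ((hmemR e he _ _ hze hw).symm.trans (hmemR e' he' _ _ hze' hw))
      obtain ⟨p, hpz, hp⟩ := ((hR e he).2.1 hze).1
      obtain ⟨q, hqz, hq⟩ := ((hR e' he').2.1 hze').1
      have := hηsep ⟨(e, e'), he, he', fun h => hne (congrArg src h)⟩ p
        ⟨hp, fun h => by
          obtain ⟨w, hw⟩ := Set.mem_iUnion.1 h
          exact hnD w ⟨p, hpz, hw⟩⟩ q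
        ⟨hq, fun h => by
          obtain ⟨w, hw⟩ := Set.mem_iUnion.1 h
          exact hnD w ⟨q, hqz, hw⟩⟩
      linarith [dist_le_of_mem_cell hpz hqz]
  have hDB : ∀ w, cells δ (D w) ⊆ B w := fun w => Set.subset_union_left
  have hRB : ∀ e ∈ P.edgeSet, R e ⊆ B (src e) := fun e he z hz =>
    Or.inr (Set.mem_biUnion (⟨he, rfl⟩ : e ∈ {e' | e' ∈ P.edgeSet ∧ src e' = src e}) hz)
  have hne : ∀ w, ∃ a, a ∈ cells δ (D w) := by
    intro w
    obtain ⟨p, hp⟩ := (hKc w).nonempty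
    obtain ⟨c, hc⟩ := exists_mem_cell hδ p
    exact ⟨c, p, hc, hKD w hp⟩
  refine hasAlgDual_of_minor P (fun w => (hBfin w).toFinset) ?_ ?_ ?_ ?_
  · intro w
    obtain ⟨a, ha⟩ := hne w
    exact ⟨a, (hBfin w).mem_toFinset.2 (hDB w ha)⟩
  · intro u v huv
    rw [Finset.disjoint_left]
    intro z hu hv
    exact huv (hBuniq u v z ((hBfin u).mem_toFinset.1 hu) ((hBfin v).mem_toFinset.1 hv))
  · intro w
    rw [Set.Finite.coe_toFinset]
    obtain ⟨a, ha⟩ := hne w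
    have mono : ∀ S ⊆ B w, ∀ x y,
        Relation.ReflTransGen (fun a b => Adj a b ∧ a ∈ S ∧ b ∈ S) x y →
        Relation.ReflTransGen (fun a b => Adj a b ∧ a ∈ B w ∧ b ∈ B w) x y :=
      fun S hS x y => Relation.ReflTransGen.mono (fun _ _ ⟨h1, h2, h3⟩ => ⟨h1, hS h2, hS h3⟩) x y
    have hD : ∀ x ∈ cells δ (D w),
        Relation.ReflTransGen (fun a b => Adj a b ∧ a ∈ B w ∧ b ∈ B w) a x := fun x hx =>
      mono _ (hDB w) _ _
        (conn_cells hδ (hDb w) (isPreconnected_thickening (hKc w) hε) a ha x hx)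
    refine Conn.of_forall a fun x hx => ?_
    rcases hx with hx | hx
    · exact hD x hx
    · simp only [Set.mem_iUnion, Set.mem_ofPred_eq, exists_prop] at hx
      obtain ⟨e, ⟨he, rfl⟩, hxe⟩ := hx
      obtain ⟨-, -, hconn, ⟨b, hb, hbD⟩, -⟩ := hR e he
      exact (hD b hbD).trans (mono _ (hRB e he) _ _ (hconn b hb x hxe))
  · intro u v huv
    obtain ⟨h1, -, -, -, x, hx, y, hy, hxy⟩ := hR s(u, v) huv
    simp only [Set.Finite.mem_toFinset]
    have hx' := hRB _ huv hx
    have hy' := hDB _ hy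
    rcases Sym2.eq_iff.1 h1 with ⟨hu, hv⟩ | ⟨hu, hv⟩
    · rw [← hu] at hx'
      rw [← hv] at hy'
      exact ⟨x, hx', y, hy', hxy⟩
    · rw [← hv] at hx'
      rw [← hu] at hy'
      exact ⟨y, hy', x, hx', hxy.symm⟩

end PlaneGrid

/-- A system of crossings of vertex-disjoint edges of `G`, in which each edge takes part in at most
one crossing: `x` is the crossing of the edges joining `q x i` to `q x (i + 2)`. -/
structure CrossingSystem {V : Type*} (G : SimpleGraph V) (X : Type*) where
  q : X → Fin 4 → V
  inj : ∀ x, Function.Injective (q x)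
  adj : ∀ x i, G.Adj (q x i) (q x (i + 2))
  uniq : ∀ {x y i j}, s(q x i, q x (i + 2)) = s(q y j, q y (j + 2)) → x = y

namespace CrossingSystem

variable {V X : Type*} {G : SimpleGraph V} (S : CrossingSystem G X)

/-- An edge that takes part in no crossing of the system. -/
def IsFree (u v : V) : Prop := G.Adj u v ∧ ∀ x i, s(u, v) ≠ s(S.q x i, S.q x (i + 2))

/-- The graph obtained by subdividing the crossing edges at their common crossing vertex. -/
def planarization : SimpleGraph (V ⊕ X) where
  Adj
    | .inl u, .inl v => S.IsFree u v
    | .inl u, .inr x => ∃ i, S.q x i = u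
    | .inr x, .inl u => ∃ i, S.q x i = u
    | .inr _, .inr _ => False
  symm := ⟨by
    rintro (u | x) (v | y) h
    · exact ⟨h.1.symm, by simpa only [Sym2.eq_swap (a := v)] using h.2⟩
    all_goals exact h⟩
  loopless := ⟨by
    rintro (u | x) h
    · exact h.1.ne rfl
    · exact h⟩

lemma mem_edgeSet_planarization {e : Sym2 (V ⊕ X)} : e ∈ S.planarization.edgeSet ↔
    (∃ u v, S.IsFree u v ∧ e = s(.inl u, .inl v)) ∨
      ∃ x i, e = s(.inl (S.q x i), .inr x) := by
  constructor
  · induction e with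
    | _ a b =>
      rcases a with u | x <;> rcases b with v | y <;> intro h
      · exact Or.inl ⟨u, v, h, rfl⟩
      · obtain ⟨i, rfl⟩ := h
        exact Or.inr ⟨y, i, rfl⟩
      · obtain ⟨i, rfl⟩ := h
        exact Or.inr ⟨x, i, Sym2.eq_swap⟩
      · exact h.elim
  · rintro (⟨u, v, h, rfl⟩ | ⟨x, i, rfl⟩)
    · exact h
    · exact ⟨i, rfl⟩

end CrossingSystem

namespace PlaneDrawing

variable {V : Type*} {G : SimpleGraph V} (D : PlaneDrawing G)

/-- The point set of the arc representing an edge. -/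
def curve (e : Sym2 V) : Set (ℝ × ℝ) :=
  {p | ∃ (u v : V) (h : G.Adj u v), s(u, v) = e ∧ p ∈ Set.range (D.arc h)}

lemma curve_mk {u v : V} (h : G.Adj u v) : D.curve s(u, v) = Set.range (D.arc h) := by
  ext p
  constructor
  · rintro ⟨a, b, h', he, hp⟩
    rcases Sym2.eq_iff.1 he with ⟨rfl, rfl⟩ | ⟨rfl, rfl⟩
    · exact hp
    · rwa [D.arc_symm h, Path.symm_range] at hp
  · exact fun hp => ⟨u, v, h, rfl, hp⟩

lemma mem_edgeSet_of_mem_curve {e : Sym2 V} {p : ℝ × ℝ} (hp : p ∈ D.curve e) : e ∈ G.edgeSet := by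
  obtain ⟨u, v, h, rfl, -⟩ := hp
  exact h

lemma mem_of_pos_mem_curve {e : Sym2 V} {w : V} (h : D.pos w ∈ D.curve e) : w ∈ e := by
  obtain ⟨u, v, h, rfl, t, ht⟩ := h
  exact Sym2.mem_iff.2 (D.no_vertex_mem h w t ht)

lemma pos_mem_curve {u v : V} (h : G.Adj u v) : D.pos u ∈ D.curve s(u, v) := by
  rw [D.curve_mk h]
  exact ⟨0, (D.arc h).source⟩

lemma isCompact_curve {u v : V} (h : G.Adj u v) : IsCompact (D.curve s(u, v)) := by
  rw [D.curve_mk h]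
  exact isCompact_range (D.arc h).continuous

lemma isPreconnected_curve {u v : V} (h : G.Adj u v) : IsPreconnected (D.curve s(u, v)) := by
  rw [D.curve_mk h]
  exact isPreconnected_range (D.arc h).continuous

lemma isInteriorPoint_iff {u v : V} (h : G.Adj u v) {p : ℝ × ℝ} :
    D.IsInteriorPoint h p ↔ p ∈ D.curve s(u, v) ∧ p ∉ Set.range D.pos := by
  rw [D.curve_mk h]
  constructor
  · rintro ⟨t, h0, h1, rfl⟩
    refine ⟨⟨t, rfl⟩, ?_⟩
    rintro ⟨w, hw⟩
    rcases D.no_vertex_mem h w t hw.symm with rfl | rfl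
    · exact h0 (D.arc_inj h (hw.symm.trans (D.arc h).source.symm))
    · exact h1 (D.arc_inj h (hw.symm.trans (D.arc h).target.symm))
  · rintro ⟨⟨t, rfl⟩, hp⟩
    refine ⟨t, ?_, ?_, rfl⟩
    · rintro rfl
      exact hp ⟨u, (D.arc h).source.symm⟩
    · rintro rfl
      exact hp ⟨v, (D.arc h).target.symm⟩

lemma eq_or_eq_of_mem_curve {e₁ e₂ e₃ : Sym2 V} {p : ℝ × ℝ} (hp : p ∉ Set.range D.pos)
    (h₁ : p ∈ D.curve e₁) (h₂ : p ∈ D.curve e₂) (h₃ : p ∈ D.curve e₃) (h : e₁ ≠ e₂) :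
    e₃ = e₁ ∨ e₃ = e₂ := by
  by_contra! hne
  obtain ⟨_, _, a₁, rfl, -⟩ := id h₁
  obtain ⟨_, _, a₂, rfl, -⟩ := id h₂
  obtain ⟨_, _, a₃, rfl, -⟩ := id h₃
  obtain ⟨t₁, b₁, c₁, d₁⟩ := (D.isInteriorPoint_iff a₁).2 ⟨h₁, hp⟩
  obtain ⟨t₂, b₂, c₂, d₂⟩ := (D.isInteriorPoint_iff a₂).2 ⟨h₂, hp⟩
  obtain ⟨t₃, b₃, c₃, d₃⟩ := (D.isInteriorPoint_iff a₃).2 ⟨h₃, hp⟩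
  exact D.no_triple_point a₁ a₂ a₃ h hne.1.symm hne.2.symm t₁ t₂ t₃ b₁ c₁ b₂ c₂ b₃ c₃
    (d₁.trans d₂.symm) (d₂.trans d₃.symm)

lemma finite_edgeCrossings [Finite V] {u v : V} (h : G.Adj u v) : (D.edgeCrossings h).Finite := by
  have : (⋃ e' ∈ {e' | s(u, v) ≠ e'}, D.curve s(u, v) ∩ D.curve e').Finite := by
    refine (Set.toFinite _).biUnion fun e' he' => ?_
    by_cases hmem : e' ∈ G.edgeSet
    · induction e' with
      | _ x y =>
        rw [D.curve_mk h, D.curve_mk hmem]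
        exact D.finite_inter h hmem he'
    · refine Set.finite_empty.subset fun p hp => hmem (D.mem_edgeSet_of_mem_curve hp.2)
  refine this.subset ?_
  rintro p ⟨hp, x, y, h', hne, hp'⟩
  exact Set.mem_biUnion hne
    ⟨((D.isInteriorPoint_iff h).1 hp).1, ((D.isInteriorPoint_iff h').1 hp').1⟩

/-- In a 1-plane drawing, the arc of each edge contains at most one crossing. -/
lemma IsKPlane.crossing_unique [Finite V] {D : PlaneDrawing G} (hD : D.IsKPlane 1)
    {e e₁ e₂ : Sym2 V} {p₁ p₂ : ℝ × ℝ} (hp₁ : p₁ ∉ Set.range D.pos) (hp₂ : p₂ ∉ Set.range D.pos)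
    (h₁ : p₁ ∈ D.curve e) (h₂ : p₂ ∈ D.curve e) (h₁' : p₁ ∈ D.curve e₁) (h₂' : p₂ ∈ D.curve e₂)
    (he₁ : e ≠ e₁) (he₂ : e ≠ e₂) : p₁ = p₂ := by
  obtain ⟨u, v, h, rfl, -⟩ := id h₁
  refine (Set.ncard_le_one (D.finite_edgeCrossings h)).1 (hD h) _ ?_ _ ?_
  · obtain ⟨x, y, h', rfl, -⟩ := id h₁'
    exact ⟨(D.isInteriorPoint_iff h).2 ⟨h₁, hp₁⟩, x, y, h', he₁,
      (D.isInteriorPoint_iff h').2 ⟨h₁', hp₁⟩⟩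
  · obtain ⟨x, y, h', rfl, -⟩ := id h₂'
    exact ⟨(D.isInteriorPoint_iff h).2 ⟨h₂, hp₂⟩, x, y, h', he₂,
      (D.isInteriorPoint_iff h').2 ⟨h₂', hp₂⟩⟩

/-- The part of the arc of `ua` from `u` to the point `c`. -/
def initialSegment (u a : V) (c : ℝ × ℝ) : Set (ℝ × ℝ) :=
  {p | ∃ (h : G.Adj u a) (s t : I), s ≤ t ∧ D.arc h s = p ∧ D.arc h t = c}

lemma initialSegment_eq {u a : V} (h : G.Adj u a) (t : I) :
    D.initialSegment u a (D.arc h t) = D.arc h '' Set.Icc 0 t := by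
  ext p
  constructor
  · rintro ⟨_, s, t', hst, rfl, ht⟩
    exact ⟨s, ⟨bot_le, hst.trans (D.arc_inj h ht).le⟩, rfl⟩
  · rintro ⟨s, hs, rfl⟩
    exact ⟨h, s, t, hs.2, rfl, rfl⟩

variable {D} {u a : V} {c p : ℝ × ℝ}

lemma mem_curve_of_mem_initialSegment (hp : p ∈ D.initialSegment u a c) :
    p ∈ D.curve s(u, a) := by
  obtain ⟨h, s, t, -, rfl, -⟩ := hp
  rw [D.curve_mk h]
  exact ⟨s, rfl⟩

lemma exists_of_mem_curve (hc : c ∈ D.curve s(u, a)) :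
    ∃ (h : G.Adj u a) (t : I), D.arc h t = c := by
  have h : G.Adj u a := D.mem_edgeSet_of_mem_curve hc
  rw [D.curve_mk h] at hc
  exact ⟨h, hc⟩

lemma isCompact_initialSegment (hc : c ∈ D.curve s(u, a)) :
    IsCompact (D.initialSegment u a c) := by
  obtain ⟨h, t, rfl⟩ := exists_of_mem_curve hc
  rw [initialSegment_eq]
  exact isCompact_Icc.image (D.arc h).continuous

lemma isPreconnected_initialSegment (hc : c ∈ D.curve s(u, a)) :
    IsPreconnected (D.initialSegment u a c) := by
  obtain ⟨h, t, rfl⟩ := exists_of_mem_curve hc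
  rw [initialSegment_eq]
  exact isPreconnected_Icc.image _ (D.arc h).continuous.continuousOn

lemma pos_mem_initialSegment (hc : c ∈ D.curve s(u, a)) : D.pos u ∈ D.initialSegment u a c := by
  obtain ⟨h, t, rfl⟩ := exists_of_mem_curve hc
  exact ⟨h, 0, t, bot_le, (D.arc h).source, rfl⟩

lemma mem_initialSegment_self (hc : c ∈ D.curve s(u, a)) : c ∈ D.initialSegment u a c := by
  obtain ⟨h, t, rfl⟩ := exists_of_mem_curve hc
  exact ⟨h, t, t, le_rfl, rfl, rfl⟩

lemma eq_of_pos_mem_initialSegment {w : V} (hc : c ∉ Set.range D.pos)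
    (hw : D.pos w ∈ D.initialSegment u a c) : w = u := by
  obtain ⟨h, s, t, hst, hs, rfl⟩ := hw
  rcases D.no_vertex_mem h w s hs with rfl | rfl
  · rfl
  · have hs1 : s = 1 := D.arc_inj h (hs.trans (D.arc h).target.symm)
    have ht1 : t = 1 := le_antisymm le_top (hs1 ▸ hst)
    exact absurd ⟨w, by rw [ht1]; exact (D.arc h).target.symm⟩ hc

lemma eq_of_mem_initialSegment_inter (h₁ : p ∈ D.initialSegment u a c)
    (h₂ : p ∈ D.initialSegment a u c) : p = c := by
  obtain ⟨h, s, t, hst, rfl, rfl⟩ := h₁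
  obtain ⟨h', s', t', hst', hs, ht⟩ := h₂
  have hs := D.arc_inj h (((congrArg (fun γ => γ s') (D.arc_symm h)).symm.trans hs : _))
  have ht := D.arc_inj h (((congrArg (fun γ => γ t') (D.arc_symm h)).symm.trans ht : _))
  subst hs ht
  exact congrArg _ (le_antisymm hst (unitInterval.symm_le_symm.2 hst'))

/-- `c` is a crossing of the edge `ua` with another edge at `u`. -/
def IsLens (D : PlaneDrawing G) (u a : V) (c : ℝ × ℝ) : Prop :=
  c ∉ Set.range D.pos ∧ c ∈ D.curve s(u, a) ∧ ∃ b, b ≠ a ∧ c ∈ D.curve s(u, b)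

lemma IsLens.eq_left {v b : V} (h : D.IsLens u a c) (h' : D.IsLens v b c) : u = v := by
  by_contra huv
  obtain ⟨hc, h₁, a', ha', h₂⟩ := h
  obtain ⟨-, h₃, b', hb', h₄⟩ := h'
  have hne : s(u, a) ≠ s(u, a') := fun h => ha' (Sym2.congr_right.1 h).symm
  have hne' : s(v, b) ≠ s(v, b') := fun h => hb' (Sym2.congr_right.1 h).symm
  have e₁ := D.eq_or_eq_of_mem_curve hc h₃ h₄ h₁ hne'
  have e₂ := D.eq_or_eq_of_mem_curve hc h₃ h₄ h₂ hne'
  simp only [Sym2.eq_iff] at e₁ e₂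
  grind

/-- The set representing the vertex `u` in the compact model of the planarization. -/
def star (D : PlaneDrawing G) (u : V) : Set (ℝ × ℝ) :=
  insert (D.pos u) (⋃ a, ⋃ c ∈ {c | D.IsLens u a c}, D.initialSegment u a c)

lemma mem_star : p ∈ D.star u ↔ p = D.pos u ∨ ∃ a c, D.IsLens u a c ∧
    p ∈ D.initialSegment u a c := by
  simp [star]

lemma pos_mem_star : D.pos u ∈ D.star u := Or.inl rfl

lemma IsLens.mem_star (h : D.IsLens u a c) : c ∈ D.star u :=
  PlaneDrawing.mem_star.2 (Or.inr ⟨a, c, h, mem_initialSegment_self h.2.1⟩)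

lemma IsLens.exists_ne (h : D.IsLens u a c) : ∃ e, s(u, a) ≠ e ∧ c ∈ D.curve e := by
  obtain ⟨-, -, b, hb, h⟩ := h
  exact ⟨_, fun h => hb (Sym2.congr_right.1 h).symm, h⟩

lemma IsLens.unique [Finite V] (hD : D.IsKPlane 1) {c' : ℝ × ℝ} (h : D.IsLens u a c)
    (h' : D.IsLens u a c') : c = c' := by
  obtain ⟨e, he, hc⟩ := h.exists_ne
  obtain ⟨e', he', hc'⟩ := h'.exists_ne
  exact hD.crossing_unique h.1 h'.1 h.2.1 h'.2.1 hc hc' he he'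

lemma isCompact_star [Finite V] (hD : D.IsKPlane 1) : IsCompact (D.star u) := by
  refine IsCompact.insert (isCompact_iUnion fun a => ?_) _
  refine Set.Finite.isCompact_biUnion ?_ fun c hc => isCompact_initialSegment hc.2.1
  exact Set.Subsingleton.finite fun c hc c' hc' => IsLens.unique hD hc hc'

lemma isConnected_star : IsConnected (D.star u) := by
  refine ⟨⟨_, pos_mem_star⟩, isPreconnected_of_forall (D.pos u) fun p hp => ?_⟩
  rcases mem_star.1 hp with rfl | ⟨a, c, h, hp⟩
  · exact ⟨{D.pos u}, by simpa using pos_mem_star, rfl, rfl, isPreconnected_singleton⟩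
  · exact ⟨_, fun x hx => mem_star.2 (Or.inr ⟨a, c, h, hx⟩), pos_mem_initialSegment h.2.1, hp,
      isPreconnected_initialSegment h.2.1⟩

/-- A point of the star of `u` on the arc of an edge `e` is a vertex, or a crossing of two edges
at `u`, or lies on the segment from `u` to such a crossing along `e`. -/
lemma mem_star_cases [Finite V] (hD : D.IsKPlane 1) {e : Sym2 V} (hp : p ∈ D.star u)
    (hpe : p ∈ D.curve e) :
    p = D.pos u ∨ (p ∉ Set.range D.pos ∧ ∃ a, D.IsLens u a p) ∨
      (p ∉ Set.range D.pos ∧ ∃ a c, e = s(u, a) ∧ D.IsLens u a c) := by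
  rcases mem_star.1 hp with h | ⟨a, c, h, hp⟩
  · exact Or.inl h
  by_cases hpos : p ∈ Set.range D.pos
  · obtain ⟨w, rfl⟩ := hpos
    exact Or.inl (congrArg _ (eq_of_pos_mem_initialSegment h.1 hp))
  right
  by_cases he : s(u, a) = e
  · exact Or.inr ⟨hpos, a, c, he.symm, h⟩
  · obtain ⟨e', he', hc⟩ := h.exists_ne
    obtain rfl : p = c := hD.crossing_unique hpos h.1 (mem_curve_of_mem_initialSegment hp) h.2.1
      hpe hc he he'
    exact Or.inl ⟨hpos, a, h⟩

lemma disjoint_star [Finite V] (hD : D.IsKPlane 1) {v : V} (huv : u ≠ v) :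
    Disjoint (D.star u) (D.star v) := by
  rw [Set.disjoint_left]
  intro p hp hp'
  have aux : ∀ {u v : V}, u ≠ v → D.pos u ∉ D.star v := by
    intro u v huv h
    rcases mem_star.1 h with h | ⟨a, c, hl, h⟩
    · exact huv (D.pos_inj h)
    · exact huv (eq_of_pos_mem_initialSegment hl.1 h)
  rcases mem_star.1 hp' with rfl | ⟨a, c, h, hpa⟩
  · exact aux huv.symm hp
  rcases mem_star_cases hD hp (mem_curve_of_mem_initialSegment hpa) with
    rfl | ⟨hpos, b, hb⟩ | ⟨-, b, c', he, hb⟩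
  · exact aux huv hp'
  · rcases mem_star_cases hD hp' hb.2.1 with rfl | ⟨-, b', hb'⟩ | ⟨-, b', c', he, hb'⟩
    · exact hpos ⟨_, rfl⟩
    · exact huv (hb.eq_left hb')
    · obtain ⟨e, he₁, hc₁⟩ := hb.exists_ne
      obtain ⟨e', he₂, hc₂⟩ := hb'.exists_ne
      obtain rfl : p = c' := hD.crossing_unique hpos hb'.1 hb.2.1 (he ▸ hb'.2.1) hc₁ hc₂ he₁
        (he ▸ he₂)
      exact huv (hb.eq_left hb')
  · obtain ⟨e, he₁, hc₁⟩ := hb.exists_ne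
    obtain ⟨e', he₂, hc₂⟩ := h.exists_ne
    obtain rfl : c' = c := hD.crossing_unique hb.1 h.1 hb.2.1 (he ▸ h.2.1) hc₁ hc₂ he₁
        (he ▸ he₂)
    exact huv (hb.eq_left h)

/-- The crossings of two vertex-disjoint edges. -/
def disjointCrossings (D : PlaneDrawing G) : Set (ℝ × ℝ) :=
  {p | p ∉ Set.range D.pos ∧ ∃ q : Fin 4 → V, Function.Injective q ∧
    ∀ i, p ∈ D.curve s(q i, q (i + 2))}

lemma exists_mem_star_or_mem_disjointCrossings {e e' : Sym2 V} (hp : p ∉ Set.range D.pos)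
    (h : p ∈ D.curve e) (h' : p ∈ D.curve e') (hne : e ≠ e') :
    (∃ u, p ∈ D.star u) ∨ p ∈ D.disjointCrossings := by
  obtain ⟨u, v, huv, rfl, -⟩ := id h
  obtain ⟨x, y, hxy, rfl, -⟩ := id h'
  have key : ∀ {u a b}, s(u, a) ≠ s(u, b) → p ∈ D.curve s(u, a) → p ∈ D.curve s(u, b) →
      ∃ u, p ∈ D.star u := fun {u a b} hne h h' =>
    ⟨u, IsLens.mem_star (a := a) ⟨hp, h, b, fun hb => hne (by rw [hb]), h'⟩⟩
  by_cases h1 : u = x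
  · subst h1
    exact Or.inl (key hne h h')
  by_cases h2 : u = y
  · subst h2
    rw [Sym2.eq_swap (a := x)] at hne h'
    exact Or.inl (key hne h h')
  rw [Sym2.eq_swap (a := u)] at hne h
  by_cases h3 : v = x
  · subst h3
    exact Or.inl (key hne h h')
  by_cases h4 : v = y
  · subst h4
    rw [Sym2.eq_swap (a := x)] at hne h'
    exact Or.inl (key hne h h')
  refine Or.inr ⟨hp, ![u, x, v, y], ?_, ?_⟩
  · have := huv.ne
    have := hxy.ne
    intro i j
    fin_cases i <;> fin_cases j <;> simp <;> grind
  · intro i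
    fin_cases i <;> simp <;> first | assumption | (rw [Sym2.eq_swap]; assumption)

lemma diagonals_ne {q : Fin 4 → V} (hq : Function.Injective q) (i : Fin 4) : s(q i, q (i + 2)) ≠ s(q (i + 1), q (i + 1 + 2)) := by
  intro h
  rcases Sym2.eq_iff.1 h with ⟨h, -⟩ | ⟨h, -⟩ <;> have h' := hq h <;> clear * - h' <;>
    revert i <;> decide

lemma exists_eq_diagonal {q : Fin 4 → V} (hq : Function.Injective q)
    (hp : ∀ i, p ∈ D.curve s(q i, q (i + 2))) (hpos : p ∉ Set.range D.pos) {e : Sym2 V} (he : p ∈ D.curve e) :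
    ∃ i, e = s(q i, q (i + 2)) :=
  (D.eq_or_eq_of_mem_curve hpos (hp 0) (hp (0 + 1)) he (diagonals_ne hq 0)).elim
    (fun h => ⟨_, h⟩) fun h => ⟨_, h⟩

lemma not_isLens_of_diagonals {q : Fin 4 → V} (hq : Function.Injective q)
    (hp : ∀ i, p ∈ D.curve s(q i, q (i + 2))) : ¬ D.IsLens u a p := by
  rintro ⟨hpos, h, b, hb, h'⟩
  obtain ⟨i, hi⟩ := exists_eq_diagonal hq hp hpos h
  obtain ⟨j, hj⟩ := exists_eq_diagonal hq hp hpos h'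
  rcases Sym2.eq_iff.1 hi with ⟨h1, h2⟩ | ⟨h1, h2⟩ <;>
  rcases Sym2.eq_iff.1 hj with ⟨h3, h4⟩ | ⟨h3, h4⟩ <;>
  · have hij := hq (h1.symm.trans h3)
    refine hb (h4.trans (Eq.trans (congrArg q ?_) h2.symm))
    clear * - hij
    revert i j
    decide

lemma exists_ne_diagonal {q : Fin 4 → V} (hq : Function.Injective q)
    (hp : ∀ i, p ∈ D.curve s(q i, q (i + 2))) (i : Fin 4) :
    ∃ e, s(q i, q (i + 2)) ≠ e ∧ p ∈ D.curve e :=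
  ⟨_, diagonals_ne hq i, hp (i + 1)⟩

lemma diagonal_eq_iff {q : Fin 4 → V} (hq : Function.Injective q) {i j : Fin 4}
    (h : s(q i, q (i + 2)) = s(q j, q (j + 2))) (hij : i ≠ j) : j = i + 2 := by
  rcases Sym2.eq_iff.1 h with ⟨h, -⟩ | ⟨-, h⟩
  · exact absurd (hq h) hij
  · exact (hq h).symm

/-- The disjoint crossings of a 1-plane drawing form a crossing system whose planarization has an
algebraic dual. -/
theorem IsKPlane.exists_crossingSystem [Fintype V] (hD : D.IsKPlane 1) :
    ∃ (X : Type) (_ : Fintype X) (S : CrossingSystem G X), HasAlgDual S.planarization := by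
  choose q hq hmem using fun x : D.disjointCrossings => x.2.2
  have hpos : ∀ x : D.disjointCrossings, (x : ℝ × ℝ) ∉ Set.range D.pos := fun x => x.2.1
  have huniq : ∀ {x y : D.disjointCrossings} {i j : Fin 4},
      s(q x i, q x (i + 2)) = s(q y j, q y (j + 2)) → x = y := by
    intro x y i j h
    obtain ⟨e, he, hx⟩ := exists_ne_diagonal (hq x) (hmem x) i
    obtain ⟨e', he', hy⟩ := exists_ne_diagonal (hq y) (hmem y) j
    exact Subtype.ext (hD.crossing_unique (hpos x) (hpos y) (hmem x i) (h ▸ hmem y j) hx hy he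
      (h ▸ he'))
  have hfin : Finite D.disjointCrossings :=
    Finite.of_injective (fun x => s(q x 0, q x (0 + 2))) fun x y h => huniq h
  let S : CrossingSystem G D.disjointCrossings :=
    ⟨q, hq, fun x i => D.mem_edgeSet_of_mem_curve (hmem x i), huniq⟩
  let K : V ⊕ D.disjointCrossings → Set (ℝ × ℝ) := Sum.elim D.star fun x => {(x : ℝ × ℝ)}
  have hx_star : ∀ (x : D.disjointCrossings) u, (x : ℝ × ℝ) ∉ D.star u := by
    intro x u hu
    rcases mem_star_cases hD hu (hmem x 0) with h | ⟨-, a, h⟩ | ⟨-, a, c, he, h⟩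
    · exact hpos x ⟨u, h.symm⟩
    · exact not_isLens_of_diagonals (hq x) (hmem x) h
    · obtain ⟨e, he₁, hc₁⟩ := h.exists_ne
      obtain ⟨e', he₂, hc₂⟩ := exists_ne_diagonal (hq x) (hmem x) 0
      obtain rfl : (x : ℝ × ℝ) = c := hD.crossing_unique (hpos x) h.1 (hmem x 0) (he ▸ h.2.1)
        hc₂ hc₁ he₂ (he ▸ he₁)
      exact not_isLens_of_diagonals (hq x) (hmem x) h
  let half : D.disjointCrossings → Fin 4 → Set (ℝ × ℝ) := fun x i =>
    D.initialSegment (q x i) (q x (i + 2)) x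
  have hhalf_star : ∀ {x i w p}, p ∈ half x i → p ∈ D.star w → w = q x i := by
    intro x i w p hp hw
    rcases mem_star_cases hD hw (mem_curve_of_mem_initialSegment hp) with
      rfl | ⟨hpp, a, h⟩ | ⟨-, a, c, he, h⟩
    · exact eq_of_pos_mem_initialSegment (hpos x) hp
    · have hpe := mem_curve_of_mem_initialSegment hp
      obtain ⟨e', he₂, hc₂⟩ := exists_ne_diagonal (hq x) (hmem x) i
      have : ∃ e, s(q x i, q x (i + 2)) ≠ e ∧ p ∈ D.curve e := by
        by_cases hs : s(q x i, q x (i + 2)) = s(w, a)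
        · exact hs ▸ h.exists_ne
        · exact ⟨_, hs, h.2.1⟩
      obtain ⟨e, he₁, hc₁⟩ := this
      obtain rfl : p = x := hD.crossing_unique hpp (hpos x) hpe (hmem x i) hc₁ hc₂ he₁ he₂
      exact absurd hw (hx_star x w)
    · obtain ⟨e, he₁, hc₁⟩ := h.exists_ne
      obtain ⟨e', he₂, hc₂⟩ := exists_ne_diagonal (hq x) (hmem x) i
      obtain rfl : (x : ℝ × ℝ) = c := hD.crossing_unique (hpos x) h.1 (hmem x i) (he ▸ h.2.1)
        hc₂ hc₁ he₂ (he ▸ he₁)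
      exact absurd h (not_isLens_of_diagonals (hq x) (hmem x))
  have hhalf_x : ∀ {x i} {y : D.disjointCrossings}, (y : ℝ × ℝ) ∈ half x i → y = x := by
    intro x i y hy
    obtain ⟨j, hj⟩ := exists_eq_diagonal (hq y) (hmem y) (hpos y)
      (mem_curve_of_mem_initialSegment hy)
    exact (huniq hj).symm
  have hfree_x : ∀ {u v} {x : D.disjointCrossings}, S.IsFree u v →
      (x : ℝ × ℝ) ∉ D.curve s(u, v) := by
    intro u v x h hx
    obtain ⟨i, hi⟩ := exists_eq_diagonal (hq x) (hmem x) (hpos x) hx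
    exact h.2 x i hi
  let A : Sym2 (V ⊕ D.disjointCrossings) → Set (ℝ × ℝ) := fun e =>
    {p | (∃ u v, e = s(.inl u, .inl v) ∧ p ∈ D.curve s(u, v)) ∨
      ∃ x i, e = s(.inl (q x i), .inr x) ∧ p ∈ half x i}
  have hA₀ : ∀ u v, A s(.inl u, .inl v) = D.curve s(u, v) := by
    intro u v
    ext p
    constructor
    · rintro (⟨a, b, he, hp⟩ | ⟨x, i, he, hp⟩)
      · have : s(u, v) = s(a, b) := by
          simpa [Sym2.eq_iff] using he
        rwa [this]
      · simp at he
    · exact fun hp => Or.inl ⟨u, v, rfl, hp⟩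
  have hA₁ : ∀ x i, A s(.inl (q x i), .inr x) = half x i := by
    intro x i
    ext p
    constructor
    · rintro (⟨a, b, he, hp⟩ | ⟨y, j, he, hp⟩)
      · simp at he
      · simp only [Sym2.eq_iff, Sum.inl.injEq, Sum.inr.injEq, reduceCtorEq, and_self,
          or_false] at he
        obtain ⟨he, rfl⟩ := he
        rwa [hq x he]
    · exact fun hp => Or.inr ⟨x, i, rfl, hp⟩
  refine ⟨D.disjointCrossings, Fintype.ofFinite _, S, ?_⟩
  let := Fintype.ofFinite D.disjointCrossings
  refine PlaneGrid.hasAlgDual_of_compact_model S.planarization K A ?_ ?_ ?_ ?_ ?_ ?_ ?_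
  · rintro (u | x)
    · exact isCompact_star hD
    · exact isCompact_singleton
  · rintro (u | x)
    · exact isConnected_star
    · exact isConnected_singleton
  · rintro (u | x) (v | y) h
    · exact disjoint_star hD fun huv => h (by rw [huv])
    · exact Set.disjoint_singleton_right.2 (hx_star y u)
    · exact Set.disjoint_singleton_left.2 (hx_star x v)
    · exact Set.disjoint_singleton.2 fun hxy => h (by rw [Subtype.ext hxy])
  · intro e he
    rcases S.mem_edgeSet_planarization.1 he with ⟨u, v, h, rfl⟩ | ⟨x, i, rfl⟩
    · exact hA₀ u v ▸ D.isCompact_curve h.1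
    · exact (hA₁ x i).symm ▸ isCompact_initialSegment (hmem x i)
  · intro e he
    rcases S.mem_edgeSet_planarization.1 he with ⟨u, v, h, rfl⟩ | ⟨x, i, rfl⟩
    · exact hA₀ u v ▸ D.isPreconnected_curve h.1
    · exact (hA₁ x i).symm ▸ isPreconnected_initialSegment (hmem x i)
  · intro e he w
    rcases S.mem_edgeSet_planarization.1 he with ⟨u, v, h, rfl⟩ | ⟨x, i, rfl⟩
    · rw [hA₀]
      rcases w with w | y
      · constructor
        · rintro ⟨p, hp, hw⟩
          suffices w ∈ s(u, v) by simpa using this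
          rcases mem_star_cases hD hw hp with rfl | ⟨hpp, a, hl⟩ | ⟨-, a, c, he, -⟩
          · exact D.mem_of_pos_mem_curve hp
          · obtain ⟨-, h₁, b, hb, h₂⟩ := hl
            rcases D.eq_or_eq_of_mem_curve hpp h₁ h₂ hp
              (fun h => hb (Sym2.congr_right.1 h).symm) with h | h <;> simp [h]
          · simp [he]
        · intro hw
          refine ⟨D.pos w, ?_, pos_mem_star⟩
          simp only [Sym2.mem_iff, Sum.inl.injEq] at hw
          rcases hw with rfl | rfl
          · exact D.pos_mem_curve h.1
          · rw [Sym2.eq_swap]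
            exact D.pos_mem_curve h.1.symm
      · refine iff_of_false ?_ (by simp)
        rintro ⟨_, hp, rfl⟩
        exact hfree_x h hp
    · rw [hA₁]
      rcases w with w | y
      · simp only [Sym2.mem_iff, Sum.inl.injEq, reduceCtorEq, or_false]
        constructor
        · rintro ⟨p, hp, hw⟩
          exact hhalf_star hp hw
        · rintro rfl
          exact ⟨_, pos_mem_initialSegment (hmem x i), pos_mem_star⟩
      · simp only [Sym2.mem_iff, Sum.inr.injEq, reduceCtorEq, false_or]
        constructor
        · rintro ⟨_, hp, rfl⟩
          exact hhalf_x hp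
        · rintro rfl
          exact ⟨_, mem_initialSegment_self (hmem y i), rfl⟩
  · have hcov : ∀ {p e e'}, p ∈ D.curve e → p ∈ D.curve e' → e ≠ e' → p ∈ ⋃ w, K w := by
      intro p e e' h h' hne
      by_cases hp : p ∈ Set.range D.pos
      · obtain ⟨w, rfl⟩ := hp
        exact Set.mem_iUnion.2 ⟨.inl w, pos_mem_star⟩
      · rcases exists_mem_star_or_mem_disjointCrossings hp h h' hne with ⟨u, hu⟩ | hx
        · exact Set.mem_iUnion.2 ⟨.inl u, hu⟩
        · exact Set.mem_iUnion.2 ⟨.inr ⟨p, hx⟩, rfl⟩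
    rintro e he e' he' hne p ⟨hp, hp'⟩
    rcases S.mem_edgeSet_planarization.1 he with ⟨u, v, h, rfl⟩ | ⟨x, i, rfl⟩ <;>
    rcases S.mem_edgeSet_planarization.1 he' with ⟨u', v', h', rfl⟩ | ⟨y, j, rfl⟩
    · rw [hA₀] at hp hp'
      refine hcov hp hp' fun h => hne ?_
      simpa [Sym2.eq_iff] using h
    · rw [hA₀] at hp
      rw [hA₁] at hp'
      exact hcov hp (mem_curve_of_mem_initialSegment hp') (h.2 y j)
    · rw [hA₁] at hp
      rw [hA₀] at hp'
      exact hcov (mem_curve_of_mem_initialSegment hp) hp' (h'.2 x i).symm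
    · rw [hA₁] at hp hp'
      by_cases hs : s(q x i, q x (i + 2)) = s(q y j, q y (j + 2))
      · obtain rfl := huniq hs
        obtain rfl := diagonal_eq_iff (hq x) hs fun hij => hne (by rw [hij])
        have hp'' : p ∈ D.initialSegment (q x (i + 2)) (q x i) x := by
          have h4 : i + 2 + 2 = i := by clear * -; revert i; decide
          simpa only [half, h4] using hp'
        exact Set.mem_iUnion.2 ⟨.inr x, eq_of_mem_initialSegment_inter hp hp''⟩
      · exact hcov (mem_curve_of_mem_initialSegment hp) (mem_curve_of_mem_initialSegment hp') hs

end PlaneDrawing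

/-! ### The Euler inequality -/

open Classical in
/-- Euler's inequality for a graph with an algebraic dual, where `T` is a set of faces that contains
both sides of each edge with two different sides. -/
theorem card_edgeFinset_lt_of_potential {W F : Type*} [Fintype W] [Nonempty W] {P : SimpleGraph W}
    {L R : Sym2 W → F}
    (hcut : ∀ C : Sym2 W → ZMod 2, (∀ w, ∑ e ∈ P.edgeFinset with w ∈ e, C e = 0) →
      ∃ h : F → ZMod 2, ∀ e ∈ P.edgeSet, C e = h (L e) + h (R e))
    {T : Finset F} (hT : ∀ e ∈ P.edgeSet, L e ≠ R e → L e ∈ T ∧ R e ∈ T) :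
    P.edgeFinset.card < T.card + Fintype.card W := by
  let E := P.edgeFinset
  let bd : (E → ZMod 2) →ₗ[ZMod 2] (W → ZMod 2) :=
    { toFun := fun C w => ∑ e : E, if w ∈ (e : Sym2 W) then C e else 0
      map_add' := fun C C' => by
        ext w
        simp only [Pi.add_apply, ← Finset.sum_add_distrib]
        exact Finset.sum_congr rfl fun e _ => by split_ifs <;> simp
      map_smul' := fun a C => by
        ext w
        simp [Finset.mul_sum] }
  let total : (W → ZMod 2) →ₗ[ZMod 2] ZMod 2 := ∑ w, LinearMap.proj w
  have htotal : ∀ z, total z = ∑ w, z w := fun z => by simp [total]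
  have hrange : LinearMap.range bd ≤ LinearMap.ker total := by
    rintro _ ⟨C, rfl⟩
    rw [LinearMap.mem_ker, htotal]
    change ∑ w, ∑ e : E, (if w ∈ (e : Sym2 W) then C e else 0) = 0
    rw [Finset.sum_comm]
    refine Finset.sum_eq_zero fun e _ => ?_
    obtain ⟨e, he⟩ := e
    induction e with
    | _ u v =>
      have huv : u ≠ v := (SimpleGraph.mem_edgeFinset.1 he : P.Adj u v).ne
      have hset : (Finset.univ.filter fun w => w ∈ s(u, v)) = {u, v} := by
        ext w
        simp
      rw [← Finset.sum_filter, hset, Finset.sum_pair huv, CharTwo.add_self_eq_zero]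
  have hsurj : LinearMap.range total = ⊤ := by
    obtain ⟨w⟩ := ‹Nonempty W›
    refine LinearMap.range_eq_top.2 fun a => ⟨Pi.single w a, ?_⟩
    rw [htotal, Finset.sum_pi_single']
    simp
  let span : (T → ZMod 2) →ₗ[ZMod 2] (E → ZMod 2) :=
    { toFun := fun h e => ∑ f : T, h f *
        ((if L e = f then 1 else 0) + (if R e = f then 1 else 0))
      map_add' := fun h h' => by
        ext e
        simp [add_mul, Finset.sum_add_distrib]
      map_smul' := fun a h => by
        ext e
        simp [Finset.mul_sum, mul_assoc] }
  have hker : LinearMap.ker bd ≤ LinearMap.range span := by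
    intro C hC
    obtain ⟨h, hh⟩ := hcut (fun e => if he : e ∈ E then C ⟨e, he⟩ else 0) fun w => by
      have := congrFun (LinearMap.mem_ker.1 hC) w
      change ∑ e : E, (if w ∈ (e : Sym2 W) then C e else 0) = 0 at this
      rw [Finset.sum_filter, ← Finset.sum_coe_sort]
      refine (Finset.sum_congr rfl fun e _ => ?_).trans this
      simp [E]
    refine ⟨fun f => h f, ?_⟩
    ext ⟨e, he⟩
    have hCe := hh e (SimpleGraph.mem_edgeFinset.1 he)
    rw [dif_pos he] at hCe
    rw [hCe]
    change ∑ f : T, h f * ((if L e = f then 1 else 0) + (if R e = f then 1 else 0)) = _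
    rw [Finset.sum_coe_sort T fun f =>
      h f * ((if L e = f then 1 else 0) + (if R e = f then 1 else 0))]
    by_cases hLR : L e = R e
    · simp [hLR, CharTwo.add_self_eq_zero]
    · obtain ⟨h1, h2⟩ := hT e (SimpleGraph.mem_edgeFinset.1 he) hLR
      simp [mul_add, Finset.sum_add_distrib, h1, h2]
  have h1 := LinearMap.finrank_range_add_finrank_ker bd
  have h2 := LinearMap.finrank_range_add_finrank_ker total
  have h3 := Submodule.finrank_mono hrange
  have h4 := Submodule.finrank_mono hker
  have h5 := LinearMap.finrank_range_le span
  rw [hsurj, finrank_top] at h2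
  simp only [Module.finrank_fintype_fun_eq_card, Module.finrank_self, Fintype.card_coe] at h1 h2 h5
  change E.card < _
  omega

/-! ### Faces of an algebraic dual -/

open Classical in
/-- An algebraic dual of `P`: the two sides `L e` and `R e` of each edge, such that the edges around
each face form an even subgraph and each even subgraph is a cut of the dual. -/
structure AlgDual {W : Type*} [Fintype W] (P : SimpleGraph W) (F : Type*) where
  L : Sym2 W → F
  R : Sym2 W → F
  even : ∀ f w, ∑ e ∈ P.edgeFinset with w ∈ e,
    ((if L e = f then 1 else 0) + (if R e = f then 1 else 0) : ZMod 2) = 0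
  cut : ∀ C : Sym2 W → ZMod 2, (∀ w, ∑ e ∈ P.edgeFinset with w ∈ e, C e = 0) →
    ∃ h : F → ZMod 2, ∀ e ∈ P.edgeSet, C e = h (L e) + h (R e)

namespace AlgDual

variable {W F : Type*} [Fintype W] {P : SimpleGraph W} (D : AlgDual P F)

open Classical in
/-- The edges with the face `f` on exactly one side. -/
noncomputable def face (f : F) : Finset (Sym2 W) :=
  P.edgeFinset.filter fun e => D.L e ≠ D.R e ∧ (D.L e = f ∨ D.R e = f)

variable {D} {f g : F} {e e' : Sym2 W}

lemma mem_face : e ∈ D.face f ↔ e ∈ P.edgeSet ∧ D.L e ≠ D.R e ∧ (D.L e = f ∨ D.R e = f) := by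
  simp [face]

open Classical in
lemma even_card_face (f : F) (w : W) : Even ((D.face f).filter fun e => w ∈ e).card := by
  rw [← ZMod.natCast_eq_zero_iff_even, ← D.even f w, face, Finset.filter_filter,
    Finset.card_filter, Finset.sum_filter, Nat.cast_sum]
  refine Finset.sum_congr rfl fun e _ => ?_
  have : (1 + 1 : ZMod 2) = 0 := by decide
  by_cases h1 : D.L e = f <;> by_cases h2 : D.R e = f <;> by_cases h3 : w ∈ e <;>
    simp [h1, h2, h3, this, eq_comm (a := f)]

lemma even_card_of_mem_iff {s : Finset (Sym2 W)} {w : W}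
    (hs : ∀ e, e ∈ s ↔ e ∈ D.face f ∧ w ∈ e) : Even s.card := by
  classical
  rw [show s = (D.face f).filter fun e => w ∈ e by ext e; simp [hs]]
  convert even_card_face (D := D) f w

lemma exists_ne_mem_face (he : e ∈ D.face f) {w : W} (hw : w ∈ e) :
    ∃ e' ∈ D.face f, e' ≠ e ∧ w ∈ e' := by
  classical
  have hmem : e ∈ (D.face f).filter fun e => w ∈ e := Finset.mem_filter.2 ⟨he, hw⟩
  have h1 : 1 < ((D.face f).filter fun e => w ∈ e).card := by
    have h0 := Finset.card_pos.2 ⟨e, hmem⟩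
    obtain ⟨k, hk⟩ := even_card_face (D := D) f w
    omega
  obtain ⟨e', h', hne⟩ := Finset.exists_mem_ne h1 e
  exact ⟨e', (Finset.mem_filter.1 h').1, hne, (Finset.mem_filter.1 h').2⟩

open Classical in
lemma eq_of_mem_face (hfg : f ≠ g) (he : e ∈ D.face f) (hg : e ∈ D.face g) (he' : e' ∈ D.face f)
    (hg' : e' ∈ D.face g) {C : Sym2 W → ZMod 2}
    (hC : ∀ w, ∑ e ∈ P.edgeFinset with w ∈ e, C e = 0) : C e = C e' := by
  obtain ⟨h, hh⟩ := D.cut C hC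
  have key : ∀ {e}, e ∈ D.face f → e ∈ D.face g → C e = h f + h g := by
    intro e he hg
    rw [mem_face] at he hg
    rw [hh e he.1]
    rcases he.2.2 with h1 | h1 <;> rcases hg.2.2 with h2 | h2
    · exact absurd (h1.symm.trans h2) hfg
    · rw [h1, h2]
    · rw [h1, h2, add_comm]
    · exact absurd (h1.symm.trans h2) hfg
  rw [key he hg, key he' hg']

end AlgDual

/-- Absence of cycles of length three and four. -/
structure HasGirthFive {V : Type*} (G : SimpleGraph V) : Prop where
  no_triangle : ∀ {a b c}, G.Adj a b → G.Adj a c → G.Adj b c → False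
  no_square : ∀ {a b c d}, a ≠ b → c ≠ d → G.Adj a c → G.Adj a d → G.Adj b c → G.Adj b d → False

namespace CrossingSystem

variable {V X F : Type*} {G : SimpleGraph V} (S : CrossingSystem G X)

/-- The part of a crossed edge from the crossing `x` to `q x i`. -/
def half (x : X) (i : Fin 4) : Sym2 (V ⊕ X) := s(.inl (S.q x i), .inr x)

variable {S} {x y : X} {i j k l : Fin 4} {u v : V}

lemma half_mem : S.half x i ∈ S.planarization.edgeSet :=
  S.mem_edgeSet_planarization.2 (Or.inr ⟨x, i, rfl⟩)

@[simp] lemma inr_mem_half : .inr y ∈ S.half x i ↔ y = x := by simp [half]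

@[simp] lemma inl_mem_half : .inl u ∈ S.half x i ↔ u = S.q x i := by simp [half]

@[simp] lemma half_inj : S.half x i = S.half y j ↔ x = y ∧ i = j := by
  constructor
  · intro h
    obtain rfl : x = y := inr_mem_half.1 (h ▸ inr_mem_half.2 rfl)
    exact ⟨rfl, S.inj x (inl_mem_half.1 (h ▸ inl_mem_half.2 rfl))⟩
  · rintro ⟨rfl, rfl⟩
    rfl

lemma half_ne_free : S.half x i ≠ s(.inl u, .inl v) := by simp [half]

lemma add_two_add_two (i : Fin 4) : i + 2 + 2 = i := by
  revert i
  decide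

lemma IsFree.symm (h : S.IsFree u v) : S.IsFree v u :=
  ⟨h.1.symm, by simpa only [Sym2.eq_swap (a := v)] using h.2⟩

lemma IsFree.ne_diagonal (h : S.IsFree (S.q x i) (S.q x j)) : j ≠ i + 2 := by
  rintro rfl
  exact h.2 x i rfl

lemma IsFree.ne_index (h : S.IsFree (S.q x i) (S.q x j)) : i ≠ j := by
  rintro rfl
  exact h.1.ne rfl

variable (S) in
/-- `uv` crosses at `x`, or `u` and `v` have a common neighbour to which exactly one of them is
joined by an edge crossing at `x`. -/
def Linked (x : X) (u v : V) : Prop :=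
  (∃ l, s(u, v) = s(S.q x l, S.q x (l + 2))) ∨
    ∃ a, ((∃ l, s(u, a) = s(S.q x l, S.q x (l + 2))) ∧ S.IsFree v a) ∨
      ((∃ l, s(v, a) = s(S.q x l, S.q x (l + 2))) ∧ S.IsFree u a)

lemma Linked.symm (h : S.Linked x u v) : S.Linked x v u := by
  rcases h with ⟨l, h⟩ | ⟨a, h⟩
  · exact Or.inl ⟨l, by rw [Sym2.eq_swap, h]⟩
  · exact Or.inr ⟨a, Or.symm h⟩

lemma adj_of_eq_diagonal (h : s(u, v) = s(S.q x l, S.q x (l + 2))) : G.Adj u v := by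
  rw [← SimpleGraph.mem_edgeSet, h]
  exact S.adj x l

lemma Linked.crossing_unique (hG : HasGirthFive G) (huv : u ≠ v) (hx : S.Linked x u v)
    (hy : S.Linked y u v) : x = y := by
  have key : ∀ {x a}, ((∃ l, s(u, a) = s(S.q x l, S.q x (l + 2))) ∧ S.IsFree v a) ∨
      ((∃ l, s(v, a) = s(S.q x l, S.q x (l + 2))) ∧ S.IsFree u a) → G.Adj u a ∧ G.Adj v a := by
    rintro x a (⟨⟨l, h⟩, h'⟩ | ⟨⟨l, h⟩, h'⟩)
    · exact ⟨adj_of_eq_diagonal h, h'.1⟩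
    · exact ⟨h'.1, adj_of_eq_diagonal h⟩
  rcases hx with ⟨l, hl⟩ | ⟨a, ha⟩ <;> rcases hy with ⟨m, hm⟩ | ⟨b, hb⟩
  · exact S.uniq (hl.symm.trans hm)
  · exact (hG.no_triangle (adj_of_eq_diagonal hl) (key hb).1 (key hb).2).elim
  · exact (hG.no_triangle (adj_of_eq_diagonal hm) (key ha).1 (key ha).2).elim
  · obtain rfl : a = b := by
      by_contra hab
      exact hG.no_square huv hab (key ha).1 (key hb).1 (key ha).2 (key hb).2
    rcases ha with ⟨⟨l, hl⟩, h⟩ | ⟨⟨l, hl⟩, h⟩ <;> rcases hb with ⟨⟨m, hm⟩, h'⟩ | ⟨⟨m, hm⟩, h'⟩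
    · exact S.uniq (hl.symm.trans hm)
    · exact (h.2 y m hm).elim
    · exact (h'.2 x l hl).elim
    · exact S.uniq (hl.symm.trans hm)

open Classical in
/-- The crossing at which an edge of the planarization ends. -/
noncomputable def crossingOf (e : Sym2 (V ⊕ X)) : Option X :=
  if h : ∃ x, Sum.inr x ∈ e then some h.choose else none

@[simp] lemma crossingOf_half : crossingOf (S.half x i) = some x := by
  have h : ∃ y, Sum.inr y ∈ S.half x i := ⟨x, inr_mem_half.2 rfl⟩
  rw [crossingOf, dif_pos h, inr_mem_half.1 h.choose_spec]

@[simp] lemma crossingOf_free : crossingOf (X := X) s(.inl u, .inl v) = none := by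
  simp [crossingOf]

variable [Fintype V] [Fintype X] (D : AlgDual S.planarization F)

/-- `f` is a triangular face consisting of two parts of crossed edges and an uncrossed edge. -/
def TriAt (f : F) (x : X) (i j : Fin 4) : Prop :=
  ∀ e, e ∈ D.face f ↔ e = S.half x i ∨ e = S.half x j ∨ e = s(.inl (S.q x i), .inl (S.q x j))

variable {D} {f g : F}

lemma TriAt.symm (h : TriAt D f x i j) : TriAt D f x j i := fun e => by
  rw [h e, Sym2.eq_swap (a := Sum.inl (S.q x i))]
  tauto

lemma isFree_of_mem_face (h : s(.inl u, .inl v) ∈ D.face f) : S.IsFree u v :=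
  (AlgDual.mem_face.1 h).1

lemma face_cases {e : Sym2 (V ⊕ X)} (h : e ∈ D.face f) :
    (∃ u v, S.IsFree u v ∧ e = s(.inl u, .inl v)) ∨ ∃ x i, e = S.half x i :=
  S.mem_edgeSet_planarization.1 (AlgDual.mem_face.1 h).1

lemma TriAt.isFree (h : TriAt D f x i j) : S.IsFree (S.q x i) (S.q x j) :=
  isFree_of_mem_face ((h _).2 (Or.inr (Or.inr rfl)))

lemma TriAt.left_mem (h : TriAt D f x i j) : S.half x i ∈ D.face f := (h _).2 (Or.inl rfl)

lemma TriAt.unique (hG : HasGirthFive G) (hf : TriAt D f x i j) (hg : TriAt D g x k l) :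
    (k = i ∧ l = j) ∨ (k = j ∧ l = i) := by
  have h1 := hf.isFree
  have h2 := hg.isFree
  have key : ∀ i j k l : Fin 4, i ≠ j → j ≠ i + 2 → k ≠ l → l ≠ k + 2 →
      ((k = i ∧ l = j) ∨ (k = j ∧ l = i)) ∨
      (k = i ∧ l = j + 2) ∨ (l = i ∧ k = j + 2) ∨ (k = j ∧ l = i + 2) ∨ (l = j ∧ k = i + 2) ∨
      (k = i + 2 ∧ l = j + 2) ∨ (l = i + 2 ∧ k = j + 2) := by
    decide
  have hsq : ∀ {k l}, S.IsFree (S.q x k) (S.q x l) → ¬ (k = i + 2 ∧ l = j + 2) := by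
    rintro k l h ⟨rfl, rfl⟩
    have hij : i + 2 ≠ j := h1.ne_diagonal.symm
    refine hG.no_square (a := S.q x i) (b := S.q x (j + 2)) (c := S.q x j) (d := S.q x (i + 2))
      (fun e => hij ?_) (fun e => hij (S.inj x e).symm) h1.1 (S.adj x i) (S.adj x j).symm h.1.symm
    rw [S.inj x e, add_two_add_two]
  rcases key i j k l h1.ne_index h1.ne_diagonal h2.ne_index h2.ne_diagonal with
    h | ⟨rfl, rfl⟩ | ⟨rfl, rfl⟩ | ⟨rfl, rfl⟩ | ⟨rfl, rfl⟩ | h | h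
  · exact h
  · exact (hG.no_triangle h1.1 h2.1 (S.adj x j)).elim
  · exact (hG.no_triangle h1.1 h2.1.symm (S.adj x j)).elim
  · exact (hG.no_triangle h1.1.symm h2.1 (S.adj x i)).elim
  · exact (hG.no_triangle h1.1.symm h2.1.symm (S.adj x i)).elim
  · exact (hsq h2 h).elim
  · exact (hsq h2.symm h).elim

variable (D) in
/-- The face on the other side of an edge of `f` is a triangle. -/
def Claimed (f : F) (e : Sym2 (V ⊕ X)) : Prop :=
  ∃ g, g ≠ f ∧ e ∈ D.face g ∧ ∃ x i j, TriAt D g x i j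

lemma Claimed.exists_triAt (h : Claimed D f (S.half x i)) :
    ∃ g, g ≠ f ∧ ∃ j, TriAt D g x i j := by
  obtain ⟨g, hg, he, y, k, l, ht⟩ := h
  refine ⟨g, hg, ?_⟩
  rcases (ht _).1 he with h | h | h
  · obtain ⟨rfl, rfl⟩ := half_inj.1 h
    exact ⟨_, ht⟩
  · obtain ⟨rfl, rfl⟩ := half_inj.1 h
    exact ⟨_, ht.symm⟩
  · exact absurd h half_ne_free

/-- Two faces share at most one edge at a crossing. -/
lemma pinch (hconn : ∀ e₁ e₂, (G.deleteEdges {e₁, e₂}).Preconnected) (hfg : f ≠ g) (hij : i ≠ j)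
    (hi : S.half x i ∈ D.face f) (hi' : S.half x i ∈ D.face g)
    (hj : S.half x j ∈ D.face f) (hj' : S.half x j ∈ D.face g) : False := by
  classical
  obtain ⟨k, hki, hkj⟩ : ∃ k : Fin 4, k ≠ i ∧ k ≠ j := by
    clear * -
    revert i j
    decide
  let bd : (Sym2 (V ⊕ X) → ZMod 2) → V ⊕ X → ZMod 2 := fun C w =>
    ∑ e ∈ S.planarization.edgeFinset with w ∈ e, C e
  have bd_add : ∀ C C' w, bd (C + C') w = bd C w + bd C' w := fun C C' w =>
    Finset.sum_add_distrib
  have bd_single : ∀ {a b : V ⊕ X}, S.planarization.Adj a b → ∀ w,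
      bd (Pi.single s(a, b) 1) w = (if w = a then 1 else 0) + (if w = b then 1 else 0) := by
    intro a b hab w
    have hne := hab.ne
    have : (s(a, b) ∈ S.planarization.edgeFinset.filter fun e => w ∈ e) ↔ w = a ∨ w = b := by
      simp [hab]
    simp only [bd, Finset.sum_pi_single', this]
    by_cases h1 : w = a <;> by_cases h2 : w = b <;> simp_all
  have hhalf : ∀ y l, S.planarization.Adj (.inl (S.q y l)) (.inr y) := fun y l => ⟨l, rfl⟩
  have hpath : ∀ z, Relation.ReflTransGen
      (G.deleteEdges {s(S.q x 0, S.q x (0 + 2)), s(S.q x 1, S.q x (1 + 2))}).Adj (S.q x i) z →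
      ∃ C : Sym2 (V ⊕ X) → ZMod 2, (∀ w, bd C w =
        (if w = .inl (S.q x i) then 1 else 0) + (if w = .inl z then 1 else 0)) ∧
        ∀ l, C (S.half x l) = 0 := by
    intro z hz
    induction hz with
    | refl =>
      refine ⟨0, fun w => ?_, fun l => rfl⟩
      rw [CharTwo.add_self_eq_zero]
      exact Finset.sum_eq_zero fun _ _ => rfl
    | @tail a b _ hab ih =>
      obtain ⟨C, hC, hC0⟩ := ih
      rw [SimpleGraph.deleteEdges_adj] at hab
      by_cases hfree : S.IsFree a b
      · refine ⟨C + Pi.single s(.inl a, .inl b) 1, fun w => ?_, fun l => ?_⟩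
        · rw [bd_add, hC, bd_single (show S.planarization.Adj (.inl a) (.inl b) from hfree),
            add_assoc, ← add_assoc (if w = Sum.inl a then (1 : ZMod 2) else 0),
            CharTwo.add_self_eq_zero, zero_add]
        · rw [Pi.add_apply, hC0, Pi.single_eq_of_ne half_ne_free, add_zero]
      · have : ∃ y l, s(a, b) = s(S.q y l, S.q y (l + 2)) := by
          by_contra! hcon
          exact hfree ⟨hab.1, hcon⟩
        obtain ⟨y, l, hyl⟩ := this
        have hxy : y ≠ x := by
          rintro rfl
          refine hab.2 ?_
          rw [hyl]
          clear * -
          fin_cases l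
          · exact Or.inl rfl
          · exact Or.inr rfl
          · exact Or.inl Sym2.eq_swap
          · exact Or.inr Sym2.eq_swap
        refine ⟨C + (Pi.single (S.half y l) 1 + Pi.single (S.half y (l + 2)) 1),
          fun w => ?_, fun m => ?_⟩
        · rw [bd_add, bd_add, hC, half, half, bd_single (hhalf y l), bd_single (hhalf y (l + 2))]
          have h2 : ∀ t : ZMod 2, t + t = 0 := CharTwo.add_self_eq_zero
          rcases Sym2.eq_iff.1 hyl with ⟨rfl, rfl⟩ | ⟨rfl, rfl⟩
          · linear_combination h2 (if w = Sum.inl (S.q y l) then (1 : ZMod 2) else 0) +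
              h2 (if w = Sum.inr y then (1 : ZMod 2) else 0)
          · linear_combination h2 (if w = Sum.inl (S.q y (l + 2)) then (1 : ZMod 2) else 0) +
              h2 (if w = Sum.inr y then (1 : ZMod 2) else 0)
        · rw [Pi.add_apply, Pi.add_apply, hC0, Pi.single_eq_of_ne, Pi.single_eq_of_ne]
          · simp
          · exact fun h => hxy (half_inj.1 h).1.symm
          · exact fun h => hxy (half_inj.1 h).1.symm
  obtain ⟨C, hC, hC0⟩ := hpath (S.q x k)
    ((SimpleGraph.reachable_iff_reflTransGen _ _).1 (hconn _ _ _ _))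
  have hcyc := AlgDual.eq_of_mem_face hfg hi hi' hj hj'
    (C := C + (Pi.single (S.half x i) 1 + Pi.single (S.half x k) 1)) fun w => by
      suffices bd (C + (Pi.single (S.half x i) 1 + Pi.single (S.half x k) 1)) w = 0 by
        convert this
      rw [bd_add, bd_add, hC, half, half, bd_single (hhalf x i), bd_single (hhalf x k)]
      have h2 : ∀ t : ZMod 2, t + t = 0 := CharTwo.add_self_eq_zero
      linear_combination h2 (if w = Sum.inl (S.q x i) then (1 : ZMod 2) else 0) +
        h2 (if w = Sum.inl (S.q x k) then (1 : ZMod 2) else 0) +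
        h2 (if w = Sum.inr x then (1 : ZMod 2) else 0)
  simp [hC0, hki.symm, hij.symm, hkj.symm] at hcyc

lemma Claimed.unique (hG : HasGirthFive G)
    (hconn : ∀ e₁ e₂, (G.deleteEdges {e₁, e₂}).Preconnected) (hij : i ≠ j)
    (hi : S.half x i ∈ D.face f) (hj : S.half x j ∈ D.face f) (hci : Claimed D f (S.half x i))
    (hcj : Claimed D f (S.half x j)) : False := by
  obtain ⟨g, hg, k, hk⟩ := hci.exists_triAt
  obtain ⟨g', -, l, hl⟩ := hcj.exists_triAt
  rcases hk.unique hG hl with ⟨rfl, -⟩ | ⟨rfl, -⟩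
  · exact hij rfl
  · exact pinch hconn hg.symm hij hi hk.left_mem hj hk.symm.left_mem

lemma TriAt.not_claimed (hG : HasGirthFive G)
    (hconn : ∀ e₁ e₂, (G.deleteEdges {e₁, e₂}).Preconnected) (h : TriAt D f x i j) :
    ¬ Claimed D f (S.half x i) := by
  intro hc
  obtain ⟨g, hg, k, hk⟩ := hc.exists_triAt
  rcases h.unique hG hk with ⟨-, rfl⟩ | ⟨hij, -⟩
  · exact pinch hconn hg.symm hk.isFree.ne_index h.left_mem hk.left_mem h.symm.left_mem
      hk.symm.left_mem
  · exact h.isFree.ne_index hij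

lemma Claimed.linked (hconn : ∀ e₁ e₂, (G.deleteEdges {e₁, e₂}).Preconnected) (hij : i ≠ j)
    (hi : S.half x i ∈ D.face f) (hj : S.half x j ∈ D.face f) (hc : Claimed D f (S.half x i)) :
    S.Linked x (S.q x i) (S.q x j) := by
  obtain ⟨g, hg, k, hk⟩ := hc.exists_triAt
  have hkj : k ≠ j := by
    rintro rfl
    exact pinch hconn hg.symm hij hi hk.left_mem hj hk.symm.left_mem
  by_cases hj2 : j = i + 2
  · subst hj2
    exact Or.inl ⟨i, rfl⟩
  have : k = j + 2 := by
    have h1 := hk.isFree.ne_index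
    have h2 := hk.isFree.ne_diagonal
    clear * - hij hkj hj2 h1 h2
    revert i j k
    decide
  subst this
  exact Or.inr ⟨S.q x (j + 2), Or.inr ⟨⟨j, rfl⟩, hk.isFree⟩⟩

lemma four_le_card_face (hG : HasGirthFive G) (hne : (D.face f).Nonempty)
    (hhalf : ∀ x i, S.half x i ∉ D.face f) : 4 ≤ (D.face f).card := by
  classical
  have hfree : ∀ {u v}, s(.inl u, .inl v) ∈ D.face f →
      ∃ w, w ≠ u ∧ s(.inl v, .inl w) ∈ D.face f := by
    intro u v h
    obtain ⟨e, he, hne, hv⟩ := AlgDual.exists_ne_mem_face h (Sym2.mem_mk_right _ _)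
    rcases face_cases he with ⟨a, b, -, rfl⟩ | ⟨x, i, rfl⟩
    · simp only [Sym2.mem_iff, Sum.inl.injEq] at hv
      rcases hv with rfl | rfl
      · exact ⟨b, fun h => hne (by rw [h, Sym2.eq_swap]), he⟩
      · exact ⟨a, fun h => hne (by rw [h]), by rwa [Sym2.eq_swap]⟩
    · exact (hhalf x i he).elim
  obtain ⟨e, he⟩ := hne
  rcases face_cases he with ⟨u, v, -, rfl⟩ | ⟨x, i, rfl⟩
  swap
  · exact (hhalf x i he).elim
  obtain ⟨w, hwu, hw⟩ := hfree he
  obtain ⟨t, htv, ht⟩ := hfree (u := v) (v := u) (by rwa [Sym2.eq_swap])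
  obtain ⟨z, hzv, hz⟩ := hfree hw
  have h1 := (isFree_of_mem_face he).1
  have h2 := (isFree_of_mem_face hw).1
  have h3 := (isFree_of_mem_face ht).1
  have htw : t ≠ w := by
    rintro rfl
    exact hG.no_triangle h1 h3 h2
  have hsub : ({s(.inl u, .inl v), s(.inl v, .inl w), s(.inl u, .inl t), s(.inl w, .inl z)} :
      Finset (Sym2 (V ⊕ X))) ⊆ D.face f := by
    simp [Finset.insert_subset_iff, he, hw, ht, hz]
  refine le_of_eq_of_le ?_ (Finset.card_le_card hsub)
  have := h1.ne
  have := h2.ne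
  have := h3.ne
  rw [Finset.card_insert_of_notMem, Finset.card_insert_of_notMem, Finset.card_insert_of_notMem,
    Finset.card_singleton] <;> simp <;> grind

lemma exists_free_of_half (hhalf : ∀ {y l}, S.half y l ∈ D.face f → y = x ∧ (l = i ∨ l = j))
    (hi : S.half x i ∈ D.face f) : ∃ u, s(.inl (S.q x i), .inl u) ∈ D.face f := by
  obtain ⟨e, he, hne, hv⟩ := AlgDual.exists_ne_mem_face hi (inl_mem_half.2 rfl)
  rcases face_cases he with ⟨a, b, -, rfl⟩ | ⟨y, l, rfl⟩
  · simp only [Sym2.mem_iff, Sum.inl.injEq] at hv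
    rcases hv with h | h
    · exact ⟨b, by rwa [h]⟩
    · exact ⟨a, by rwa [h, Sym2.eq_swap]⟩
  · obtain ⟨rfl, -⟩ := hhalf he
    exact absurd (by rw [S.inj y (inl_mem_half.1 hv)]) hne

lemma exists_free_ne_free
    (hhalf : ∀ {y l}, S.half y l ∈ D.face f → y = x ∧ (l = i ∨ l = j)) (hij : i ≠ j)
    (hi : S.half x i ∈ D.face f) (hj : S.half x j ∈ D.face f) (hT : ¬ TriAt D f x i j) :
    ∃ u v u' v', s(.inl u, .inl v) ∈ D.face f ∧ s(.inl u', .inl v') ∈ D.face f ∧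
      s(u, v) ≠ s(u', v') := by
  by_contra! hcon
  obtain ⟨u, hu⟩ := exists_free_of_half hhalf hi
  obtain ⟨v, hv⟩ := exists_free_of_half (fun h => (hhalf h).imp_right Or.symm) hj
  have huv : u = S.q x j := by
    rcases Sym2.eq_iff.1 (hcon _ _ _ _ hu hv) with ⟨h, -⟩ | ⟨-, h⟩
    · exact absurd (S.inj x h) hij
    · exact h
  subst huv
  refine hT fun e => ⟨fun he => ?_, ?_⟩
  · rcases face_cases he with ⟨a, b, -, rfl⟩ | ⟨y, l, rfl⟩
    · refine Or.inr (Or.inr ?_)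
      simpa [Sym2.eq_iff] using hcon _ _ _ _ he hu
    · obtain ⟨rfl, rfl | rfl⟩ := hhalf he
      · exact Or.inl rfl
      · exact Or.inr (Or.inl rfl)
  · rintro (rfl | rfl | rfl)
    exacts [hi, hj, hu]

lemma not_two_crossings (hG : HasGirthFive G)
    (hconn : ∀ e₁ e₂, (G.deleteEdges {e₁, e₂}).Preconnected) (hxy : x ≠ y) (hij : i ≠ j)
    (hkl : k ≠ l) (hi : S.half x i ∈ D.face f) (hj : S.half x j ∈ D.face f)
    (hk : S.half y k ∈ D.face f) (hl : S.half y l ∈ D.face f)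
    (hall : ∀ e ∈ D.face f, e = S.half x i ∨ e = S.half x j ∨ e = S.half y k ∨ e = S.half y l)
    (hcx : Claimed D f (S.half x i)) (hcy : Claimed D f (S.half y k)) : False := by
  have hmatch : ∀ {m}, S.half x m ∈ D.face f → S.q x m = S.q y k ∨ S.q x m = S.q y l := by
    intro m hm
    obtain ⟨e, he, hne, hv⟩ := AlgDual.exists_ne_mem_face hm (inl_mem_half.2 rfl)
    rcases hall e he with rfl | rfl | rfl | rfl
    · exact absurd (by rw [S.inj x (inl_mem_half.1 hv)]) hne
    · exact absurd (by rw [S.inj x (inl_mem_half.1 hv)]) hne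
    · exact Or.inl (inl_mem_half.1 hv)
    · exact Or.inr (inl_mem_half.1 hv)
  have h1 := hcx.linked hconn hij hi hj
  have h2 := hcy.linked hconn hkl hk hl
  have hne : S.q x i ≠ S.q x j := fun h => hij (S.inj x h)
  refine hxy (h1.crossing_unique hG hne ?_)
  rcases hmatch hi with h | h <;> rcases hmatch hj with h' | h'
  · exact absurd (h.trans h'.symm) hne
  · rwa [h, h']
  · rw [h, h']
    exact h2.symm
  · exact absurd (h.trans h'.symm) hne

open Classical in
variable (D) in
/-- The indicator of triangular faces. -/
noncomputable def triIndicator (f : F) : ℤ := if ∃ x i j, TriAt D f x i j then 1 else 0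

variable (D) in
/-- The charge that the edge `e` gives to the face `f` on one of its sides. -/
noncomputable def charge (f : F) (e : Sym2 (V ⊕ X)) : ℤ :=
  (crossingOf e).elim 14 fun _ =>
    13 + 4 * (2 * triIndicator D f - triIndicator D (D.L e) - triIndicator D (D.R e))

lemma charge_free : charge D f s(.inl u, .inl v) = 14 := by
  simp [charge]

open Classical in
lemma charge_half (h : S.half x i ∈ D.face f) : charge D f (S.half x i) =
    13 + 4 * triIndicator D f - if Claimed D f (S.half x i) then 4 else 0 := by
  obtain ⟨g, hgf, hg, hLR, huniq⟩ : ∃ g, g ≠ f ∧ S.half x i ∈ D.face g ∧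
      triIndicator D (D.L (S.half x i)) + triIndicator D (D.R (S.half x i)) =
        triIndicator D f + triIndicator D g ∧
      ∀ g', g' ≠ f → S.half x i ∈ D.face g' → g' = g := by
    obtain ⟨he, hne, hL | hR⟩ := AlgDual.mem_face.1 h
    · refine ⟨_, fun h' => hne (hL.trans h'.symm), AlgDual.mem_face.2 ⟨he, hne, Or.inr rfl⟩,
        by rw [hL], fun g' hg' hm => ?_⟩
      rcases (AlgDual.mem_face.1 hm).2.2 with h1 | h1
      · exact absurd (h1.symm.trans hL) hg'
      · exact h1.symm
    · refine ⟨_, fun h' => hne (h'.trans hR.symm), AlgDual.mem_face.2 ⟨he, hne, Or.inl rfl⟩,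
        by rw [hR, add_comm], fun g' hg' hm => ?_⟩
      rcases (AlgDual.mem_face.1 hm).2.2 with h1 | h1
      · exact h1.symm
      · exact absurd (h1.symm.trans hR) hg'
  have hc : Claimed D f (S.half x i) ↔ ∃ x i j, TriAt D g x i j := by
    constructor
    · rintro ⟨g', hg', hm, ht⟩
      rwa [← huniq g' hg' hm]
    · exact fun ht => ⟨g, hgf, hg, ht⟩
  have htri : triIndicator D g = if Claimed D f (S.half x i) then 1 else 0 := by
    simp only [triIndicator, hc]
  simp only [charge, crossingOf_half, Option.elim_some]
  split_ifs at htri ⊢ <;> linarith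

lemma charge_add_charge (e : Sym2 (V ⊕ X)) :
    charge D (D.L e) e + charge D (D.R e) e = (crossingOf e).elim 28 fun _ => 26 := by
  rw [charge, charge]
  cases crossingOf e
  · norm_num
  · simp only [Option.elim_some]
    ring

set_option maxHeartbeats 1000000 in
/-- Every face receives charge at least `48`. -/
lemma le_sum_charge (hG : HasGirthFive G)
    (hconn : ∀ e₁ e₂, (G.deleteEdges {e₁, e₂}).Preconnected) (hne : (D.face f).Nonempty) :
    48 ≤ ∑ e ∈ D.face f, charge D f e := by
  classical
  by_cases htri : ∃ x i j, TriAt D f x i j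
  · have h1 : triIndicator D f = 1 := if_pos htri
    obtain ⟨x, i, j, h⟩ := htri
    have hface : D.face f = {S.half x i, S.half x j, s(.inl (S.q x i), .inl (S.q x j))} := by
      ext e
      simpa using h e
    have hij := h.isFree.ne_index
    rw [hface, Finset.sum_insert, Finset.sum_insert, Finset.sum_singleton, charge_half h.left_mem,
      charge_half h.symm.left_mem, charge_free, if_neg (h.not_claimed hG hconn),
      if_neg (h.symm.not_claimed hG hconn), h1]
    · norm_num
    · simpa using half_ne_free
    · simp [hij, half_ne_free]
  have h0 : triIndicator D f = 0 := if_neg htri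
  let T : Option X → Finset (Sym2 (V ⊕ X)) := fun o => (D.face f).filter fun e => crossingOf e = o
  have hT : ∀ {x e}, e ∈ T (some x) ↔ ∃ i, e = S.half x i ∧ S.half x i ∈ D.face f := by
    intro x e
    rw [Finset.mem_filter]
    constructor
    · rintro ⟨he, hx⟩
      rcases face_cases he with ⟨a, b, -, rfl⟩ | ⟨y, l, rfl⟩
      · simp at hx
      · rw [crossingOf_half, Option.some.injEq] at hx
        subst hx
        exact ⟨l, rfl, he⟩
    · rintro ⟨i, rfl, hi⟩
      exact ⟨hi, crossingOf_half⟩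
  have heven : ∀ x, Even (T (some x)).card := by
    intro x
    refine AlgDual.even_card_of_mem_iff (D := D) (f := f) (w := Sum.inr x) fun e => ?_
    rw [hT]
    constructor
    · rintro ⟨i, rfl, hi⟩
      exact ⟨hi, inr_mem_half.2 rfl⟩
    · rintro ⟨he, hx⟩
      rcases face_cases he with ⟨a, b, -, rfl⟩ | ⟨y, l, rfl⟩
      · simp at hx
      · obtain rfl := inr_mem_half.1 hx
        exact ⟨l, rfl, he⟩
  have htotal : ∑ e ∈ D.face f, charge D f e =
      14 * (T none).card + ∑ x, ∑ e ∈ T (some x), charge D f e := by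
    rw [← Finset.sum_fiberwise (D.face f) crossingOf, Fintype.sum_option]
    congr 1
    rw [Finset.sum_congr rfl (g := fun _ => 14), Finset.sum_const, nsmul_eq_mul, mul_comm]
    · intro e he
      rcases face_cases (Finset.mem_filter.1 he).1 with ⟨a, b, -, rfl⟩ | ⟨y, l, rfl⟩
      · exact charge_free
      · simp at he
  have hcharge : ∀ x, ∑ e ∈ T (some x), charge D f e =
      13 * (T (some x)).card - 4 * ((T (some x)).filter (Claimed D f)).card := by
    intro x
    rw [Finset.sum_congr rfl (g := fun e => 13 - if Claimed D f e then 4 else 0),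
      Finset.sum_sub_distrib, Finset.sum_const, ← Finset.sum_filter, Finset.sum_const]
    · simp only [nsmul_eq_mul]
      ring
    · intro e he
      obtain ⟨i, rfl, hi⟩ := hT.1 he
      rw [charge_half hi, h0]
      ring
  have hclaim : ∀ x, ((T (some x)).filter (Claimed D f)).card ≤ 1 := by
    intro x
    refine Finset.card_le_one.2 fun e he e' he' => ?_
    obtain ⟨he, hc⟩ := Finset.mem_filter.1 he
    obtain ⟨he', hc'⟩ := Finset.mem_filter.1 he'
    obtain ⟨i, rfl, hi⟩ := hT.1 he
    obtain ⟨j, rfl, hj⟩ := hT.1 he'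
    by_contra hij
    exact hc.unique hG hconn (fun h => hij (by rw [h])) hi hj hc'
  have hnonneg : ∀ x, 0 ≤ ∑ e ∈ T (some x), charge D f e := by
    intro x
    rw [hcharge]
    have := Finset.card_filter_le (T (some x)) (Claimed D f)
    omega
  have hlow : ∀ x, (T (some x)).Nonempty → 22 ≤ ∑ e ∈ T (some x), charge D f e := by
    intro x hx
    have := Finset.card_pos.2 hx
    have := hclaim x
    obtain ⟨k, hk⟩ := heven x
    rw [hcharge]
    omega
  /- A crossing with a small contribution has two edges on the face, one of them claimed. -/
  have hpair : ∀ x, (T (some x)).Nonempty → (∑ e ∈ T (some x), charge D f e < 48) →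
      ∃ i j, i ≠ j ∧ T (some x) = {S.half x i, S.half x j} ∧ S.half x i ∈ D.face f ∧
        S.half x j ∈ D.face f ∧
        (∑ e ∈ T (some x), charge D f e < 26 → Claimed D f (S.half x i)) := by
    intro x hx hlt
    have h1 := Finset.card_pos.2 hx
    have h2 := hclaim x
    obtain ⟨k, hk⟩ := heven x
    rw [hcharge] at hlt ⊢
    obtain ⟨e, e', hee, hTe⟩ := Finset.card_eq_two.1 (show (T (some x)).card = 2 by omega)
    obtain ⟨i, rfl, hi⟩ := hT.1 (hTe ▸ Finset.mem_insert_self e _)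
    obtain ⟨j, rfl, hj⟩ := hT.1 (hTe ▸ Finset.mem_insert_of_mem (Finset.mem_singleton_self e'))
    have hij : i ≠ j := fun h => hee (by rw [h])
    by_cases hc : Claimed D f (S.half x i)
    · exact ⟨i, j, hij, hTe, hi, hj, fun _ => hc⟩
    · refine ⟨j, i, hij.symm, by rw [hTe, Finset.pair_comm], hj, hi, fun hlt' => ?_⟩
      by_contra hc'
      have : (T (some x)).filter (Claimed D f) = ∅ := by
        rw [hTe]
        simp [Finset.filter_insert, Finset.filter_singleton, hc, hc']
      rw [this, Finset.card_empty] at hlt'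
      omega
  rw [htotal]
  let Y : Finset X := Finset.univ.filter fun x => (T (some x)).Nonempty
  have hY : ∀ {x}, x ∈ Y ↔ (T (some x)).Nonempty := by simp [Y]
  have hsum : ∑ x, ∑ e ∈ T (some x), charge D f e =
      ∑ x ∈ Y, ∑ e ∈ T (some x), charge D f e := by
    refine (Finset.sum_subset (Finset.subset_univ Y) fun x _ hx => ?_).symm
    rw [hY, Finset.not_nonempty_iff_eq_empty] at hx
    rw [hx, Finset.sum_empty]
  have hhalf : ∀ {y l}, S.half y l ∈ D.face f → S.half y l ∈ T (some y) := fun {y l} h =>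
    hT.2 ⟨l, rfl, h⟩
  have hYhalf : ∀ {y l}, S.half y l ∈ D.face f → y ∈ Y := fun h => hY.2 ⟨_, hhalf h⟩
  rw [hsum]
  obtain h3 | h3 : 3 ≤ Y.card ∨ Y.card < 3 := le_or_gt _ _
  · have := Finset.card_nsmul_le_sum Y (fun x => ∑ e ∈ T (some x), charge D f e) 22
      fun x hx => hlow x (hY.1 hx)
    rw [nsmul_eq_mul] at this
    have h4 : (3 : ℤ) ≤ Y.card := by exact_mod_cast h3
    linarith
  interval_cases hcard : Y.card
  · have hnone : ∀ x i, S.half x i ∉ D.face f := fun x i h => by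
      have := hYhalf h
      rw [Finset.card_eq_zero.1 hcard] at this
      simp at this
    have h4 := four_le_card_face hG hne hnone
    have : T none = D.face f := by
      refine Finset.filter_true_of_mem fun e he => ?_
      rcases face_cases he with ⟨a, b, -, rfl⟩ | ⟨y, l, rfl⟩
      · exact crossingOf_free
      · exact absurd he (hnone y l)
    rw [this, Finset.card_eq_zero.1 hcard, Finset.sum_empty]
    omega
  · obtain ⟨x, hx⟩ := Finset.card_eq_one.1 hcard
    have hxT : (T (some x)).Nonempty := hY.1 (hx ▸ Finset.mem_singleton_self x)
    rw [hx, Finset.sum_singleton]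
    by_contra! hlt
    obtain ⟨i, j, hij, hTx, hi, hj, -⟩ := hpair x hxT (by omega)
    have h22 := hlow x hxT
    obtain ⟨u, v, u', v', h1, h2, h12⟩ := exists_free_ne_free (x := x) (i := i) (j := j)
      (fun {y l} h => by
        obtain rfl : y = x := by simpa [hx] using hYhalf h
        have := hhalf h
        rw [hTx] at this
        simpa using this) hij hi hj fun h => htri ⟨x, i, j, h⟩
    have : 2 ≤ (T none).card := by
      refine Finset.one_lt_card.2 ⟨_, Finset.mem_filter.2 ⟨h1, crossingOf_free⟩, _,
        Finset.mem_filter.2 ⟨h2, crossingOf_free⟩, fun h => h12 ?_⟩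
      simpa [Sym2.eq_iff] using h
    omega
  · obtain ⟨x, y, hxy, hYxy⟩ := Finset.card_eq_two.1 hcard
    have hxT : (T (some x)).Nonempty := hY.1 (hYxy ▸ Finset.mem_insert_self x _)
    have hyT : (T (some y)).Nonempty :=
      hY.1 (hYxy ▸ Finset.mem_insert_of_mem (Finset.mem_singleton_self y))
    rw [hYxy, Finset.sum_pair hxy]
    by_contra! hlt
    have hx22 := hlow x hxT
    have hy22 := hlow y hyT
    obtain ⟨i, j, hij, hTx, hi, hj, hcx⟩ := hpair x hxT (by omega)
    obtain ⟨k, l, hkl, hTy, hk, hl, hcy⟩ := hpair y hyT (by omega)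
    have hnone : T none = ∅ := Finset.card_eq_zero.1 (by omega)
    refine not_two_crossings hG hconn hxy hij hkl hi hj hk hl (fun e he => ?_) (hcx (by omega))
      (hcy (by omega))
    rcases face_cases he with ⟨a, b, -, rfl⟩ | ⟨z, m, rfl⟩
    · have : s(Sum.inl a, Sum.inl b) ∈ T none := Finset.mem_filter.2 ⟨he, crossingOf_free⟩
      simp [hnone] at this
    · have hz := hYhalf he
      rw [hYxy, Finset.mem_insert, Finset.mem_singleton] at hz
      rcases hz with rfl | rfl
      · have := hhalf he
        rw [hTx, Finset.mem_insert, Finset.mem_singleton] at this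
        exact this.imp_right Or.inl
      · have := hhalf he
        rw [hTy, Finset.mem_insert, Finset.mem_singleton] at this
        exact Or.inr (Or.inr this)

variable (D) in
open Classical in
/-- The total charge received by the faces is at most twice the total weight of the edges. -/
lemma sum_charge_le (T : Finset F)
    (hT : ∀ e ∈ S.planarization.edgeSet, D.L e ≠ D.R e → D.L e ∈ T ∧ D.R e ∈ T) :
    ∑ f ∈ T, ∑ e ∈ D.face f, charge D f e ≤
      ∑ e ∈ S.planarization.edgeFinset, (crossingOf e).elim 28 fun _ => 26 := by
  simp only [AlgDual.face, Finset.sum_filter]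
  rw [Finset.sum_comm]
  refine Finset.sum_le_sum fun e he => ?_
  by_cases hLR : D.L e = D.R e
  · simp only [hLR, ne_eq, not_true_eq_false, false_and, if_false, Finset.sum_const_zero]
    cases crossingOf e <;> simp
  · obtain ⟨h1, h2⟩ := hT e (SimpleGraph.mem_edgeFinset.1 he) hLR
    have hset : (T.filter fun f => D.L e ≠ D.R e ∧ (D.L e = f ∨ D.R e = f)) = {D.L e, D.R e} := by
      ext f
      simp only [Finset.mem_filter, Finset.mem_insert, Finset.mem_singleton]
      constructor
      · rintro ⟨-, -, h | h⟩
        · exact Or.inl h.symm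
        · exact Or.inr h.symm
      · rintro (rfl | rfl)
        · exact ⟨h1, hLR, Or.inl rfl⟩
        · exact ⟨h2, hLR, Or.inr rfl⟩
    rw [← Finset.sum_filter, hset, Finset.sum_pair hLR, charge_add_charge]

variable (S) in
open Classical in
lemma card_edges_bounds : ∃ a b : ℕ, S.planarization.edgeFinset.card = a + b ∧
    (∑ e ∈ S.planarization.edgeFinset, (crossingOf e).elim 28 fun _ => 26 : ℤ) = 28 * a + 26 * b ∧
    4 * Fintype.card X ≤ b ∧ G.edgeSet.ncard ≤ a + 2 * Fintype.card X := by
  refine ⟨(S.planarization.edgeFinset.filter fun e => crossingOf e = none).card,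
    (S.planarization.edgeFinset.filter fun e => ¬ crossingOf e = none).card,
    (Finset.card_filter_add_card_filter_not _).symm, ?_, ?_, ?_⟩
  · rw [← Finset.sum_filter_add_sum_filter_not _ fun e => crossingOf e = none,
      Finset.sum_congr rfl (g := fun _ => 28), Finset.sum_const,
      Finset.sum_congr (s₁ := Finset.filter (fun e => ¬ crossingOf e = none) _) rfl
        (g := fun _ => 26), Finset.sum_const, nsmul_eq_mul, nsmul_eq_mul, mul_comm, mul_comm (26 : ℤ)]
    · intro e he
      obtain ⟨x, hx⟩ := Option.ne_none_iff_exists'.1 (Finset.mem_filter.1 he).2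
      simp [hx]
    · intro e he
      simp [(Finset.mem_filter.1 he).2]
  · have : (Finset.univ : Finset (X × Fin 4)).card = 4 * Fintype.card X := by
      simp [mul_comm]
    rw [← this]
    refine Finset.card_le_card_of_injOn (fun p => S.half p.1 p.2) (fun p _ => ?_)
      fun p _ p' _ h => ?_
    · simpa using half_mem
    · exact Prod.ext (half_inj.1 h).1 (half_inj.1 h).2
  · have hsub : G.edgeFinset ⊆ (G.edgeFinset.filter fun e => ∀ x i, e ≠ s(S.q x i, S.q x (i + 2))) ∪
        Finset.univ.image fun p : X × Fin 2 =>
          s(S.q p.1 (p.2.castLE (by norm_num)), S.q p.1 (p.2.castLE (by norm_num) + 2)) := by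
      intro e he
      by_cases h : ∀ x i, e ≠ s(S.q x i, S.q x (i + 2))
      · exact Finset.mem_union_left _ (Finset.mem_filter.2 ⟨he, h⟩)
      · push Not at h
        obtain ⟨x, i, rfl⟩ := h
        refine Finset.mem_union_right _ (Finset.mem_image.2 ?_)
        fin_cases i
        · exact ⟨(x, 0), Finset.mem_univ _, rfl⟩
        · exact ⟨(x, 1), Finset.mem_univ _, rfl⟩
        · exact ⟨(x, 0), Finset.mem_univ _, Sym2.eq_swap⟩
        · exact ⟨(x, 1), Finset.mem_univ _, Sym2.eq_swap⟩
    rw [← SimpleGraph.coe_edgeFinset, Set.ncard_coe_finset]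
    refine (Finset.card_le_card hsub).trans ((Finset.card_union_le _ _).trans (add_le_add ?_ ?_))
    · refine Finset.card_le_card_of_injOn (Sym2.map Sum.inl) (fun e he => ?_)
        (Sym2.map.injective Sum.inl_injective).injOn
      induction e with
      | _ u v =>
        obtain ⟨he, h⟩ := Finset.mem_filter.1 he
        have : S.IsFree u v := ⟨SimpleGraph.mem_edgeFinset.1 he, h⟩
        simpa using show s(Sum.inl u, Sum.inl v) ∈ S.planarization.edgeSet from this
    · refine Finset.card_image_le.trans_eq ?_
      simp [mul_comm]

/-- The discharging bound for 3-edge-connected graphs. -/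
theorem edge_bound [Nonempty V] (D : AlgDual S.planarization F) (hG : HasGirthFive G)
    (hconn : ∀ e₁ e₂, (G.deleteEdges {e₁, e₂}).Preconnected) :
    5 * G.edgeSet.ncard + 12 ≤ 12 * Fintype.card V := by
  classical
  let T : Finset F := (S.planarization.edgeFinset.filter fun e => D.L e ≠ D.R e).image D.L ∪
    (S.planarization.edgeFinset.filter fun e => D.L e ≠ D.R e).image D.R
  have hT : ∀ e ∈ S.planarization.edgeSet, D.L e ≠ D.R e → D.L e ∈ T ∧ D.R e ∈ T := by
    intro e he hne
    have : e ∈ S.planarization.edgeFinset.filter fun e => D.L e ≠ D.R e :=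
      Finset.mem_filter.2 ⟨SimpleGraph.mem_edgeFinset.2 he, hne⟩
    exact ⟨Finset.mem_union_left _ (Finset.mem_image_of_mem _ this),
      Finset.mem_union_right _ (Finset.mem_image_of_mem _ this)⟩
  have hface : ∀ f ∈ T, (D.face f).Nonempty := by
    intro f hf
    rcases Finset.mem_union.1 hf with h | h
    all_goals
      obtain ⟨e, he, rfl⟩ := Finset.mem_image.1 h
      obtain ⟨he, hne⟩ := Finset.mem_filter.1 he
      refine ⟨e, AlgDual.mem_face.2 ⟨SimpleGraph.mem_edgeFinset.1 he, hne, ?_⟩⟩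
    · exact Or.inl rfl
    · exact Or.inr rfl
  have h1 := Finset.card_nsmul_le_sum T (fun f => ∑ e ∈ D.face f, charge D f e) 48
    fun f hf => le_sum_charge hG hconn (hface f hf)
  have h2 := sum_charge_le D T hT
  have h3 := card_edgeFinset_lt_of_potential D.cut hT
  obtain ⟨a, b, hab, hsum, hb, ha⟩ := card_edges_bounds S
  rw [nsmul_eq_mul] at h1
  rw [Fintype.card_sum] at h3
  omega

end CrossingSystem

/-! ### Edge counts by induction along small edge cuts -/

lemma HasNoCycleOfLength.hasGirthFive {V : Type*} {G : SimpleGraph V}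
    (h3 : HasNoCycleOfLength G 3) (h4 : HasNoCycleOfLength G 4) : HasGirthFive G where
  no_triangle {a b c} hab hac hbc := by
    refine h3 a (.cons hab (.cons hbc (.cons hac.symm .nil))) ?_ rfl
    rw [SimpleGraph.Walk.isCycle_def]
    simp [SimpleGraph.Walk.isTrail_def, hab.ne, hac.ne, hbc.ne, hab.ne', hac.ne']
  no_square {a b c d} hne hne' hac had hbc hbd := by
    refine h4 a (.cons hac (.cons hbc.symm (.cons hbd (.cons had.symm .nil)))) ?_ rfl
    rw [SimpleGraph.Walk.isCycle_def]
    simp [SimpleGraph.Walk.isTrail_def, hne, hne', hne.symm, hac.ne, had.ne, hbd.ne, hac.ne', had.ne',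
      hbc.ne']

lemma HasGirthFive.induce {V : Type*} {G : SimpleGraph V} (h : HasGirthFive G) (s : Set V) :
    HasGirthFive (G.induce s) where
  no_triangle hab hac hbc := h.no_triangle hab hac hbc
  no_square hne hne' hac had hbc hbd := h.no_square (Subtype.coe_injective.ne hne)
    (Subtype.coe_injective.ne hne') hac had hbc hbd

lemma KPlanar.induce {V : Type*} [Finite V] {G : SimpleGraph V} {k : ℕ} (h : KPlanar G k)
    (s : Set V) : KPlanar (G.induce s) k := by
  obtain ⟨D, hD⟩ := h
  have hinj {u v x y : s} (hne : s(u, v) ≠ s(x, y)) : s((u : V), (v : V)) ≠ s((x : V), (y : V)) :=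
    (Sym2.map.injective Subtype.val_injective).ne hne
  let D' : PlaneDrawing (G.induce s) :=
    { pos := fun v => D.pos v
      pos_inj := D.pos_inj.comp Subtype.val_injective
      arc := fun _ _ h => D.arc h
      arc_symm := fun _ _ h => D.arc_symm h
      arc_inj := fun _ _ h => D.arc_inj h
      no_vertex_mem := fun _ _ h w t ht =>
        (D.no_vertex_mem h w t ht).imp Subtype.ext Subtype.ext
      finite_inter := fun _ _ _ _ h₁ h₂ hne => D.finite_inter h₁ h₂ (hinj hne)
      no_triple_point := fun _ _ _ _ _ _ h₁ h₂ h₃ h₁₂ h₁₃ h₂₃ =>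
        D.no_triple_point h₁ h₂ h₃ (hinj h₁₂) (hinj h₁₃) (hinj h₂₃) }
  refine ⟨D', fun u v h => (Set.ncard_le_ncard ?_ (D.finite_edgeCrossings h)).trans (hD h)⟩
  rintro p ⟨hp, x, y, h', hne, hp'⟩
  exact ⟨hp, x, y, h', hinj hne, hp'⟩

/-- If all edges between `s` and its complement lie in `{e₁, e₂}`, then `G` has at most two edges
outside the subgraphs induced on `s` and on its complement. -/
lemma ncard_edgeSet_le_of_edge_cut {V : Type*} [Finite V] {G : SimpleGraph V} {e₁ e₂ : Sym2 V}
    {s : Set V} (hs : ∀ u ∈ s, ∀ v ∉ s, G.Adj u v → s(u, v) = e₁ ∨ s(u, v) = e₂) :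
    G.edgeSet.ncard ≤ (G.induce s).edgeSet.ncard + (G.induce sᶜ).edgeSet.ncard + 2 := by
  have hsub : G.edgeSet ⊆ (Sym2.map (Subtype.val : s → V) '' (G.induce s).edgeSet ∪
      Sym2.map (Subtype.val : ↥sᶜ → V) '' (G.induce sᶜ).edgeSet) ∪ {e₁, e₂} := by
    intro e he
    induction e with
    | _ u v =>
      by_cases hu : u ∈ s <;> by_cases hv : v ∈ s
      · exact Or.inl (Or.inl ⟨s(⟨u, hu⟩, ⟨v, hv⟩), he, rfl⟩)
      · exact Or.inr (hs u hu v hv he)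
      · exact Or.inr (by simpa [Sym2.eq_swap] using hs v hv u hu (SimpleGraph.Adj.symm he))
      · exact Or.inl (Or.inr ⟨s(⟨u, hu⟩, ⟨v, hv⟩), he, rfl⟩)
  refine (Set.ncard_le_ncard hsub (Set.toFinite _)).trans ((Set.ncard_union_le _ _).trans
    (add_le_add ((Set.ncard_union_le _ _).trans (add_le_add ?_ ?_))
      ((Set.ncard_insert_le _ _).trans (by rw [Set.ncard_singleton]))))
  all_goals exact Set.ncard_image_le (Set.toFinite _)

theorem KPlanar.ncard_edgeSet_le {V : Type} [Fintype V] [Nonempty V] {G : SimpleGraph V}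
    (hk : KPlanar G 1) (hG : HasGirthFive G) :
    5 * G.edgeSet.ncard + 12 ≤ 12 * Fintype.card V := by
  classical
  induction hn : Fintype.card V using Nat.strong_induction_on generalizing V with
  | _ n ih =>
    subst hn
    by_cases hconn : ∀ e₁ e₂, (G.deleteEdges {e₁, e₂}).Preconnected
    · obtain ⟨D, hD⟩ := hk
      obtain ⟨X, _, S, F, L, R, heven, hcut⟩ := hD.exists_crossingSystem
      exact CrossingSystem.edge_bound ⟨L, R, heven, hcut⟩ hG hconn
    · unfold SimpleGraph.Preconnected at hconn
      push Not at hconn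
      obtain ⟨e₁, e₂, u, v, huv⟩ := hconn
      let s : Set V := {w | (G.deleteEdges {e₁, e₂}).Reachable u w}
      have hus : u ∈ s := SimpleGraph.Reachable.refl u
      have hle := ncard_edgeSet_le_of_edge_cut (G := G) (e₁ := e₁) (e₂ := e₂) (s := s)
        fun x hx y hy hxy => by
          by_contra hne
          exact hy (SimpleGraph.Reachable.trans hx
            (SimpleGraph.Adj.reachable (SimpleGraph.deleteEdges_adj.2 ⟨hxy, hne⟩)))
      have : Nonempty s := ⟨⟨u, hus⟩⟩
      have : Nonempty ↥sᶜ := ⟨⟨v, huv⟩⟩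
      have hcard : Fintype.card s + Fintype.card ↥sᶜ = Fintype.card V := by
        rw [← Nat.card_eq_fintype_card, ← Nat.card_eq_fintype_card, ← Nat.card_eq_fintype_card]
        exact Set.ncard_add_ncard_compl s
      have hpos : 0 < Fintype.card s := Fintype.card_pos
      have hpos' : 0 < Fintype.card ↥sᶜ := Fintype.card_pos
      have h₁ := ih _ (by omega) (hk.induce s) (hG.induce s) rfl
      have h₂ := ih _ (by omega) (hk.induce sᶜ) (hG.induce sᶜ) rfl
      omega

theorem stmt_7 {V : Type} [Fintype V] (G : SimpleGraph V)
    (hC3 : HasNoCycleOfLength G 3) (hC4 : HasNoCycleOfLength G 4)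
    (hG : KPlanar G 1) :
    (G.edgeSet.ncard : ℝ) ≤ (12 / 5) * Fintype.card V := by
  have h : 5 * G.edgeSet.ncard ≤ 12 * Fintype.card V := by
    cases isEmpty_or_nonempty V
    · simp [Set.eq_empty_of_isEmpty G.edgeSet]
    · have := hG.ncard_edgeSet_le (hC3.hasGirthFive hC4)
      omega
  have h' : (5 * G.edgeSet.ncard : ℝ) ≤ 12 * Fintype.card V := by exact_mod_cast h
  linarith
end

section
/- There exist a constant C ≥ 0 and a threshold N such that for every integer n ≥ N there exists a 1-planar finite simple graph of girth at least 5 on n vertices with at least (13/6)·n − C edges. -/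
open unitInterval

/-- The Gaussian integer `(1 + i) ^ k`, as a pair of integers. -/
def gaussPow : ℕ → ℤ × ℤ
  | 0 => (1, 0)
  | k + 1 => ((gaussPow k).1 - (gaussPow k).2, (gaussPow k).1 + (gaussPow k).2)

/-- Twice the signed area of the triangle on the `a`-th, `b`-th and `c`-th spiral points. -/
def spiralOrient (a b c : ℕ) : ℤ :=
  ((gaussPow b).1 - (gaussPow a).1) * ((gaussPow c).2 - (gaussPow a).2) -
    ((gaussPow b).2 - (gaussPow a).2) * ((gaussPow c).1 - (gaussPow a).1)

/-- The inner product of the `a`-th and `b`-th spiral points. -/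
def spiralDot (a b : ℕ) : ℤ :=
  (gaussPow a).1 * (gaussPow b).1 + (gaussPow a).2 * (gaussPow b).2

/-- The `k`-th spiral point, as a point of the plane. -/
def spiralPt (k : ℕ) : ℝ × ℝ := ((gaussPow k).1, (gaussPow k).2)

/-- The forward edges of the spiral graph: `a` is joined to `a + d` for `d ∈ spiralSteps a`. -/
def spiralSteps (a : ℕ) : Finset ℕ :=
  match a % 6 with
  | 0 => {1, 2, 7}
  | 1 => {7, 9}
  | 2 => {1, 7}
  | 3 => {7, 8}
  | 4 => {6, 8}
  | _ => {1, 6}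

/-- `b` is a forward neighbour of `a` in the spiral graph. -/
abbrev SpiralEdge (a b : ℕ) : Prop := b - a ∈ spiralSteps a

/-- Adjacency in the infinite spiral graph. -/
abbrev SpiralAdj (a b : ℕ) : Prop := SpiralEdge a b ∨ SpiralEdge b a

/-- Two integers have strictly opposite signs, or both vanish. -/
abbrev OppositeSigns (x y : ℤ) : Prop := x * y < 0 ∨ (x = 0 ∧ y = 0)

/-- The sign conditions satisfied by two spiral edges whose interiors meet. -/
abbrev SpiralCross (a b c d : ℕ) : Prop :=
  OppositeSigns (spiralOrient a b c) (spiralOrient a b d) ∧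
    OppositeSigns (spiralOrient c d a) (spiralOrient c d b)

/-- Subtracting a multiple of `6` brings an index below `m + 6`, keeping it at least `m` if
anything is subtracted. -/
theorem exists_eq_six_mul_add (m a : ℕ) :
    ∃ k a', a = 6 * k + a' ∧ a' < m + 6 ∧ (k = 0 ∨ m ≤ a') := by
  by_cases h : a < m
  · exact ⟨0, a, by omega, by omega, .inl rfl⟩
  · exact ⟨(a - m) / 6, a - 6 * ((a - m) / 6), by omega, by omega, by omega⟩

theorem spiralSteps_six_mul_add (k a : ℕ) : spiralSteps (6 * k + a) = spiralSteps a := by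
  simp [spiralSteps]

theorem spiralEdge_six_mul_add (k a b : ℕ) :
    SpiralEdge (6 * k + a) (6 * k + b) ↔ SpiralEdge a b := by
  unfold SpiralEdge
  rw [spiralSteps_six_mul_add, Nat.add_sub_add_left]

theorem mem_spiralSteps {a d : ℕ} (h : d ∈ spiralSteps a) :
    d ∈ ({1, 2, 6, 7, 8, 9} : Finset ℕ) := by
  have key : ∀ r < 6, spiralSteps r ⊆ {1, 2, 6, 7, 8, 9} := by decide
  have h6 := spiralSteps_six_mul_add (a / 6) (a % 6)
  rw [Nat.div_add_mod] at h6
  exact key _ (Nat.mod_lt _ (by norm_num)) (h6 ▸ h)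

theorem SpiralEdge.sub_mem {a b : ℕ} (h : SpiralEdge a b) :
    b - a ∈ ({1, 2, 6, 7, 8, 9} : Finset ℕ) := mem_spiralSteps h

theorem SpiralEdge.bounds {a b : ℕ} (h : SpiralEdge a b) : a < b ∧ b ≤ a + 9 := by
  have := h.sub_mem
  simp only [Finset.mem_insert, Finset.mem_singleton] at this
  omega

theorem SpiralAdj.bounds {a b : ℕ} (h : SpiralAdj a b) : a ≠ b ∧ a ≤ b + 9 ∧ b ≤ a + 9 := by
  rcases h with h | h <;> have := h.bounds <;> omega

/-! ### Similarity of the spiral -/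

theorem spiralOrient_add (k a b c : ℕ) :
    spiralOrient (k + a) (k + b) (k + c) = 2 ^ k * spiralOrient a b c := by
  induction k with
  | zero => simp
  | succ k ih =>
    rw [pow_succ, mul_right_comm, ← ih]
    simp only [Nat.add_right_comm k 1, spiralOrient, gaussPow]
    ring

theorem spiralDot_add (k a b : ℕ) :
    spiralDot (k + a) (k + b) = 2 ^ k * spiralDot a b := by
  induction k with
  | zero => simp
  | succ k ih =>
    rw [pow_succ, mul_right_comm, ← ih]
    simp only [Nat.add_right_comm k 1, spiralDot, gaussPow]
    ring

theorem spiralDot_self (k : ℕ) : spiralDot k k = 2 ^ k := by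
  have := spiralDot_add k 0 0
  simpa [spiralDot, gaussPow] using this

theorem oppositeSigns_mul_iff {r : ℤ} (hr : 0 < r) (x y : ℤ) :
    OppositeSigns (r * x) (r * y) ↔ OppositeSigns x y := by
  unfold OppositeSigns
  rw [mul_mul_mul_comm]
  simp [hr.ne', mul_neg_iff, hr, hr.not_gt]

theorem spiralCross_add (k a b c d : ℕ) :
    SpiralCross (k + a) (k + b) (k + c) (k + d) ↔ SpiralCross a b c d := by
  unfold SpiralCross
  simp only [spiralOrient_add, oppositeSigns_mul_iff (pow_pos (two_pos : (0 : ℤ) < 2) k)]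

/-! ### Finite verifications -/

set_option synthInstance.maxHeartbeats 400000 in
set_option synthInstance.maxSize 2000 in
theorem spiralCross_unique_of_lt : ∀ a ∈ Finset.range 18, ∀ b ∈ (spiralSteps a).image (a + ·),
    ∀ c ∈ Finset.range 28, (a ≤ c + 9 ∧ c ≤ a + 9) →
    ∀ d ∈ (spiralSteps c).image (c + ·), (a, b) ≠ (c, d) ∧ SpiralCross a b c d →
    ∀ c' ∈ Finset.range 28, (a ≤ c' + 9 ∧ c' ≤ a + 9) →
    ∀ d' ∈ (spiralSteps c').image (c' + ·), (a, b) ≠ (c', d') ∧ SpiralCross a b c' d' →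
      (c, d) = (c', d') := by
  decide +kernel

theorem spiralOrient_ne_zero_of_lt : ∀ a ∈ Finset.range 18, ∀ b ∈ (spiralSteps a).image (a + ·),
    ∀ c ∈ Finset.range 28, (a ≤ c + 9 ∧ c ≤ a + 9) →
    ∀ d ∈ (spiralSteps c).image (c + ·), (a, b) ≠ (c, d) →
      ¬ (spiralOrient a b c = 0 ∧ spiralOrient a b d = 0) := by
  decide +kernel

theorem spiralOrient_ne_zero_or_dot_neg : ∀ d ∈ ({1, 2, 6, 7, 8, 9} : Finset ℕ),
    ∀ w < d, w ≠ 0 → spiralOrient 0 d w ≠ 0 ∨ spiralDot 0 w < 0 := by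
  decide +kernel

theorem spiralDot_zero_nonneg : ∀ d ∈ ({1, 2, 6, 7, 8, 9} : Finset ℕ), 0 ≤ spiralDot 0 d := by
  decide +kernel

theorem spiral_no_triangle_of_lt : ∀ u ∈ Finset.range 18, ∀ v ∈ Finset.range 27, SpiralAdj u v → ∀ w ∈ Finset.range 27,
    SpiralAdj u w → ¬ SpiralAdj v w := by
  decide +kernel

theorem spiral_no_square_of_lt : ∀ u ∈ Finset.range 24, ∀ v ∈ Finset.range 33, SpiralAdj u v → ∀ x ∈ Finset.range 33,
    SpiralAdj u x ∧ x ≠ v → ∀ w ∈ Finset.range 42, ¬ (w ≠ u ∧ SpiralAdj v w ∧ SpiralAdj x w) := by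
  decide +kernel

/-! ### The girth of the spiral graph -/

theorem spiralAdj_six_mul_add (k a b : ℕ) :
    SpiralAdj (6 * k + a) (6 * k + b) ↔ SpiralAdj a b := by
  unfold SpiralAdj
  simp only [spiralEdge_six_mul_add]

theorem spiral_no_triangle {u v w : ℕ} (huv : SpiralAdj u v) (huw : SpiralAdj u w) :
    ¬ SpiralAdj v w := by
  have hv := huv.bounds
  have hw := huw.bounds
  obtain ⟨k, u, rfl, hu, hk⟩ := exists_eq_six_mul_add 9 u
  obtain ⟨v, rfl⟩ : ∃ v', v = 6 * k + v' := ⟨v - 6 * k, by omega⟩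
  obtain ⟨w, rfl⟩ : ∃ w', w = 6 * k + w' := ⟨w - 6 * k, by omega⟩
  rw [spiralAdj_six_mul_add] at huv huw ⊢
  exact spiral_no_triangle_of_lt u (Finset.mem_range.2 (by omega)) v (Finset.mem_range.2 (by omega)) huv
    w (Finset.mem_range.2 (by omega)) huw

theorem spiral_no_square {u v x w : ℕ} (huv : SpiralAdj u v) (hux : SpiralAdj u x) (hxv : x ≠ v)
    (hwu : w ≠ u) (hvw : SpiralAdj v w) : ¬ SpiralAdj x w := by
  have hv := huv.bounds
  have hx := hux.bounds
  have hw := hvw.bounds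
  obtain ⟨k, u, rfl, hu, hk⟩ := exists_eq_six_mul_add 18 u
  obtain ⟨v, rfl⟩ : ∃ v', v = 6 * k + v' := ⟨v - 6 * k, by omega⟩
  obtain ⟨x, rfl⟩ : ∃ x', x = 6 * k + x' := ⟨x - 6 * k, by omega⟩
  obtain ⟨w, rfl⟩ : ∃ w', w = 6 * k + w' := ⟨w - 6 * k, by omega⟩
  rw [spiralAdj_six_mul_add] at huv hux hvw ⊢
  exact fun hxw => spiral_no_square_of_lt u (Finset.mem_range.2 (by omega))
    v (Finset.mem_range.2 (by omega)) huv x (Finset.mem_range.2 (by omega)) ⟨hux, by omega⟩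
    w (Finset.mem_range.2 (by omega)) ⟨by omega, hvw, hxw⟩

/-! ### Segments between spiral points -/

/-- Signed area as an affine function of its last argument. -/
theorem spiralOrient_combo (a b c d : ℕ) {s t : ℝ} (hst : s + t = 1) :
    ((spiralPt b).1 - (spiralPt a).1) *
        ((s • spiralPt c + t • spiralPt d).2 - (spiralPt a).2) -
      ((spiralPt b).2 - (spiralPt a).2) *
        ((s • spiralPt c + t • spiralPt d).1 - (spiralPt a).1) =
      s * spiralOrient a b c + t * spiralOrient a b d := by
  obtain rfl : s = 1 - t := by linarith
  simp [spiralOrient, spiralPt]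
  ring

theorem combo_orient_eq_zero {a b c d : ℕ} {p : ℝ × ℝ}
    (hp : p ∈ segment ℝ (spiralPt a) (spiralPt b))
    {s t : ℝ} (hst : s + t = 1) (hs : s • spiralPt c + t • spiralPt d = p) :
    s * spiralOrient a b c + t * spiralOrient a b d = (0 : ℝ) := by
  obtain ⟨x, y, -, -, hxy, rfl⟩ := hp
  rw [← spiralOrient_combo a b c d hst, hs, spiralOrient_combo a b a b hxy]
  simp [spiralOrient]
  right
  ring

theorem oppositeSigns_of_mem {a b c d : ℕ} {p : ℝ × ℝ}
    (hp : p ∈ segment ℝ (spiralPt a) (spiralPt b))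
    (hq : p ∈ openSegment ℝ (spiralPt c) (spiralPt d)) :
    OppositeSigns (spiralOrient a b c) (spiralOrient a b d) := by
  obtain ⟨s, t, hs, ht, hst, h⟩ := hq
  have h0 := combo_orient_eq_zero hp hst h
  set x := spiralOrient a b c
  set y := spiralOrient a b d
  by_cases hx : x = 0
  · right
    refine ⟨hx, ?_⟩
    simpa [hx, ht.ne'] using h0
  · left
    have hx' : (0 : ℝ) < (x : ℝ) ^ 2 := by positivity
    have : t * ((x : ℝ) * y) < 0 := by
      rw [show t * ((x : ℝ) * y) = -(s * (x : ℝ) ^ 2) by linear_combination (x : ℝ) * h0]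
      exact neg_neg_of_pos (mul_pos hs hx')
    exact_mod_cast (pos_iff_neg_of_mul_neg this).1 ht

theorem spiralCross_of_mem {a b c d : ℕ} {p : ℝ × ℝ}
    (hp : p ∈ openSegment ℝ (spiralPt a) (spiralPt b))
    (hq : p ∈ openSegment ℝ (spiralPt c) (spiralPt d)) : SpiralCross a b c d :=
  ⟨oppositeSigns_of_mem (openSegment_subset_segment _ _ _ hp) hq,
    oppositeSigns_of_mem (openSegment_subset_segment _ _ _ hq) hp⟩

theorem segment_inter_subsingleton {a b c d : ℕ}
    (h : ¬ (spiralOrient a b c = 0 ∧ spiralOrient a b d = 0)) :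
    (segment ℝ (spiralPt a) (spiralPt b) ∩ segment ℝ (spiralPt c) (spiralPt d)).Subsingleton := by
  rintro p ⟨hp, s, t, -, -, hst, hs⟩ q ⟨hq, s', t', -, -, hst', hs'⟩
  have h1 := combo_orient_eq_zero hp hst hs
  have h2 := combo_orient_eq_zero hq hst' hs'
  obtain rfl : s = 1 - t := by linarith
  obtain rfl : s' = 1 - t' := by linarith
  by_cases htt : t = t'
  · subst htt
    exact hs.symm.trans hs'
  · refine absurd ?_ h
    set x := spiralOrient a b c
    set y := spiralOrient a b d
    have h3 : (t - t') * ((y : ℝ) - x) = 0 := by linear_combination h1 - h2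
    have h4 : (y : ℝ) = x := by
      rcases mul_eq_zero.1 h3 with h3 | h3
      · exact absurd (sub_eq_zero.1 h3) htt
      · exact sub_eq_zero.1 h3
    have h5 : (x : ℝ) = 0 := by rw [h4] at h1; linear_combination h1
    exact ⟨by exact_mod_cast h5, by exact_mod_cast h4.trans h5⟩

/-- The squared Euclidean norm. -/
def sqNorm (p : ℝ × ℝ) : ℝ := p.1 ^ 2 + p.2 ^ 2

theorem sqNorm_combo (a b : ℕ) (s t : ℝ) :
    sqNorm (s • spiralPt a + t • spiralPt b) =
      s ^ 2 * 2 ^ a + 2 * s * t * spiralDot a b + t ^ 2 * 2 ^ b := by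
  have ha : (spiralDot a a : ℝ) = 2 ^ a := by exact_mod_cast spiralDot_self a
  have hb : (spiralDot b b : ℝ) = 2 ^ b := by exact_mod_cast spiralDot_self b
  rw [← ha, ← hb]
  simp [sqNorm, spiralDot, spiralPt]
  ring

theorem sqNorm_spiralPt (k : ℕ) : sqNorm (spiralPt k) = 2 ^ k := by
  simpa using sqNorm_combo k k 1 0

theorem spiralPt_injective : Function.Injective spiralPt := by
  intro a b h
  have h2 : (2 : ℝ) ^ a = 2 ^ b := by rw [← sqNorm_spiralPt, h, sqNorm_spiralPt]
  exact pow_right_injective₀ two_pos (by norm_num) h2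

theorem SpiralEdge.dot_nonneg {a b : ℕ} (h : SpiralEdge a b) : 0 ≤ spiralDot a b := by
  have h0 := spiralDot_zero_nonneg _ h.sub_mem
  have h1 := spiralDot_add a 0 (b - a)
  rw [add_zero, Nat.add_sub_cancel' h.bounds.1.le] at h1
  rw [h1]
  positivity

theorem SpiralEdge.sqNorm_le {a b : ℕ} (h : SpiralEdge a b) {p : ℝ × ℝ}
    (hp : p ∈ segment ℝ (spiralPt a) (spiralPt b)) : sqNorm p ≤ 2 ^ b := by
  obtain ⟨s, t, hs, ht, hst, rfl⟩ := hp
  have hab : (2 : ℝ) ^ a ≤ 2 ^ b := pow_le_pow_right₀ one_le_two h.bounds.1.le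
  have hdot : 2 * (spiralDot a b : ℝ) ≤ 2 ^ a + 2 ^ b := by
    have := sqNorm_combo a b 1 (-1)
    have h0 : 0 ≤ sqNorm ((1 : ℝ) • spiralPt a + (-1 : ℝ) • spiralPt b) := by
      unfold sqNorm; positivity
    linarith
  rw [sqNorm_combo]
  obtain rfl : s = 1 - t := by linarith
  have h1 := mul_le_mul_of_nonneg_left hdot (mul_nonneg hs ht)
  have h2 := mul_le_mul_of_nonneg_left hab hs
  nlinarith

theorem SpiralEdge.lt_sqNorm {a b : ℕ} (h : SpiralEdge a b) {p : ℝ × ℝ}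
    (hp : p ∈ segment ℝ (spiralPt a) (spiralPt b)) : (2 : ℝ) ^ a < 2 * sqNorm p := by
  obtain ⟨s, t, hs, ht, hst, rfl⟩ := hp
  have hab : (2 : ℝ) * 2 ^ a ≤ 2 ^ b := by
    rw [← pow_succ']
    exact pow_le_pow_right₀ one_le_two h.bounds.1
  have hdot : (0 : ℝ) ≤ spiralDot a b := by exact_mod_cast h.dot_nonneg
  have hpos : (0 : ℝ) < 2 ^ a := by positivity
  rw [sqNorm_combo]
  obtain rfl : s = 1 - t := by linarith
  have h1 := mul_nonneg (mul_nonneg hs ht) hdot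
  have h2 := mul_le_mul_of_nonneg_left hab (sq_nonneg t)
  have h3 : 0 < (2 * (1 - t) ^ 2 + 4 * t ^ 2 - 1) * (2 : ℝ) ^ a :=
    mul_pos (by nlinarith [sq_nonneg (3 * t - 1)]) hpos
  nlinarith

theorem SpiralEdge.le_of_meet {a b c d : ℕ} (hab : SpiralEdge a b) (hcd : SpiralEdge c d)
    {p : ℝ × ℝ} (hp : p ∈ segment ℝ (spiralPt a) (spiralPt b))
    (hq : p ∈ segment ℝ (spiralPt c) (spiralPt d)) : c ≤ a + 9 := by
  have h1 := hab.sqNorm_le hp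
  have h2 := hcd.lt_sqNorm hq
  have h3 : (2 : ℝ) ^ c < 2 ^ (b + 1) := by rw [pow_succ]; linarith
  have := (pow_lt_pow_iff_right₀ (one_lt_two (α := ℝ))).1 h3
  have := hab.bounds
  omega

theorem SpiralEdge.eq_or_eq_of_mem {a b w : ℕ} (h : SpiralEdge a b)
    (hw : spiralPt w ∈ segment ℝ (spiralPt a) (spiralPt b)) : w = a ∨ w = b := by
  have hb := h.bounds
  have h1 := h.sqNorm_le hw
  have h2 := h.lt_sqNorm hw
  rw [sqNorm_spiralPt] at h1 h2
  rw [← pow_succ'] at h2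
  have h1 := (pow_le_pow_iff_right₀ (one_lt_two (α := ℝ))).1 h1
  have h2 := (pow_lt_pow_iff_right₀ (one_lt_two (α := ℝ))).1 h2
  by_contra! hne
  have hor : spiralOrient a b w = 0 := by
    have := combo_orient_eq_zero (c := w) (d := w) hw (add_zero 1) (by simp)
    simpa using this
  have hdot : 0 ≤ spiralDot a w := by
    obtain ⟨s, t, hs, ht, hst, e⟩ := hw
    have e1 := congrArg Prod.fst e
    have e2 := congrArg Prod.snd e
    have key : (spiralDot a w : ℝ) = s * spiralDot a a + t * spiralDot a b := by
      simp only [spiralPt, Prod.fst_add, Prod.snd_add, Prod.smul_fst, Prod.smul_snd,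
        smul_eq_mul] at e1 e2
      simp only [spiralDot]
      push_cast
      rw [← e1, ← e2]
      ring
    have hd : (0 : ℝ) ≤ spiralDot a b := by exact_mod_cast h.dot_nonneg
    rw [spiralDot_self] at key
    have : (0 : ℝ) ≤ spiralDot a w := by
      rw [key]
      push_cast
      positivity
    exact_mod_cast this
  obtain ⟨d, rfl⟩ := Nat.exists_eq_add_of_lt hb.1
  obtain ⟨w, rfl⟩ : ∃ w', w = a + w' := ⟨w - a, by omega⟩
  have hd := h.sub_mem
  rw [add_assoc, Nat.add_sub_cancel_left] at hd
  have ho := spiralOrient_add a 0 (d + 1) w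
  have hn := spiralDot_add a 0 w
  have hpos : (0 : ℤ) < 2 ^ a := by positivity
  rcases spiralOrient_ne_zero_or_dot_neg _ hd w (by omega) (by omega) with h3 | h3
  · rw [add_zero, ← add_assoc, hor] at ho
    exact mul_ne_zero hpos.ne' h3 ho.symm
  · rw [add_zero] at hn
    exact absurd (mul_neg_of_pos_of_neg hpos h3) (by omega)

theorem SpiralEdge.mem_image {a b : ℕ} (h : SpiralEdge a b) :
    b ∈ (spiralSteps a).image (a + ·) :=
  Finset.mem_image.2 ⟨b - a, h, Nat.add_sub_cancel' h.bounds.1.le⟩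

theorem SpiralEdge.crossing_unique {a b c d c' d' : ℕ} (hab : SpiralEdge a b)
    (hcd : SpiralEdge c d) (hcd' : SpiralEdge c' d') (hne : (a, b) ≠ (c, d))
    (hne' : (a, b) ≠ (c', d')) {p q : ℝ × ℝ}
    (hp : p ∈ openSegment ℝ (spiralPt a) (spiralPt b))
    (hp' : p ∈ openSegment ℝ (spiralPt c) (spiralPt d))
    (hq : q ∈ openSegment ℝ (spiralPt a) (spiralPt b))
    (hq' : q ∈ openSegment ℝ (spiralPt c') (spiralPt d')) : (c, d) = (c', d') := by
  have sub (i j : ℕ) := openSegment_subset_segment ℝ (spiralPt i) (spiralPt j)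
  have h1 := hab.le_of_meet hcd (sub _ _ hp) (sub _ _ hp')
  have h2 := hcd.le_of_meet hab (sub _ _ hp') (sub _ _ hp)
  have h3 := hab.le_of_meet hcd' (sub _ _ hq) (sub _ _ hq')
  have h4 := hcd'.le_of_meet hab (sub _ _ hq') (sub _ _ hq)
  have hX := spiralCross_of_mem hp hp'
  have hX' := spiralCross_of_mem hq hq'
  have hb := hab.bounds
  have hd := hcd.bounds
  have hd' := hcd'.bounds
  obtain ⟨k, a, rfl, ha, hk⟩ := exists_eq_six_mul_add 9 a
  obtain ⟨b, rfl⟩ : ∃ b', b = 6 * k + b' := ⟨b - 6 * k, by omega⟩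
  obtain ⟨c, rfl⟩ : ∃ c', c = 6 * k + c' := ⟨c - 6 * k, by omega⟩
  obtain ⟨d, rfl⟩ : ∃ d', d = 6 * k + d' := ⟨d - 6 * k, by omega⟩
  obtain ⟨c', rfl⟩ : ∃ c'', c' = 6 * k + c'' := ⟨c' - 6 * k, by omega⟩
  obtain ⟨d', rfl⟩ : ∃ d'', d' = 6 * k + d'' := ⟨d' - 6 * k, by omega⟩
  rw [spiralEdge_six_mul_add] at hab hcd hcd'
  rw [spiralCross_add] at hX hX'
  have := spiralCross_unique_of_lt a (Finset.mem_range.2 (by omega)) b hab.mem_image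
    c (Finset.mem_range.2 (by omega)) (by omega) d hcd.mem_image ⟨by simpa using hne, hX⟩
    c' (Finset.mem_range.2 (by omega)) (by omega) d' hcd'.mem_image ⟨by simpa using hne', hX'⟩
  simpa using this

theorem SpiralEdge.inter_subsingleton {a b c d : ℕ} (hab : SpiralEdge a b)
    (hcd : SpiralEdge c d) (hne : (a, b) ≠ (c, d)) :
    (segment ℝ (spiralPt a) (spiralPt b) ∩
      segment ℝ (spiralPt c) (spiralPt d)).Subsingleton := by
  intro p hp q hq
  have h1 := hab.le_of_meet hcd hp.1 hp.2
  have h2 := hcd.le_of_meet hab hp.2 hp.1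
  refine segment_inter_subsingleton ?_ hp hq
  have hb := hab.bounds
  have hd := hcd.bounds
  obtain ⟨k, a, rfl, ha, hk⟩ := exists_eq_six_mul_add 9 a
  obtain ⟨b, rfl⟩ : ∃ b', b = 6 * k + b' := ⟨b - 6 * k, by omega⟩
  obtain ⟨c, rfl⟩ : ∃ c', c = 6 * k + c' := ⟨c - 6 * k, by omega⟩
  obtain ⟨d, rfl⟩ : ∃ d', d = 6 * k + d' := ⟨d - 6 * k, by omega⟩
  rw [spiralEdge_six_mul_add] at hab hcd
  simp only [spiralOrient_add, mul_eq_zero, pow_eq_zero_iff', OfNat.ofNat_ne_zero, false_and,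
    false_or]
  exact spiralOrient_ne_zero_of_lt a (Finset.mem_range.2 (by omega)) b hab.mem_image
    c (Finset.mem_range.2 (by omega)) (by omega) d hcd.mem_image (by simpa using hne)

/-! ### The finite spiral graphs and their drawings -/

/-- The spiral graph on the first `n` spiral points. -/
def spiralGraph (n : ℕ) : SimpleGraph (Fin n) where
  Adj u v := SpiralAdj u v
  symm := ⟨fun _ _ h => Or.symm h⟩
  loopless := ⟨fun _ h => h.bounds.1 rfl⟩

theorem SpiralAdj.exists_edge {u v : ℕ} (h : SpiralAdj u v) :
    ∃ a b, SpiralEdge a b ∧ s(u, v) = s(a, b) ∧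
      segment ℝ (spiralPt u) (spiralPt v) = segment ℝ (spiralPt a) (spiralPt b) ∧
      openSegment ℝ (spiralPt u) (spiralPt v) = openSegment ℝ (spiralPt a) (spiralPt b) := by
  rcases h with h | h
  · exact ⟨u, v, h, rfl, rfl, rfl⟩
  · exact ⟨v, u, h, Sym2.eq_swap, segment_symm _ _ _, openSegment_symm _ _ _⟩

theorem pair_ne_of_sym2_ne {n : ℕ} {u v x y : Fin n} {a b c d : ℕ}
    (h : s(u, v) ≠ s(x, y)) (h₁ : s(u.val, v.val) = s(a, b)) (h₂ : s(x.val, y.val) = s(c, d)) :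
    (a, b) ≠ (c, d) := by
  intro e
  obtain ⟨rfl, rfl⟩ := Prod.mk.inj e
  exact h (Sym2.map.injective Fin.val_injective (h₁.trans h₂.symm))

theorem segment_path_mem_openSegment {E : Type*} [AddCommGroup E] [Module ℝ E]
    [TopologicalSpace E] [ContinuousAdd E] [ContinuousSMul ℝ E] (a b : E) {t : I}
    (h0 : t ≠ 0) (h1 : t ≠ 1) : Path.segment a b t ∈ openSegment ℝ a b := by
  rw [openSegment_eq_image_lineMap, Path.segment_apply]
  exact Set.mem_image_of_mem _ ⟨unitInterval.pos_iff_ne_zero.2 h0,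
    unitInterval.lt_one_iff_ne_one.2 h1⟩

/-- The straight-line drawing of the spiral graph. -/
noncomputable def spiralDrawing (n : ℕ) : PlaneDrawing (spiralGraph n) where
  pos u := spiralPt u
  pos_inj := spiralPt_injective.comp Fin.val_injective
  arc u v _ := Path.segment (spiralPt u) (spiralPt v)
  arc_symm u v _ := (Path.segment_symm _ _).symm
  arc_inj u v h := Path.segment_injective_of_ne fun e => h.bounds.1 (spiralPt_injective e)
  no_vertex_mem u v h w t e := by
    obtain ⟨a, b, hab, hs, hseg, -⟩ := SpiralAdj.exists_edge h
    have hw : spiralPt w ∈ segment ℝ (spiralPt u) (spiralPt v) := by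
      rw [← e, ← Path.range_segment]
      exact Set.mem_range_self t
    rw [hseg] at hw
    have hmem : w.val ∈ s(a, b) := Sym2.mem_iff.2 (hab.eq_or_eq_of_mem hw)
    rw [← hs, Sym2.mem_iff] at hmem
    exact hmem.imp Fin.ext Fin.ext
  finite_inter u v x y h₁ h₂ hne := by
    obtain ⟨a, b, hab, hs, hseg, -⟩ := SpiralAdj.exists_edge h₁
    obtain ⟨c, d, hcd, hs', hseg', -⟩ := SpiralAdj.exists_edge h₂
    rw [Path.range_segment, Path.range_segment, hseg, hseg']
    exact (hab.inter_subsingleton hcd (pair_ne_of_sym2_ne hne hs hs')).finite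
  no_triple_point u₁ v₁ u₂ v₂ u₃ v₃ h₁ h₂ h₃ h₁₂ h₁₃ h₂₃ t₁ t₂ t₃ p₁ q₁ p₂ q₂ p₃ q₃ e₁ e₂ := by
    obtain ⟨a, b, hab, hs, -, hseg⟩ := SpiralAdj.exists_edge h₁
    obtain ⟨c, d, hcd, hs', -, hseg'⟩ := SpiralAdj.exists_edge h₂
    obtain ⟨c', d', hcd', hs'', -, hseg''⟩ := SpiralAdj.exists_edge h₃
    have m₁ := segment_path_mem_openSegment (spiralPt u₁) (spiralPt v₁) p₁ q₁
    have m₂ := segment_path_mem_openSegment (spiralPt u₂) (spiralPt v₂) p₂ q₂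
    have m₃ := segment_path_mem_openSegment (spiralPt u₃) (spiralPt v₃) p₃ q₃
    rw [hseg] at m₁
    rw [hseg', ← e₁] at m₂
    rw [hseg'', ← e₂, ← e₁] at m₃
    exact pair_ne_of_sym2_ne h₂₃ hs' hs'' (hab.crossing_unique hcd hcd'
      (pair_ne_of_sym2_ne h₁₂ hs hs') (pair_ne_of_sym2_ne h₁₃ hs hs'') m₁ m₂ m₁ m₃)

theorem spiralDrawing_isKPlane (n : ℕ) : (spiralDrawing n).IsKPlane 1 := by
  intro u v h
  have mem {x y : Fin n} {h' : (spiralGraph n).Adj x y} {p : ℝ × ℝ}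
      (hp : (spiralDrawing n).IsInteriorPoint h' p) :
      p ∈ openSegment ℝ (spiralPt x) (spiralPt y) := by
    obtain ⟨t, h0, h1, rfl⟩ := hp
    exact segment_path_mem_openSegment _ _ h0 h1
  obtain ⟨a, b, hab, hs, -, hseg⟩ := SpiralAdj.exists_edge h
  have hsub : ((spiralDrawing n).edgeCrossings h).Subsingleton := by
    rintro p ⟨hp, x, y, h₂, hne, hp'⟩ q ⟨hq, x', y', h₃, hne', hq'⟩
    obtain ⟨c, d, hcd, hs', -, hseg'⟩ := SpiralAdj.exists_edge h₂
    obtain ⟨c', d', hcd', hs'', -, hseg''⟩ := SpiralAdj.exists_edge h₃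
    have mp := mem hp
    have mp' := mem hp'
    have mq := mem hq
    have mq' := mem hq'
    rw [hseg] at mp mq
    rw [hseg'] at mp'
    rw [hseg''] at mq'
    have hcd_ne := pair_ne_of_sym2_ne hne hs hs'
    obtain ⟨rfl, rfl⟩ := Prod.mk.inj (hab.crossing_unique hcd hcd' hcd_ne
      (pair_ne_of_sym2_ne hne' hs hs'') mp mp' mq mq')
    have sub (i j : ℕ) := openSegment_subset_segment ℝ (spiralPt i) (spiralPt j)
    exact hab.inter_subsingleton hcd hcd_ne ⟨sub _ _ mp, sub _ _ mp'⟩ ⟨sub _ _ mq, sub _ _ mq'⟩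
  rcases hsub.eq_empty_or_singleton with h | ⟨p, h⟩ <;> simp [h]

theorem spiralGraph_no_three_cycle (n : ℕ) : HasNoCycleOfLength (spiralGraph n) 3 := by
  intro v c _ hl
  match c, hl with
  | .cons h₁ (.cons h₂ (.cons h₃ .nil)), _ => exact spiral_no_triangle h₁ h₃.symm h₂

theorem spiralGraph_no_four_cycle (n : ℕ) : HasNoCycleOfLength (spiralGraph n) 4 := by
  intro v c hc hl
  match c, hc, hl with
  | .cons h₁ (.cons h₂ (.cons h₃ (.cons h₄ .nil))), hc, _ =>
    have hnd := hc.support_nodup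
    simp only [SimpleGraph.Walk.support_cons, SimpleGraph.Walk.support_nil, List.tail_cons,
      List.nodup_cons, List.mem_cons, List.not_mem_nil, or_false, not_or] at hnd
    exact spiral_no_square h₁ h₄.symm (fun e => hnd.1.2.1 (Fin.ext e.symm))
      (fun e => hnd.2.1.2 (Fin.ext e)) h₂ h₃.symm

theorem sum_card_spiralSteps (q : ℕ) :
    ∑ a ∈ Finset.range (6 * q), (spiralSteps a).card = 13 * q := by
  induction q with
  | zero => simp
  | succ q ih =>
    rw [mul_add_one, Finset.sum_range_add, ih]
    simp only [spiralSteps_six_mul_add]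
    have : ∑ a ∈ Finset.range 6, (spiralSteps a).card = 13 := by decide
    omega

theorem le_ncard_edgeSet_spiralGraph {n q : ℕ} (h : 6 * q + 9 ≤ n) :
    13 * q ≤ (spiralGraph n).edgeSet.ncard := by
  let T : Finset (Sym2 ℕ) :=
    ((Finset.range (6 * q)).sigma spiralSteps).image fun x => s(x.1, x.1 + x.2)
  have hT : T.card = 13 * q := by
    rw [Finset.card_image_of_injOn, Finset.card_sigma, sum_card_spiralSteps]
    rintro ⟨a, d⟩ - ⟨a', d'⟩ - e
    simp only [Sym2.eq_iff] at e
    obtain ⟨rfl, rfl⟩ : a = a' ∧ d = d' := by omega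
    rfl
  have hsub : (T : Set (Sym2 ℕ)) ⊆ Sym2.map Fin.val '' (spiralGraph n).edgeSet := by
    intro e he
    obtain ⟨⟨a, d⟩, hx, rfl⟩ := Finset.mem_image.1 (Finset.mem_coe.1 he)
    obtain ⟨ha, hd⟩ := Finset.mem_sigma.1 hx
    have ha := Finset.mem_range.1 ha
    have hedge : SpiralEdge a (a + d) := by simpa [SpiralEdge] using hd
    have hb := hedge.bounds
    simp only at ha hb
    refine ⟨s(⟨a, by omega⟩, ⟨a + d, by omega⟩), ?_, rfl⟩
    exact Or.inl hedge
  calc 13 * q = (T : Set (Sym2 ℕ)).ncard := by rw [Set.ncard_coe_finset, hT]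
    _ ≤ (Sym2.map Fin.val '' (spiralGraph n).edgeSet).ncard := Set.ncard_le_ncard hsub
    _ ≤ _ := Set.ncard_image_le

theorem stmt_8 :
    ∃ (C : ℝ) (N : ℕ), 0 ≤ C ∧ ∀ n : ℕ, N ≤ n →
      ∃ G : SimpleGraph (Fin n), HasNoCycleOfLength G 3 ∧
        HasNoCycleOfLength G 4 ∧ KPlanar G 1 ∧
        (13 / 6 : ℝ) * n - C ≤ G.edgeSet.ncard := by
  refine ⟨31, 9, by norm_num, fun n hn => ⟨spiralGraph n, spiralGraph_no_three_cycle n,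
    spiralGraph_no_four_cycle n, ⟨spiralDrawing n, spiralDrawing_isKPlane n⟩, ?_⟩⟩
  have h := le_ncard_edgeSet_spiralGraph (n := n) (q := (n - 9) / 6) (by omega)
  have hq : n ≤ 6 * ((n - 9) / 6) + 14 := by omega
  have h' : (13 : ℝ) * ((n - 9) / 6 : ℕ) ≤ (spiralGraph n).edgeSet.ncard := by exact_mod_cast h
  have hq' : (n : ℝ) ≤ 6 * ((n - 9) / 6 : ℕ) + 14 := by exact_mod_cast hq
  linarith
end

section
/- There exist a constant C ≥ 0 and a threshold N such that for every integer n ≥ N there exists a C₄-free 2-planar finite simple graph on n vertices with at least (5/2)·n − C edges. -/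
open unitInterval

/-! ### The annular graph

The vertices `16 * k + j` and `16 * k + 8 + j` for `j < 8` form an inner and an outer octagonal
ring of the `k`-th layer, and consecutive layers differ by scaling by `4`.  The inner ring is a
cycle, it is joined to the outer ring by a zigzag, and the outer ring is joined to the next layer
by two matchings that cross each other. -/

namespace AnnularGraph

/-- The sixteen points of the innermost layer. -/
def basePoint (i : ℕ) : ℤ × ℤ :=
  [(10, 0), (7, 7), (0, 10), (-7, 7), (-10, 0), (-7, -7), (0, -10), (7, -7),
   (12, 5), (5, 12), (-5, 12), (-12, 5), (-12, -5), (-5, -12), (5, -12), (12, -5)].getD i (0, 0)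

/-- The position of the vertex `t`. -/
def point (t : ℕ) : ℤ × ℤ :=
  (((4 ^ (t / 16) : ℕ) : ℤ) * (basePoint (t % 16)).1,
    ((4 ^ (t / 16) : ℕ) : ℤ) * (basePoint (t % 16)).2)

/-- The endpoints of the forty edges starting in the innermost layer. -/
def ends (e : Fin 40) : ℕ × ℕ :=
  [(0, 1), (1, 2), (2, 3), (3, 4), (4, 5), (5, 6), (6, 7), (0, 7),
   (0, 8), (1, 9), (2, 10), (3, 11), (4, 12), (5, 13), (6, 14), (7, 15),
   (1, 8), (2, 9), (3, 10), (4, 11), (5, 12), (6, 13), (7, 14), (0, 15),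
   (8, 23), (9, 16), (10, 17), (11, 18), (12, 19), (13, 20), (14, 21), (15, 22),
   (8, 18), (9, 19), (10, 20), (11, 21), (12, 22), (13, 23), (14, 16), (15, 17)].getD e (0, 1)

/-- The lower endpoint of the `e`-th edge of layer `k`. -/
def lo (k : ℕ) (e : Fin 40) : ℕ := 16 * k + (ends e).1

/-- The upper endpoint of the `e`-th edge of layer `k`. -/
def hi (k : ℕ) (e : Fin 40) : ℕ := 16 * k + (ends e).2

/-- `u` and `v` are the endpoints of the `e`-th edge of layer `k`. -/
def IsEdge (u v k : ℕ) (e : Fin 40) : Prop :=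
  u = lo k e ∧ v = hi k e ∨ u = hi k e ∧ v = lo k e

lemma ends_bounds : ∀ e : Fin 40,
    (ends e).1 < 16 ∧ (ends e).1 < (ends e).2 ∧ (ends e).2 < 32 := by
  decide +kernel

lemma ends_injective : Function.Injective ends := by
  have : ∀ e f : Fin 40, ends e = ends f → e = f := by decide +kernel
  exact fun e f => this e f

lemma exists_ends_fst : ∀ i : Fin 16, ∃ e : Fin 40, (ends e).1 = i := by
  decide +kernel

lemma lo_lt_hi (k : ℕ) (e : Fin 40) : lo k e < hi k e := by
  have := ends_bounds e
  simp only [lo, hi]; omega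

lemma IsEdge.symm {u v k : ℕ} {e : Fin 40} (h : IsEdge u v k e) : IsEdge v u k e := by
  unfold IsEdge at *; tauto

lemma IsEdge.sym2_eq {u v k : ℕ} {e : Fin 40} (h : IsEdge u v k e) :
    s(u, v) = s(lo k e, hi k e) := by
  rcases h with ⟨rfl, rfl⟩ | ⟨rfl, rfl⟩
  · rfl
  · exact Sym2.eq_swap

/-- The infinite annular graph. -/
def graph : SimpleGraph ℕ where
  Adj u v := ∃ k e, IsEdge u v k e
  symm := ⟨fun _ _ ⟨k, e, h⟩ => ⟨k, e, h.symm⟩⟩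
  loopless := ⟨fun u ⟨k, e, h⟩ => by
    have := lo_lt_hi k e
    rcases h with ⟨h₁, h₂⟩ | ⟨h₁, h₂⟩ <;> omega⟩

/-! ### Cycles of length four -/

/-- The offsets from a vertex of residue `i` modulo `16` to its neighbours. -/
def offsets (i : ℤ) : List ℤ :=
  (List.finRange 40).flatMap fun e =>
    (if ((ends e).1 : ℤ) % 16 = i then [((ends e).2 : ℤ) - (ends e).1] else []) ++
    (if ((ends e).2 : ℤ) % 16 = i then [((ends e).1 : ℤ) - (ends e).2] else [])

lemma sub_mem_offsets {u v : ℕ} (h : graph.Adj u v) :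
    (v : ℤ) - u ∈ offsets ((u : ℤ) % 16) := by
  obtain ⟨k, e, h⟩ := h
  refine List.mem_flatMap.2 ⟨e, List.mem_finRange e, List.mem_append.2 ?_⟩
  rcases h with ⟨rfl, rfl⟩ | ⟨rfl, rfl⟩
  · left
    rw [if_pos (by simp only [lo]; push_cast; omega)]
    simp [lo, hi]
  · right
    rw [if_pos (by simp only [hi]; push_cast; omega)]
    simp [lo, hi]

lemma offsets_rhombus : ∀ i : Fin 16,
    ∀ x ∈ offsets (i : ℕ), ∀ y ∈ offsets (i : ℕ), x = y ∨
      ∀ x' ∈ offsets ((((i : ℕ) : ℤ) + x) % 16), ∀ y' ∈ offsets ((((i : ℕ) : ℤ) + y) % 16),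
        x + x' = y + y' → x + x' = 0 := by
  decide +kernel

lemma eq_or_eq_of_adj {a b c d : ℕ} (hab : graph.Adj a b) (hbc : graph.Adj b c)
    (hcd : graph.Adj c d) (hda : graph.Adj d a) : b = d ∨ a = c := by
  have key := offsets_rhombus ⟨a % 16, Nat.mod_lt _ (by norm_num)⟩
  have hx := sub_mem_offsets hab
  have hy := sub_mem_offsets hda.symm
  have hx' := sub_mem_offsets hbc
  have hy' := sub_mem_offsets hcd.symm
  simp only [Nat.cast_ofNat, Int.natCast_mod] at key
  rcases key _ hx _ hy with h | h
  · left; omega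
  · right
    have hb : ((a : ℤ) % 16 + ((b : ℤ) - a)) % 16 = (b : ℤ) % 16 := by omega
    have hd : ((a : ℤ) % 16 + ((d : ℤ) - a)) % 16 = (d : ℤ) % 16 := by omega
    rw [hb, hd] at h
    have := h _ hx' _ hy' (by ring)
    omega

lemma hasNoCycleOfLength_four {V : Type*} (f : V → ℕ) (hf : Function.Injective f) :
    HasNoCycleOfLength (graph.comap f) 4 := by
  intro v c hc hlen
  match c, hc, hlen with
  | .cons (v := b) h₁ (.cons (v := c) h₂ (.cons (v := d) h₃ (.cons h₄ .nil))), hc, _ =>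
    have hnd := hc.support_nodup
    simp only [SimpleGraph.Walk.support_cons, SimpleGraph.Walk.support_nil, List.tail_cons,
      List.nodup_cons, List.mem_cons] at hnd
    rcases eq_or_eq_of_adj h₁ h₂ h₃ h₄ with h | h
    · have := hf h; tauto
    · have := hf h; subst this; tauto

/-! ### Segments in the plane -/

/-- Twice the signed area of the triangle `abc`. -/
def orient {R : Type*} [CommRing R] (a b c : R × R) : R :=
  (b.1 - a.1) * (c.2 - a.2) - (b.2 - a.2) * (c.1 - a.1)

/-- One of the segments `ab` and `cd` lies strictly on one side of the line through the other. -/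
abbrev Apart (a b c d : ℤ × ℤ) : Prop :=
  0 < orient a b c * orient a b d ∨ 0 < orient c d a * orient c d b

/-- The segments `ab` and `cd` cross properly. -/
abbrev Crossing (a b c d : ℤ × ℤ) : Prop :=
  orient a b c * orient a b d < 0 ∧ orient c d a * orient c d b < 0

/-- The point of the real plane with the given integer coordinates. -/
def toReal (a : ℤ × ℤ) : ℝ × ℝ := (a.1, a.2)

lemma orient_toReal (a b c : ℤ × ℤ) :
    orient (toReal a) (toReal b) (toReal c) = ((orient a b c : ℤ) : ℝ) := by
  simp [orient, toReal]

lemma toReal_injective : Function.Injective toReal := by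
  rintro ⟨a, b⟩ ⟨c, d⟩ h
  simpa [toReal] using h

lemma orient_add_sub_orient (a b c d : ℤ × ℤ) :
    orient c d a - orient c d b = orient a b d - orient a b c := by
  simp only [orient]; ring

/-- A point of the segment `cd` on the line `ab` is determined by a relation between the
orientations of `abc` and `abd`. -/
lemma exists_combination {a b c d p : ℝ × ℝ} (h₁ : p ∈ segment ℝ a b) (h₂ : p ∈ segment ℝ c d) :
    ∃ t : ℝ, 0 ≤ t ∧ t ≤ 1 ∧ p = (c.1 + t * (d.1 - c.1), c.2 + t * (d.2 - c.2)) ∧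
      (1 - t) * orient a b c + t * orient a b d = 0 := by
  rw [segment_eq_image'] at h₁ h₂
  obtain ⟨s, -, rfl⟩ := h₁
  obtain ⟨t, ⟨ht₀, ht₁⟩, ht⟩ := h₂
  have e₁ := congrArg Prod.fst ht
  have e₂ := congrArg Prod.snd ht
  simp only [Prod.fst_add, Prod.snd_add, Prod.smul_fst, Prod.smul_snd, Prod.fst_sub,
    Prod.snd_sub, smul_eq_mul] at e₁ e₂
  refine ⟨t, ht₀, ht₁, ?_, ?_⟩
  · ext <;> simp [e₁, e₂]
  · simp only [orient]
    linear_combination (b.1 - a.1) * e₂ - (b.2 - a.2) * e₁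

lemma orient_mul_orient_nonpos {a b c d p : ℝ × ℝ} (h₁ : p ∈ segment ℝ a b)
    (h₂ : p ∈ segment ℝ c d) : orient a b c * orient a b d ≤ 0 := by
  obtain ⟨t, ht₀, ht₁, -, h⟩ := exists_combination h₁ h₂
  by_contra! hpos
  rcases pos_and_pos_or_neg_and_neg_of_mul_pos hpos with ⟨hc, hd⟩ | ⟨hc, hd⟩ <;>
    rcases ht₀.eq_or_lt with rfl | ht₀ <;> nlinarith

lemma Apart.notMem {a b c d : ℤ × ℤ} (h : Apart a b c d) {p : ℝ × ℝ}
    (h₁ : p ∈ segment ℝ (toReal a) (toReal b)) (h₂ : p ∈ segment ℝ (toReal c) (toReal d)) :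
    False := by
  have e₁ := orient_mul_orient_nonpos h₁ h₂
  have e₂ := orient_mul_orient_nonpos h₂ h₁
  simp only [orient_toReal] at e₁ e₂
  norm_cast at e₁ e₂
  rcases h with h | h <;> omega

lemma eq_of_mem_segments {a b c d : ℤ × ℤ} (h : orient a b c ≠ orient a b d) {p q : ℝ × ℝ}
    (hp₁ : p ∈ segment ℝ (toReal a) (toReal b)) (hp₂ : p ∈ segment ℝ (toReal c) (toReal d))
    (hq₁ : q ∈ segment ℝ (toReal a) (toReal b)) (hq₂ : q ∈ segment ℝ (toReal c) (toReal d)) :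
    p = q := by
  obtain ⟨s, -, -, rfl, hs⟩ := exists_combination hp₁ hp₂
  obtain ⟨t, -, -, rfl, ht⟩ := exists_combination hq₁ hq₂
  simp only [orient_toReal] at hs ht
  have h' : ((orient a b d : ℤ) : ℝ) - ((orient a b c : ℤ) : ℝ) ≠ 0 := by
    rw [sub_ne_zero]; exact_mod_cast h.symm
  have : s = t := by
    have : (s - t) * (((orient a b d : ℤ) : ℝ) - ((orient a b c : ℤ) : ℝ)) = 0 := by
      linear_combination hs - ht
    rcases mul_eq_zero.1 this with h | h
    · linarith
    · exact absurd h h'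
  rw [this]

/-! ### Relative position of two edges -/

lemma point_add (k t : ℕ) : point (16 * k + t) = (4 ^ k * (point t).1, 4 ^ k * (point t).2) := by
  have h₁ : (16 * k + t) / 16 = k + t / 16 := by omega
  have h₂ : (16 * k + t) % 16 = t % 16 := by omega
  simp only [point, h₁, h₂]
  push_cast
  ext <;> ring

lemma orient_point_add (k a b c : ℕ) :
    orient (point (16 * k + a)) (point (16 * k + b)) (point (16 * k + c)) =
      16 ^ k * orient (point a) (point b) (point c) := by
  have : (16 : ℤ) ^ k = 4 ^ k * 4 ^ k := by rw [← mul_pow]; norm_num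
  simp only [orient, point_add, this]
  ring

/-- The `e`-th and `f`-th edge of a common layer cross. -/
abbrev Crosses (e f : Fin 40) : Prop :=
  Crossing (point (ends e).1) (point (ends e).2) (point (ends f).1) (point (ends f).2)

/-- The edges with endpoints `a`, `b` and `c`, `d` share an endpoint and are not parallel. -/
abbrev Touching (a b c d : ℕ) : Prop :=
  orient (point a) (point b) (point c) ≠ orient (point a) (point b) (point d) ∧
    (a = c ∨ a = d ∨ b = c ∨ b = d)

lemma same_layer : ∀ e f : Fin 40, e = f ∨
    Apart (point (ends e).1) (point (ends e).2) (point (ends f).1) (point (ends f).2) ∨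
    Touching (ends e).1 (ends e).2 (ends f).1 (ends f).2 ∨ Crosses e f := by
  decide +kernel

lemma next_layer : ∀ e f : Fin 40,
    Apart (point (ends e).1) (point (ends e).2)
      (point (16 * 1 + (ends f).1)) (point (16 * 1 + (ends f).2)) ∨
    Touching (ends e).1 (ends e).2 (16 * 1 + (ends f).1) (16 * 1 + (ends f).2) := by
  decide +kernel

lemma far_bound : ∀ f : Fin 40, ∀ t : Fin 32,
    |((point (ends f).2).1 - (point (ends f).1).1) * (point t).2 -
      ((point (ends f).2).2 - (point (ends f).1).2) * (point t).1| <
    16 * |(point (ends f).1).1 * (point (ends f).2).2 -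
      (point (ends f).1).2 * (point (ends f).2).1| := by
  decide +kernel

lemma add_mul_add_pos {x y z : ℤ} (hx : |x| < |z|) (hy : |y| < |z|) : 0 < (z + x) * (z + y) := by
  rw [abs_lt] at hx hy
  rcases abs_cases z with ⟨h, -⟩ | ⟨h, -⟩ <;> rw [h] at hx hy
  · exact mul_pos (by omega) (by omega)
  · exact mul_pos_of_neg_of_neg (by omega) (by omega)

lemma far_layer {m : ℕ} (hm : 2 ≤ m) (e f : Fin 40) :
    Apart (point (ends e).1) (point (ends e).2) (point (lo m f)) (point (hi m f)) := by
  right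
  set D := (point (ends f).1).1 * (point (ends f).2).2 -
      (point (ends f).1).2 * (point (ends f).2).1 with hD
  have key (t : ℕ) : orient (point (lo m f)) (point (hi m f)) (point t) =
      4 ^ m * (4 ^ m * D + (((point (ends f).2).1 - (point (ends f).1).1) * (point t).2 -
      ((point (ends f).2).2 - (point (ends f).1).2) * (point t).1)) := by
    simp only [orient, lo, hi, point_add, hD]; ring
  have h16 : (16 : ℤ) ≤ 4 ^ m := by
    calc (16 : ℤ) = 4 ^ 2 := by norm_num
      _ ≤ 4 ^ m := pow_le_pow_right₀ (by norm_num) hm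
  have hz : 16 * |D| ≤ |4 ^ m * D| := by
    rw [abs_mul, abs_of_pos (by positivity : (0 : ℤ) < 4 ^ m)]
    exact mul_le_mul_of_nonneg_right h16 (abs_nonneg _)
  have he := ends_bounds e
  have h₁ := (far_bound f ⟨(ends e).1, by omega⟩).trans_le hz
  have h₂ := (far_bound f ⟨(ends e).2, by omega⟩).trans_le hz
  have := add_mul_add_pos h₁ h₂
  rw [key, key, mul_mul_mul_comm]
  exact mul_pos (by positivity) this

/-- The possible relative positions of two edges. -/
def Position (k : ℕ) (e : Fin 40) (l : ℕ) (f : Fin 40) : Prop :=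
  Apart (point (lo k e)) (point (hi k e)) (point (lo l f)) (point (hi l f)) ∨
    Touching (lo k e) (hi k e) (lo l f) (hi l f) ∨ k = l ∧ Crosses e f

lemma Position.symm {k l : ℕ} {e f : Fin 40} (h : Position k e l f) : Position l f k e := by
  rcases h with h | ⟨h, h'⟩ | ⟨rfl, h⟩
  · exact Or.inl (Or.symm h)
  · refine Or.inr (Or.inl ⟨?_, by tauto⟩)
    rw [← sub_ne_zero, orient_add_sub_orient, sub_ne_zero]
    exact h.symm
  · exact Or.inr (Or.inr ⟨rfl, And.symm h⟩)

lemma Position.shift {m : ℕ} {e f : Fin 40} (k : ℕ) (h : Position 0 e m f) :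
    Position k e (k + m) f := by
  have h₁ : lo k e = 16 * k + lo 0 e := by simp [lo]
  have h₂ : hi k e = 16 * k + hi 0 e := by simp [hi]
  have h₃ : lo (k + m) f = 16 * k + lo m f := by simp only [lo]; ring
  have h₄ : hi (k + m) f = 16 * k + hi m f := by simp only [hi]; ring
  have hpos : (0 : ℤ) < 16 ^ k := by positivity
  unfold Position Apart Touching
  simp only [h₁, h₂, h₃, h₄, orient_point_add, mul_mul_mul_comm, mul_pos_iff_of_pos_left,
    mul_pos hpos hpos, ne_eq, mul_right_inj' hpos.ne', add_right_inj]
  rcases h with h | h | ⟨h, h'⟩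
  · exact Or.inl h
  · exact Or.inr (Or.inl h)
  · exact Or.inr (Or.inr ⟨by omega, h'⟩)

lemma position_of_ne {k l : ℕ} {e f : Fin 40} (h : (k, e) ≠ (l, f)) : Position k e l f := by
  wlog hkl : k ≤ l generalizing k l e f
  · exact (this h.symm (by omega)).symm
  obtain ⟨m, rfl⟩ := Nat.exists_eq_add_of_le hkl
  apply Position.shift
  match m with
  | 0 =>
    have hef : e ≠ f := by rintro rfl; exact h rfl
    have := (same_layer e f).resolve_left hef
    simp only [Position, lo, hi, mul_zero, zero_add, true_and]
    exact this
  | 1 =>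
    have := next_layer e f
    simp only [Position, lo, hi, mul_zero, zero_add]
    tauto
  | m + 2 =>
    have := far_layer (m := m + 2) (by omega) e f
    left
    simpa only [lo, hi, mul_zero, zero_add] using this

/-! ### The drawing -/

/-- The position of the vertex `t` in the real plane. -/
def vertex (t : ℕ) : ℝ × ℝ := toReal (point t)

lemma basePoint_bounds : ∀ i : Fin 16,
    7 ≤ max |(basePoint i).1| |(basePoint i).2| ∧ max |(basePoint i).1| |(basePoint i).2| ≤ 12 := by
  decide +kernel

lemma basePoint_injective : ∀ i j : Fin 16, basePoint i = basePoint j → i = j := by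
  decide +kernel

lemma point_injective : Function.Injective point := by
  intro s t h
  wlog hst : s / 16 ≤ t / 16 generalizing s t
  · exact (this h.symm (by omega)).symm
  have hs := basePoint_bounds ⟨s % 16, Nat.mod_lt _ (by norm_num)⟩
  have ht := basePoint_bounds ⟨t % 16, Nat.mod_lt _ (by norm_num)⟩
  have hinj := basePoint_injective ⟨s % 16, Nat.mod_lt _ (by norm_num)⟩
    ⟨t % 16, Nat.mod_lt _ (by norm_num)⟩
  simp only [Fin.mk.injEq] at hs ht hinj
  have hnorm (r : ℕ) : max |(point r).1| |(point r).2| =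
      4 ^ (r / 16) * max |(basePoint (r % 16)).1| |(basePoint (r % 16)).2| := by
    simp only [point, abs_mul]
    rw [← mul_max_of_nonneg _ _ (abs_nonneg _)]
    simp
  obtain ⟨m, hm⟩ := Nat.exists_eq_add_of_le hst
  have hn : max |(point s).1| |(point s).2| = max |(point t).1| |(point t).2| := by rw [h]
  have hpos : (0 : ℤ) < 4 ^ (s / 16) := by positivity
  rw [hnorm, hnorm, hm, pow_add, mul_assoc, mul_right_inj' hpos.ne'] at hn
  have hm0 : m = 0 := by
    by_contra hm0
    have : (4 : ℤ) ≤ 4 ^ m := le_self_pow₀ (by norm_num) hm0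
    nlinarith
  have hq : s / 16 = t / 16 := by omega
  have : basePoint (s % 16) = basePoint (t % 16) := by
    simp only [point, hq, Prod.mk.injEq] at h
    have hne : ((4 ^ (t / 16) : ℕ) : ℤ) ≠ 0 := by positivity
    exact Prod.ext (mul_left_cancel₀ hne h.1) (mul_left_cancel₀ hne h.2)
  have := hinj this
  omega

lemma vertex_injective : Function.Injective vertex := toReal_injective.comp point_injective

/-- The segment representing the `e`-th edge of layer `k`. -/
def edgeSegment (k : ℕ) (e : Fin 40) : Set (ℝ × ℝ) :=
  segment ℝ (vertex (lo k e)) (vertex (hi k e))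

lemma IsEdge.segment_eq {u v k : ℕ} {e : Fin 40} (h : IsEdge u v k e) :
    segment ℝ (vertex u) (vertex v) = edgeSegment k e := by
  rcases h with ⟨rfl, rfl⟩ | ⟨rfl, rfl⟩
  · rfl
  · exact segment_symm _ _ _

lemma Crosses.orient_ne {e f : Fin 40} (h : Crosses e f) (k : ℕ) :
    orient (point (lo k e)) (point (hi k e)) (point (lo k f)) ≠
      orient (point (lo k e)) (point (hi k e)) (point (hi k f)) := by
  intro heq
  simp only [lo, hi, orient_point_add] at heq
  have := mul_left_cancel₀ (by positivity) heq
  have h' := h.1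
  rw [this] at h'
  exact absurd h' (not_lt.2 (mul_self_nonneg _))

lemma edgeSegment_inter_subsingleton {k l : ℕ} {e f : Fin 40} (h : (k, e) ≠ (l, f)) :
    (edgeSegment k e ∩ edgeSegment l f).Subsingleton := by
  rintro p ⟨hp₁, hp₂⟩ q ⟨hq₁, hq₂⟩
  rcases position_of_ne h with h' | h' | ⟨rfl, h'⟩
  · exact (h'.notMem hp₁ hp₂).elim
  · exact eq_of_mem_segments h'.1 hp₁ hp₂ hq₁ hq₂
  · exact eq_of_mem_segments (Crosses.orient_ne h' k) hp₁ hp₂ hq₁ hq₂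

lemma Touching.exists_common {k l : ℕ} {e f : Fin 40}
    (h : Touching (lo k e) (hi k e) (lo l f) (hi l f)) :
    ∃ w, (w = lo k e ∨ w = hi k e) ∧ (w = lo l f ∨ w = hi l f) := by
  rcases h.2 with h | h | h | h
  exacts [⟨_, .inl rfl, .inl h⟩, ⟨_, .inl rfl, .inr h⟩, ⟨_, .inr rfl, .inl h⟩,
    ⟨_, .inr rfl, .inr h⟩]

lemma vertex_mem_edgeSegment {k w : ℕ} {e : Fin 40} (h : w = lo k e ∨ w = hi k e) :
    vertex w ∈ edgeSegment k e := by
  rcases h with rfl | rfl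
  exacts [left_mem_segment _ _ _, right_mem_segment _ _ _]

/-- Distinct edges meet in a common endpoint or at a proper crossing. -/
lemma endpoint_or_crosses {k l : ℕ} {e f : Fin 40} (h : (k, e) ≠ (l, f)) {p : ℝ × ℝ}
    (hp₁ : p ∈ edgeSegment k e) (hp₂ : p ∈ edgeSegment l f) :
    (∃ w, (w = lo k e ∨ w = hi k e) ∧ (w = lo l f ∨ w = hi l f) ∧ p = vertex w) ∨
      k = l ∧ Crosses e f := by
  rcases position_of_ne h with h' | h' | h'
  · exact (h'.notMem hp₁ hp₂).elim
  · obtain ⟨w, hw₁, hw₂⟩ := h'.exists_common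
    exact Or.inl ⟨w, hw₁, hw₂, edgeSegment_inter_subsingleton h ⟨hp₁, hp₂⟩
      ⟨vertex_mem_edgeSegment hw₁, vertex_mem_edgeSegment hw₂⟩⟩
  · exact Or.inr h'

lemma eq_of_vertex_mem {k w : ℕ} {e : Fin 40} (h : vertex w ∈ edgeSegment k e) :
    w = lo k e ∨ w = hi k e := by
  obtain ⟨f, hf⟩ := exists_ends_fst ⟨w % 16, Nat.mod_lt _ (by norm_num)⟩
  have hw : w = lo (w / 16) f := by simp only [lo, hf]; omega
  by_cases hne : (k, e) = (w / 16, f)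
  · simp only [Prod.mk.injEq] at hne
    rw [hne.1, hne.2]
    exact Or.inl hw
  rcases endpoint_or_crosses hne h (vertex_mem_edgeSegment (.inl hw)) with
    ⟨w', h₁, -, h₂⟩ | ⟨hk, h'⟩
  · rwa [vertex_injective h₂]
  · exfalso
    obtain ⟨t, -, -, -, ht⟩ := exists_combination h (left_mem_segment ℝ (vertex w) (vertex w))
    have h0 : orient (vertex (lo k e)) (vertex (hi k e)) (vertex w) = 0 := by linarith
    rw [hw, ← hk] at h0
    rw [vertex, vertex, vertex, orient_toReal, Int.cast_eq_zero] at h0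
    simp only [lo, hi, orient_point_add] at h0
    have h0' := (mul_eq_zero.1 h0).resolve_left (by positivity)
    have := h'.1
    rw [h0', zero_mul] at this
    exact lt_irrefl _ this

lemma card_crosses_le : ∀ e : Fin 40, (Finset.univ.filter (Crosses e)).card ≤ 2 := by
  decide +kernel

lemma not_crosses_self : ∀ e : Fin 40, ¬ Crosses e e := by
  decide +kernel

/-- Crossing edges belong to different matchings. -/
lemma Crosses.matching_ne : ∀ e f : Fin 40, Crosses e f → decide (e < 32) ≠ decide (f < 32) := by
  decide +kernel

/-- `p` lies on the `e`-th edge of layer `k` and is not one of its endpoints. -/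
def IsInterior (k : ℕ) (e : Fin 40) (p : ℝ × ℝ) : Prop :=
  p ∈ edgeSegment k e ∧ ∀ w, w = lo k e ∨ w = hi k e → p ≠ vertex w

lemma range_lineMap (a b : ℝ × ℝ) :
    Set.range (fun t : I => AffineMap.lineMap a b (t : ℝ)) = segment ℝ a b := by
  rw [segment_eq_image_lineMap, Set.image_eq_range]

lemma IsEdge.isInterior {u v k : ℕ} {e : Fin 40} (h : IsEdge u v k e) {t : I} (h₀ : t ≠ 0)
    (h₁ : t ≠ 1) : IsInterior k e (AffineMap.lineMap (vertex u) (vertex v) (t : ℝ)) := by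
  have hlt := lo_lt_hi k e
  have hne : vertex u ≠ vertex v := by
    refine vertex_injective.ne ?_
    rcases h with ⟨rfl, rfl⟩ | ⟨rfl, rfl⟩ <;> omega
  have hinj := AffineMap.lineMap_injective ℝ hne
  have hu : AffineMap.lineMap (vertex u) (vertex v) (t : ℝ) ≠ vertex u := fun hp =>
    h₀ (Subtype.ext (hinj (by simpa using hp)))
  have hv : AffineMap.lineMap (vertex u) (vertex v) (t : ℝ) ≠ vertex v := fun hp =>
    h₁ (Subtype.ext (hinj (by simpa using hp)))
  refine ⟨?_, fun w hw => ?_⟩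
  · rw [← h.segment_eq, ← range_lineMap]
    exact ⟨t, rfl⟩
  · rcases h with ⟨rfl, rfl⟩ | ⟨rfl, rfl⟩ <;> rcases hw with rfl | rfl <;> assumption

lemma IsInterior.crosses {k l : ℕ} {e f : Fin 40} {p : ℝ × ℝ} (h₁ : IsInterior k e p)
    (h₂ : IsInterior l f p) (h : (k, e) ≠ (l, f)) : k = l ∧ Crosses e f := by
  rcases endpoint_or_crosses h h₁.1 h₂.1 with ⟨w, hw, -, hp⟩ | h'
  · exact (h₁.2 w hw hp).elim
  · exact h'

section Drawing

variable {V : Type*} (f : V → ℕ) (hf : Function.Injective f)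

lemma IsEdge.ne_of_sym2_ne {f : V → ℕ} (hf : Function.Injective f) {u v x y : V} {k l : ℕ}
    {e e' : Fin 40} (h : IsEdge (f u) (f v) k e) (h' : IsEdge (f x) (f y) l e')
    (hne : s(u, v) ≠ s(x, y)) : (k, e) ≠ (l, e') := by
  rintro heq
  obtain ⟨rfl, rfl⟩ := Prod.mk.inj heq
  apply hne
  apply Sym2.map.injective hf
  simpa only [Sym2.map_mk] using h.sym2_eq.trans h'.sym2_eq.symm

/-- The straight-line drawing of a pullback of the annular graph. -/
noncomputable def drawing : PlaneDrawing (graph.comap f) where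
  pos v := vertex (f v)
  pos_inj := vertex_injective.comp hf
  arc u v _ :=
    { toFun := fun t => AffineMap.lineMap (vertex (f u)) (vertex (f v)) (t : ℝ)
      continuous_toFun := by fun_prop
      source' := by simp
      target' := by simp }
  arc_symm u v h := by
    apply Path.ext
    funext t
    exact (AffineMap.lineMap_apply_one_sub _ _ _).symm
  arc_inj u v h := by
    intro s t hst
    have hne : vertex (f u) ≠ vertex (f v) := vertex_injective.ne (hf.ne h.ne)
    exact Subtype.ext (AffineMap.lineMap_injective ℝ hne hst)
  no_vertex_mem u v h w t ht := by
    obtain ⟨k, e, hk⟩ := h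
    have : vertex (f w) ∈ segment ℝ (vertex (f u)) (vertex (f v)) := by
      rw [← range_lineMap]; exact ⟨t, ht⟩
    rw [hk.segment_eq] at this
    have := eq_of_vertex_mem this
    rcases hk with ⟨h₁, h₂⟩ | ⟨h₁, h₂⟩ <;> rw [← h₁, ← h₂] at this
    · exact this.imp (hf ·) (hf ·)
    · exact this.symm.imp (hf ·) (hf ·)
  finite_inter u v x y h₁ h₂ hne := by
    obtain ⟨k, e, hk⟩ := h₁
    obtain ⟨l, e', hl⟩ := h₂
    change (Set.range (fun t : I => AffineMap.lineMap (vertex (f u)) (vertex (f v)) (t : ℝ)) ∩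
      Set.range (fun t : I => AffineMap.lineMap (vertex (f x)) (vertex (f y)) (t : ℝ))).Finite
    rw [range_lineMap, range_lineMap, hk.segment_eq, hl.segment_eq]
    exact (edgeSegment_inter_subsingleton (hk.ne_of_sym2_ne hf hl hne)).finite
  no_triple_point u₁ v₁ u₂ v₂ u₃ v₃ h₁ h₂ h₃ h₁₂ h₁₃ h₂₃ t₁ t₂ t₃ a₁ b₁ a₂ b₂ a₃ b₃ e₁₂ e₂₃ := by
    obtain ⟨k, e, hk⟩ := h₁
    obtain ⟨l, e', hl⟩ := h₂
    obtain ⟨m, e'', hm⟩ := h₃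
    have i₁ := hk.isInterior a₁ b₁
    have i₂ := hl.isInterior a₂ b₂
    have i₃ := hm.isInterior a₃ b₃
    have e₁₂' : AffineMap.lineMap (vertex (f u₁)) (vertex (f v₁)) (t₁ : ℝ) =
      AffineMap.lineMap (vertex (f u₂)) (vertex (f v₂)) (t₂ : ℝ) := e₁₂
    have e₂₃' : AffineMap.lineMap (vertex (f u₂)) (vertex (f v₂)) (t₂ : ℝ) =
      AffineMap.lineMap (vertex (f u₃)) (vertex (f v₃)) (t₃ : ℝ) := e₂₃
    rw [e₁₂', e₂₃'] at i₁
    rw [e₂₃'] at i₂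
    have c₁₂ := Crosses.matching_ne _ _ (i₁.crosses i₂ (hk.ne_of_sym2_ne hf hl h₁₂)).2
    have c₁₃ := Crosses.matching_ne _ _ (i₁.crosses i₃ (hk.ne_of_sym2_ne hf hm h₁₃)).2
    have c₂₃ := Crosses.matching_ne _ _ (i₂.crosses i₃ (hl.ne_of_sym2_ne hf hm h₂₃)).2
    generalize decide (e < 32) = x, decide (e' < 32) = y, decide (e'' < 32) = z at c₁₂ c₁₃ c₂₃
    cases x <;> cases y <;> cases z <;> simp_all

lemma isInterior_of_isInteriorPoint {u v : V} (h : (graph.comap f).Adj u v) {k : ℕ} {e : Fin 40}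
    (hk : IsEdge (f u) (f v) k e) {p : ℝ × ℝ} (hp : (drawing f hf).IsInteriorPoint h p) :
    IsInterior k e p := by
  obtain ⟨t, h₀, h₁, rfl⟩ := hp
  exact hk.isInterior h₀ h₁

lemma drawing_isKPlane : (drawing f hf).IsKPlane 2 := by
  intro u v h
  obtain ⟨k, e, hk⟩ := id h
  have key : ∀ p ∈ (drawing f hf).edgeCrossings h, ∃ e', Crosses e e' ∧
      p ∈ edgeSegment k e ∩ edgeSegment k e' := by
    rintro p ⟨hp, x, y, h', hne, hp'⟩
    obtain ⟨l, e', hl⟩ := id h'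
    have i₁ := isInterior_of_isInteriorPoint f hf h hk hp
    have i₂ := isInterior_of_isInteriorPoint f hf h' hl hp'
    obtain ⟨rfl, hc⟩ := i₁.crosses i₂ (hk.ne_of_sym2_ne hf hl hne)
    exact ⟨e', hc, i₁.1, i₂.1⟩
  choose! g hg hmem using key
  refine le_trans ?_ (card_crosses_le e)
  rw [← Set.ncard_coe_finset]
  refine Set.ncard_le_ncard_of_injOn g (fun p hp => by simpa using hg p hp) ?_
    (Finset.finite_toSet _)
  intro p hp q hq hpq
  refine edgeSegment_inter_subsingleton (e := e) (f := g p) (k := k) (l := k) ?_ (hmem p hp)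
    (hpq ▸ hmem q hq)
  intro heq
  have := hg p hp
  rw [← (Prod.mk.inj heq).2] at this
  exact not_crosses_self e this

end Drawing

lemma le_ncard_edgeSet (n : ℕ) :
    40 * (n / 16 - 1) ≤ (graph.comap ((↑) : Fin n → ℕ)).edgeSet.ncard := by
  have hlt (k : Fin (n / 16 - 1)) (e : Fin 40) : lo k e < n ∧ hi k e < n := by
    have := ends_bounds e
    have := k.isLt
    simp only [lo, hi]; omega
  let g : Fin 40 × Fin (n / 16 - 1) → (graph.comap ((↑) : Fin n → ℕ)).edgeSet := fun x =>
    ⟨s(⟨lo x.2 x.1, (hlt x.2 x.1).1⟩, ⟨hi x.2 x.1, (hlt x.2 x.1).2⟩),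
      ⟨x.2, x.1, Or.inl ⟨rfl, rfl⟩⟩⟩
  have hg : Function.Injective g := by
    rintro ⟨e, k⟩ ⟨e', k'⟩ h
    have h' := Subtype.mk.inj h
    have := lo_lt_hi k e
    have := lo_lt_hi k' e'
    have := ends_bounds e
    have := ends_bounds e'
    rw [Sym2.eq_iff] at h'
    simp only [Fin.mk.injEq] at h'
    have hlo : lo k e = lo k' e' := by omega
    have hhi : hi k e = hi k' e' := by omega
    simp only [lo, hi] at hlo hhi
    have hk : k = k' := Fin.ext (by omega)
    have he : e = e' := ends_injective (Prod.ext (by omega) (by omega))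
    rw [hk, he]
  have := Nat.card_le_card_of_injective g hg
  simpa using this

end AnnularGraph

theorem stmt_12 :
    ∃ (C : ℝ) (N : ℕ), 0 ≤ C ∧ ∀ n : ℕ, N ≤ n →
      ∃ G : SimpleGraph (Fin n), HasNoCycleOfLength G 4 ∧ KPlanar G 2 ∧
        (5 / 2 : ℝ) * n - C ≤ G.edgeSet.ncard := by
  refine ⟨80, 0, by norm_num, fun n _ => ⟨AnnularGraph.graph.comap ((↑) : Fin n → ℕ),
    AnnularGraph.hasNoCycleOfLength_four _ Fin.val_injective,
    ⟨AnnularGraph.drawing _ Fin.val_injective, AnnularGraph.drawing_isKPlane _ _⟩, ?_⟩⟩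
  have h := AnnularGraph.le_ncard_edgeSet n
  have h' : 5 * n ≤ 2 * (AnnularGraph.graph.comap ((↑) : Fin n → ℕ)).edgeSet.ncard + 160 := by
    omega
  have h'' : (5 : ℝ) * n ≤
      2 * (AnnularGraph.graph.comap ((↑) : Fin n → ℕ)).edgeSet.ncard + 160 := by
    exact_mod_cast h'
  linarith
end
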